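/- Let $(Y,\mu)$ be a probability space, $F:Y\to Y$ a measure-preserving map, and $\varphi:Y\to\{1,2,3,\dots\}$ a measurable function such that $\mu(\varphi>n)=\ell(n)n^{-\beta}$ for all $n\ge 1$, where $\beta\in(0,\tfrac12]$ and $\ell:(0,\infty)\to(0,\infty)$ is slowly varying, i.e. measurable, bounded above and below by positive constants on each compact subset of $(0,\infty)$, and $\lim_{x\to\infty}\ell(cx)/\ell(x)=1$ for every $c>0$. Let $R:L^1(Y,\mu)\to L^1(Y,\mu)$ be the transfer operator of $F$, characterized by $\int_Y (Rv)\,w\,d\mu=\int_Y v\,(w\circ F)\,d\mu$ for all $v\in L^1(Y,\mu)$, $w\in L^\infty(Y,\mu)$, and for $n\ge1$ put $R_nv=R(1_{\{\varphi=n\}}v)$. Let $\mathcal B\subset L^\infty(Y,\mu)$ be a linear subspace containing the constant functions which is a complex Banach space for a norm $\|\cdot\|$ satisfying $|v|_\infty\le\|v\|$ for all $v\in\mathcal B$. Assume: (H1) each $R_n$ maps $\mathcal B$ boundedly into $\mathcal B$, and there is a constant $C>0$ such that $\|R_n\|_{\mathcal B}\le C\mu(\varphi=n)$ for all $n\ge1$.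 Put $R(z)=\sum_{n\ge1}z^nR_n$, a bounded operator on $\mathcal B$ for each complex $z$ with $|z|\le1$; in particular $R(1)=R|_{\mathcal B}$. (H2) (i) $1$ is a simple isolated eigenvalue of $R(1)$ on $\mathcal B$, meaning that $1$ is an eigenvalue and an isolated point of the spectrum of $R(1)$, and that the corresponding spectral projection $\frac{1}{2\pi i}\oint_{|\zeta-1|=r}(\zeta-R(1))^{-1}\,d\zeta$ (with $r>0$ so small that $1$ is the only point of the spectrum in $\{|\zeta-1|\le r\}$) has rank one; (ii) for every $z\in\mathbb C$ with $|z|\le1$ and $z\ne1$, $1$ does not belong to the spectrum of $R(z)$ on $\mathcal B$. Define $T_n:\mathcal B\to\mathcal B$ by $T_0=I$ and $T_n=\sum_{j=1}^nT_{n-j}R_j$ for $n\ge1$. Then for every real-valued $v\in\mathcal B$ and $\mu$-almost every $y\in Y$ there exists a set $E\subset\mathbb N$ of density zero, i.e. $\frac1n\#\{j\in E:1\le j\le n\}\to0$, such that $$\lim_{n\to\infty,\;n\notin E}\ell(n)\,n^{1-\beta}\,(T_nv)(y)=\frac{\sin\beta\pi}{\pi}\int_Yv\,d\mu .$$ -/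

import Mathlib

open MeasureTheory Filter Topology
open scoped ENNReal

/-- `l : (0,∞) → (0,∞)` is slowly varying: measurable, bounded above and below by positive
constants on each compact subset of `(0,∞)`, and `l (c x) / l x → 1` as `x → ∞` for every
`c > 0`. Only the values of `l` on `(0,∞)` are constrained. -/
def SlowlyVarying (l : ℝ → ℝ) : Prop :=
  (∀ x : ℝ, 0 < x → 0 < l x) ∧
  Measurable (fun x : Set.Ioi (0 : ℝ) => l x) ∧
  (∀ K : Set ℝ, IsCompact K → K ⊆ Set.Ioi 0 →
    ∃ c C : ℝ, 0 < c ∧ ∀ x ∈ K, c ≤ l x ∧ l x ≤ C) ∧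
  ∀ c : ℝ, 0 < c → Tendsto (fun x => l (c * x) / l x) atTop (𝓝 1)

/-- `E ⊆ ℕ` has density zero: `(1/n) #{j ∈ E : 1 ≤ j ≤ n} → 0`. -/
def HasDensityZero (E : Set ℕ) : Prop :=
  Tendsto (fun n : ℕ => ((E ∩ Set.Icc 1 n).ncard : ℝ) / n) atTop (𝓝 0)

section Transfer

variable {Y : Type*} [MeasurableSpace Y]

/-- `u` is the image of `v` under the transfer operator of `F`:
`u` is integrable and `∫ u w dμ = ∫ v (w ∘ F) dμ` for all bounded measurable `w`. -/
def IsTransferImage (μ : Measure Y) (F : Y → Y) (v u : Y → ℂ) : Prop :=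
  Integrable u μ ∧
  ∀ w : Y → ℂ, Measurable w → (∃ M : ℝ, ∀ y, ‖w y‖ ≤ M) →
    ∫ y, u y * w y ∂μ = ∫ y, v y * w (F y) ∂μ

/-- The image under the transfer operator exists for every integrable `v`. -/
theorem IsTransferImage.exists {μ : Measure Y} [IsProbabilityMeasure μ] {F : Y → Y}
    (hF : MeasurePreserving F μ μ) {v : Y → ℂ} (hv : Integrable v μ) :
    ∃ u, IsTransferImage μ F v u := by
  have hm := hF.measurable.comap_le
  obtain ⟨u, hu, hvu⟩ := (stronglyMeasurable_condExp (μ := μ) (f := v)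
    (m := MeasurableSpace.comap F inferInstance)).measurable.exists_eq_measurable_comp
  have hint : Integrable (u ∘ F) μ := hvu ▸ integrable_condExp
  refine ⟨u, (hF.integrable_comp hu.aestronglyMeasurable).1 hint, ?_⟩
  rintro w hw ⟨M, hM⟩
  have hwF : StronglyMeasurable[MeasurableSpace.comap F inferInstance] (w ∘ F) :=
    (hw.comp (comap_measurable F)).stronglyMeasurable
  have hvw : Integrable (fun y => v y * w (F y)) μ :=
    hv.mul_bdd (c := M) (hw.comp hF.measurable).aestronglyMeasurable
      (Eventually.of_forall fun y => hM (F y))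
  have h1 := condExp_bilin_of_stronglyMeasurable_right (μ := μ)
    (ContinuousLinearMap.mul ℝ ℂ) hwF hvw hv
  calc ∫ y, u y * w y ∂μ = ∫ y, u (F y) * w (F y) ∂μ := by
        conv_lhs => rw [← hF.map_eq]
        exact integral_map hF.measurable.aemeasurable (hu.mul hw).aestronglyMeasurable
    _ = ∫ y, (μ[fun y => v y * w (F y) | MeasurableSpace.comap F inferInstance]) y ∂μ := by
        refine integral_congr_ae ?_
        filter_upwards [h1] with y hy
        refine Eq.trans ?_ hy.symm
        rw [hvu]
        rfl
    _ = ∫ y, v y * w (F y) ∂μ := integral_condExp hm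

/-- The image under the transfer operator is unique up to null sets. -/
theorem IsTransferImage.ae_eq {μ : Measure Y} {F : Y → Y} {v u u' : Y → ℂ}
    (h : IsTransferImage μ F v u) (h' : IsTransferImage μ F v u') : u =ᵐ[μ] u' := by
  refine Integrable.ae_eq_of_forall_setIntegral_eq _ _ h.1 h'.1 fun s hs _ => ?_
  have hw : Measurable (s.indicator fun _ => (1 : ℂ)) := measurable_const.indicator hs
  have hb : ∃ M : ℝ, ∀ y, ‖s.indicator (fun _ => (1 : ℂ)) y‖ ≤ M :=
    ⟨1, fun y => (norm_indicator_le_norm_self _ _).trans (by simp)⟩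
  have key := (h.2 _ hw hb).trans (h'.2 _ hw hb).symm
  have e : ∀ g : Y → ℂ, (fun y => g y * s.indicator (fun _ => (1 : ℂ)) y) = s.indicator g := by
    intro g
    funext y
    by_cases hy : y ∈ s <;> simp [hy]
  rwa [e, e, integral_indicator hs, integral_indicator hs] at key

open Classical in
/-- The transfer operator `R` of `F`, on integrable functions (defined up to null sets). -/
noncomputable def transferOperator (μ : Measure Y) (F : Y → Y) (v : Y → ℂ) : Y → ℂ :=
  if h : ∃ u, IsTransferImage μ F v u then h.choose else 0

theorem transferOperator_spec {μ : Measure Y} [IsProbabilityMeasure μ] {F : Y → Y}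
    (hF : MeasurePreserving F μ μ) {v : Y → ℂ} (hv : Integrable v μ) :
    IsTransferImage μ F v (transferOperator μ F v) := by
  have h := IsTransferImage.exists hF hv
  rw [transferOperator, dif_pos h]
  exact h.choose_spec

end Transfer

section Operators

variable {B : Type*} [NormedAddCommGroup B] [NormedSpace ℂ B]

/-- `R(z) = ∑_{n ≥ 1} zⁿ R_n`. The value `Rn 0` is not used. -/
noncomputable def returnSeries (Rn : ℕ → B →L[ℂ] B) (z : ℂ) : B →L[ℂ] B :=
  ∑' n : ℕ, z ^ (n + 1) • Rn (n + 1)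

/-- The renewal operators: `T_0 = I` and `T_n = ∑_{j=1}^n T_{n-j} R_j` for `n ≥ 1`. -/
noncomputable def renewalOperator (Rn : ℕ → B →L[ℂ] B) : ℕ → B →L[ℂ] B
  | 0 => ContinuousLinearMap.id ℂ B
  | n + 1 => ∑ j : Fin (n + 1), (renewalOperator Rn (n - j)).comp (Rn (j + 1))
  termination_by n => n
  decreasing_by omega

theorem renewalOperator_zero (Rn : ℕ → B →L[ℂ] B) :
    renewalOperator Rn 0 = ContinuousLinearMap.id ℂ B := by
  rw [renewalOperator]

theorem renewalOperator_eq (Rn : ℕ → B →L[ℂ] B) {n : ℕ} (hn : 1 ≤ n) :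
    renewalOperator Rn n
      = ∑ j ∈ Finset.Icc 1 n, (renewalOperator Rn (n - j)).comp (Rn j) := by
  obtain ⟨m, rfl⟩ : ∃ m, n = m + 1 := ⟨n - 1, by omega⟩
  rw [renewalOperator, Fin.sum_univ_eq_sum_range
    (fun j => (renewalOperator Rn (m - j)).comp (Rn (j + 1))) (m + 1),
    Finset.range_eq_Ico, Finset.sum_Ico_add' (fun j => (renewalOperator Rn (m + 1 - j)).comp (Rn j))
      0 (m + 1) 1 |>.symm.trans (Finset.sum_congr rfl fun j _ => by
        rw [Nat.add_sub_add_right]) |>.symm]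
  rfl

/-- The spectral (Riesz) projection of `A` for the part of its spectrum inside the circle of
centre `a` and radius `r`: `(2πi)⁻¹ ∮_{|ζ-a|=r} (ζ - A)⁻¹ dζ`. -/
noncomputable def spectralProjection (A : B →L[ℂ] B) (a : ℂ) (r : ℝ) : B →L[ℂ] B :=
  (2 * Real.pi * Complex.I : ℂ)⁻¹ • ∮ ζ in C(a, r), resolvent A ζ

/-- `a` is a simple isolated eigenvalue of `A`: it is an eigenvalue, an isolated point of the
spectrum, and its spectral projection has rank one (algebraic multiplicity one). -/
def IsSimpleIsolatedEigenvalue (A : B →L[ℂ] B) (a : ℂ) : Prop :=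
  Module.End.HasEigenvalue (A : B →ₗ[ℂ] B) a ∧
  ∃ r : ℝ, 0 < r ∧ spectrum ℂ A ∩ Metric.closedBall a r = {a} ∧
    Module.finrank ℂ (LinearMap.range (spectralProjection A a r : B →ₗ[ℂ] B)) = 1

/-- Hypothesis (H1): the operators `Rn n` on `B` satisfy `‖R_n‖ ≤ C μ(φ = n)` for `n ≥ 1`. -/
def HypothesisH1 {Y : Type*} [MeasurableSpace Y] (μ : Measure Y) (φ : Y → ℕ)
    (Rn : ℕ → B →L[ℂ] B) : Prop :=
  ∃ C : ℝ, 0 < C ∧ ∀ n : ℕ, 1 ≤ n → ‖Rn n‖ ≤ C * μ.real {y | φ y = n}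

/-- Hypothesis (H2): `1` is a simple isolated eigenvalue of `R(1)`, and `1` is not in the
spectrum of `R(z)` for `z ≠ 1` in the closed unit disk. -/
def HypothesisH2 (Rn : ℕ → B →L[ℂ] B) : Prop :=
  IsSimpleIsolatedEigenvalue (returnSeries Rn 1) 1 ∧
  ∀ z : ℂ, ‖z‖ ≤ 1 → z ≠ 1 → (1 : ℂ) ∉ spectrum ℂ (returnSeries Rn z)

end Operators

/-- A positive antitone function which is regularly varying of index `-β`. -/
structure IsRegVarTail (τ : ℝ → ℝ) (β : ℝ) : Prop where
  anti : Antitone τ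
  pos : ∀ x, 0 < τ x
  ratio : ∀ c : ℝ, 0 < c → Tendsto (fun x => τ (c * x) / τ x) atTop (𝓝 (c ^ (-β)))

theorem tendsto_natMul_ratio {l τ : ℝ → ℝ} {β : ℝ} (hl : SlowlyVarying l)
    (hτ : ∀ n : ℕ, 1 ≤ n → τ n = l n * (n : ℝ) ^ (-β)) {a b : ℕ} (ha : 1 ≤ a) (hb : 1 ≤ b) :
    Tendsto (fun k : ℕ => τ (a * k : ℝ) / τ (b * k : ℝ)) atTop
      (𝓝 (((a : ℝ) / b) ^ (-β))) := by
  have ha0 : (0 : ℝ) < a := by exact_mod_cast ha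
  have hb0 : (0 : ℝ) < b := by exact_mod_cast hb
  have h1 := (hl.2.2.2 a ha0).comp tendsto_natCast_atTop_atTop
  have h2 := (hl.2.2.2 b hb0).comp tendsto_natCast_atTop_atTop
  have h3 := ((h1.div h2 one_ne_zero).mul_const (((a : ℝ) / b) ^ (-β)))
  rw [div_one, one_mul] at h3
  refine h3.congr' ?_
  filter_upwards [eventually_ge_atTop 1] with k hk
  have hk0 : (0 : ℝ) < k := by exact_mod_cast hk
  have e1 := hτ (a * k) (Nat.mul_pos ha hk)
  have e2 := hτ (b * k) (Nat.mul_pos hb hk)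
  push_cast at e1 e2
  have p1 := hl.1 k hk0
  have p2 := hl.1 (b * k) (by positivity)
  simp only [Function.comp_apply, Pi.div_apply]
  rw [e1, e2, Real.mul_rpow ha0.le hk0.le, Real.mul_rpow hb0.le hk0.le,
    Real.div_rpow ha0.le hb0.le]
  have q1 : (0 : ℝ) < (k : ℝ) ^ (-β) := by positivity
  have q2 : (0 : ℝ) < (b : ℝ) ^ (-β) := by positivity
  field_simp

theorem IsRegVarTail.of_slowlyVarying {l τ : ℝ → ℝ} {β : ℝ} (hl : SlowlyVarying l)
    (hanti : Antitone τ) (hτ : ∀ n : ℕ, 1 ≤ n → τ n = l n * (n : ℝ) ^ (-β)) :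
    IsRegVarTail τ β := by
  have hpos : ∀ x, 0 < τ x := by
    intro x
    have h1 : x ≤ ((⌈x⌉₊ + 1 : ℕ) : ℝ) := by
      push_cast; linarith [Nat.le_ceil x]
    refine lt_of_lt_of_le ?_ (hanti h1)
    rw [hτ _ (by omega)]
    have := hl.1 ((⌈x⌉₊ + 1 : ℕ) : ℝ) (by positivity)
    positivity
  refine ⟨hanti, hpos, fun c hc => ?_⟩
  have hfl : Tendsto (fun b : ℕ => (⌊c * b⌋₊ : ℝ) / b) atTop (𝓝 c) :=
    (tendsto_nat_floor_mul_div_atTop hc.le).comp tendsto_natCast_atTop_atTop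
  have hup : Tendsto (fun b : ℕ => ((⌊c * b⌋₊ : ℝ) / ((b + 1 : ℕ) : ℝ)) ^ (-β)) atTop
      (𝓝 (c ^ (-β))) := by
    have h1 : Tendsto (fun b : ℕ => (⌊c * b⌋₊ : ℝ) / b * (b / ((b : ℝ) + 1))) atTop
        (𝓝 (c * 1)) := hfl.mul (tendsto_natCast_div_add_atTop 1)
    rw [mul_one] at h1
    refine (h1.congr' ?_).rpow_const (Or.inl hc.ne')
    filter_upwards [eventually_ge_atTop 1] with b hb
    have hb0 : (0 : ℝ) < b := by exact_mod_cast hb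
    push_cast
    field_simp
  have hlow : Tendsto (fun b : ℕ => (((⌊c * b⌋₊ + 2 : ℕ) : ℝ) / b) ^ (-β)) atTop
      (𝓝 (c ^ (-β))) := by
    have h1 : Tendsto (fun b : ℕ => (⌊c * b⌋₊ : ℝ) / b + 2 / (b : ℝ)) atTop
        (𝓝 (c + 0)) := hfl.add (tendsto_const_div_atTop_nhds_zero_nat 2)
    rw [add_zero] at h1
    refine (h1.congr' ?_).rpow_const (Or.inl hc.ne')
    filter_upwards [eventually_ge_atTop 1] with b hb
    push_cast
    ring
  have hbig : ∀ᶠ b : ℕ in atTop, 1 ≤ ⌊c * b⌋₊ := by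
    have : Tendsto (fun b : ℕ => c * (b : ℝ)) atTop atTop :=
      tendsto_natCast_atTop_atTop.const_mul_atTop hc
    filter_upwards [this.eventually_ge_atTop 1] with b hb
    exact Nat.le_floor (by simpa using hb)
  have hkb : ∀ b : ℕ, 1 ≤ b → Tendsto (fun x : ℝ => ⌊x / b⌋₊) atTop atTop := fun b hb =>
    tendsto_nat_floor_atTop.comp (tendsto_id.atTop_div_const (by exact_mod_cast hb))
  rw [tendsto_order]
  constructor
  · intro d hd
    obtain ⟨b, ⟨h1, -⟩, h3⟩ := (((hlow.eventually_const_lt hd).and hbig).and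
      (eventually_ge_atTop 1)).exists
    have hlim := tendsto_natMul_ratio hl hτ (a := ⌊c * b⌋₊ + 2) (b := b) (by omega) h3
    have hev := (hkb b h3).eventually
      ((hlim.eventually_const_lt h1).and (eventually_ge_atTop (⌊c * b⌋₊ + 1)))
    filter_upwards [hev, eventually_ge_atTop 0] with x hx hx0
    refine hx.1.trans_le ?_
    have hb0 : (0 : ℝ) < b := by exact_mod_cast h3
    set k := ⌊x / b⌋₊ with hk
    have k1 : (k : ℝ) ≤ x / b := Nat.floor_le (by positivity)
    have k2 : x / b < k + 1 := Nat.lt_floor_add_one _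
    have f2 : c * b < ⌊c * b⌋₊ + 1 := Nat.lt_floor_add_one _
    have k3 : ((⌊c * b⌋₊ : ℝ) + 1) ≤ k := by exact_mod_cast hx.2
    rw [le_div_iff₀ hb0] at k1
    rw [div_lt_iff₀ hb0] at k2
    have m1 : c * x ≤ ((⌊c * b⌋₊ + 2 : ℕ) : ℝ) * k := by
      push_cast
      have : c * x ≤ c * b * (k + 1) := by nlinarith
      nlinarith
    have m2 : (b : ℝ) * k ≤ x := by linarith
    exact div_le_div₀ (hpos _).le (hanti m1) (hpos _) (hanti m2)
  · intro d hd
    obtain ⟨b, ⟨h1, h2⟩, h3⟩ := (((hup.eventually_lt_const hd).and hbig).and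
      (eventually_ge_atTop 1)).exists
    have hlim := tendsto_natMul_ratio hl hτ (a := ⌊c * b⌋₊) (b := b + 1) h2 (by omega)
    have hev := (hkb b h3).eventually
      ((hlim.eventually_lt_const h1).and (eventually_ge_atTop b))
    filter_upwards [hev, eventually_ge_atTop 0] with x hx hx0
    refine lt_of_le_of_lt ?_ hx.1
    have hb0 : (0 : ℝ) < b := by exact_mod_cast h3
    set k := ⌊x / b⌋₊ with hk
    have k1 : (k : ℝ) ≤ x / b := Nat.floor_le (by positivity)
    have k2 : x / b < k + 1 := Nat.lt_floor_add_one _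
    have f2 : (⌊c * b⌋₊ : ℝ) ≤ c * b := Nat.floor_le (by positivity)
    have k3 : (b : ℝ) ≤ k := by exact_mod_cast hx.2
    rw [le_div_iff₀ hb0] at k1
    rw [div_lt_iff₀ hb0] at k2
    have m1 : (⌊c * b⌋₊ : ℝ) * k ≤ c * x := by
      calc (⌊c * b⌋₊ : ℝ) * k ≤ c * b * k := by gcongr
        _ = c * (k * b) := by ring
        _ ≤ c * x := by gcongr
    have m2 : x ≤ ((b + 1 : ℕ) : ℝ) * k := by
      push_cast; nlinarith
    exact div_le_div₀ (hpos _).le (hanti m1) (hpos _) (hanti m2)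

/-- Iterating a bound between `f y` and `f (2 y)`. -/
theorem le_pow_mul_of_doubling {f : ℝ → ℝ} {A x₀ : ℝ} (hA : 0 ≤ A) (hx₀ : 0 ≤ x₀)
    (h : ∀ y, x₀ ≤ y → f y ≤ A * f (2 * y)) (k : ℕ) :
    ∀ y, x₀ ≤ y → f y ≤ A ^ k * f (2 ^ k * y) := by
  induction k with
  | zero => intro y _; simp
  | succ k ih =>
    intro y hy
    refine (h y hy).trans ?_
    have h2 := ih (2 * y) (by linarith)
    calc A * f (2 * y) ≤ A * (A ^ k * f (2 ^ k * (2 * y))) := by gcongr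
      _ = A ^ (k + 1) * f (2 ^ (k + 1) * y) := by
        rw [pow_succ, pow_succ]; ring_nf

theorem exists_dyadic_between {x y : ℝ} (hy : 0 < y) (hyx : y ≤ x) :
    ∃ k : ℕ, 2 ^ k * y ≤ x ∧ x < 2 ^ (k + 1) * y := by
  obtain ⟨k, h1, h2⟩ := exists_nat_pow_near (x := x / y) (y := (2 : ℝ))
    ((one_le_div hy).2 hyx) one_lt_two
  exact ⟨k, (le_div_iff₀ hy).1 h1, (div_lt_iff₀ hy).1 h2⟩

theorem two_pow_rpow (b : ℝ) (k : ℕ) : ((2 : ℝ) ^ b) ^ k = ((2 : ℝ) ^ k) ^ b := by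
  rw [← Real.rpow_natCast, ← Real.rpow_mul two_pos.le, ← Real.rpow_natCast 2 k,
    ← Real.rpow_mul two_pos.le, mul_comm]

/-- Potter's bound, from below in the larger argument. -/
theorem IsRegVarTail.potter_upper {τ : ℝ → ℝ} {β b : ℝ} (h : IsRegVarTail τ β)
    (hb0 : 0 < b) (hb : β < b) :
    ∃ C : ℝ, 0 < C ∧ ∀ x y : ℝ, 1 ≤ y → y ≤ x → τ y ≤ C * (x / y) ^ b * τ x := by
  have h2 := h.ratio 2 two_pos
  have h3 : (2 : ℝ) ^ (-b) < 2 ^ (-β) := Real.rpow_lt_rpow_of_exponent_lt one_lt_two (by linarith)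
  obtain ⟨x₁, hx₁⟩ := eventually_atTop.1 (h2.eventually_const_lt h3)
  set x₀ := max x₁ 1
  have hx₀ : 1 ≤ x₀ := le_max_right _ _
  have hd : ∀ y, x₀ ≤ y → τ y ≤ 2 ^ b * τ (2 * y) := by
    intro y hy
    have := (hx₁ y ((le_max_left _ _).trans hy)).le
    rw [le_div_iff₀ (h.pos _), Real.rpow_neg two_pos.le, inv_mul_le_iff₀ (by positivity)] at this
    exact this
  have key : ∀ x y : ℝ, x₀ ≤ y → y ≤ x → τ y ≤ 2 ^ b * (x / y) ^ b * τ x := by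
    intro x y hy hyx
    have hy0 : 0 < y := by linarith
    obtain ⟨k, k1, k2⟩ := exists_dyadic_between hy0 hyx
    calc τ y ≤ (2 ^ b) ^ (k + 1) * τ (2 ^ (k + 1) * y) :=
          le_pow_mul_of_doubling (by positivity) (by linarith) hd _ y hy
      _ ≤ (2 ^ b) ^ (k + 1) * τ x := by
          have := h.anti k2.le
          gcongr
      _ ≤ 2 ^ b * (x / y) ^ b * τ x := by
          have hτ := (h.pos x).le
          gcongr
          rw [pow_succ, mul_comm, two_pow_rpow]
          gcongr
          rwa [le_div_iff₀ hy0]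
  refine ⟨2 ^ b * (τ 1 / τ x₀) * x₀ ^ b, ?_, ?_⟩
  · have := h.pos 1; have := h.pos x₀; positivity
  intro x y hy hyx
  have hr : 1 ≤ τ 1 / τ x₀ := (one_le_div (h.pos _)).2 (h.anti hx₀)
  have h1b : (1 : ℝ) ≤ 2 ^ b := Real.one_le_rpow one_le_two hb0.le
  have hxb : 1 ≤ x₀ ^ b := Real.one_le_rpow hx₀ hb0.le
  have hy0 : 0 < y := by linarith
  have hxy : 1 ≤ (x / y) ^ b := Real.one_le_rpow ((one_le_div hy0).2 hyx) hb0.le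
  have hτx := h.pos x
  have hx0 := h.pos x₀
  rcases le_total x₀ y with hc | hc
  · refine (key x y hc hyx).trans ?_
    have : 2 ^ b * (x / y) ^ b * 1 * 1 ≤ 2 ^ b * (x / y) ^ b * (τ 1 / τ x₀) * x₀ ^ b := by gcongr
    nlinarith
  · rcases le_total x x₀ with hx | hx
    · have e1 : τ y ≤ τ 1 / τ x₀ * τ x := by
        calc τ y ≤ τ 1 := h.anti hy
          _ = τ 1 / τ x₀ * τ x₀ := by field_simp
          _ ≤ τ 1 / τ x₀ * τ x := by have := h.anti hx; gcongr
      refine e1.trans ?_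
      have : 1 * (τ 1 / τ x₀) * 1 * 1 ≤ 2 ^ b * (τ 1 / τ x₀) * x₀ ^ b * (x / y) ^ b := by gcongr
      nlinarith
    · have e1 : τ y ≤ τ 1 / τ x₀ * (2 ^ b * (x / x₀) ^ b * τ x) := by
        calc τ y ≤ τ 1 := h.anti hy
          _ = τ 1 / τ x₀ * τ x₀ := by field_simp
          _ ≤ _ := by have := key x x₀ le_rfl hx; gcongr
      refine e1.trans ?_
      have hx₀' : 0 < x₀ := by linarith
      have hx' : 0 < x := by linarith
      have e2 : (x / x₀) ^ b ≤ x₀ ^ b * (x / y) ^ b := by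
        have : (x / x₀) ^ b ≤ (x / y) ^ b := by gcongr
        nlinarith
      calc τ 1 / τ x₀ * (2 ^ b * (x / x₀) ^ b * τ x)
          ≤ τ 1 / τ x₀ * (2 ^ b * (x₀ ^ b * (x / y) ^ b) * τ x) := by gcongr
        _ = _ := by ring

/-- Potter's bound, from above in the larger argument. -/
theorem IsRegVarTail.potter_lower {τ : ℝ → ℝ} {β a : ℝ} (h : IsRegVarTail τ β)
    (ha0 : 0 < a) (ha : a < β) {y₀ : ℝ} (hy₀ : 0 < y₀) :
    ∃ C : ℝ, 0 < C ∧ ∀ x y : ℝ, y₀ ≤ y → y ≤ x → (x / y) ^ a * τ x ≤ C * τ y := by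
  have h2 := h.ratio 2 two_pos
  have h3 : (2 : ℝ) ^ (-β) < 2 ^ (-a) := Real.rpow_lt_rpow_of_exponent_lt one_lt_two (by linarith)
  obtain ⟨x₁, hx₁⟩ := eventually_atTop.1 (h2.eventually_lt_const h3)
  set x₀ := max x₁ y₀
  have hx₀ : y₀ ≤ x₀ := le_max_right _ _
  have hd : ∀ y, x₀ ≤ y → -τ y ≤ 2 ^ a * -τ (2 * y) := by
    intro y hy
    have := (hx₁ y ((le_max_left _ _).trans hy)).le
    rw [div_le_iff₀ (h.pos _), Real.rpow_neg two_pos.le, le_inv_mul_iff₀ (by positivity)] at this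
    linarith
  have key : ∀ x y : ℝ, x₀ ≤ y → y ≤ x → (x / y) ^ a * τ x ≤ 2 ^ a * τ y := by
    intro x y hy hyx
    have hy0 : 0 < y := by linarith
    have hx0 : 0 < x := by linarith
    obtain ⟨k, k1, k2⟩ := exists_dyadic_between hy0 hyx
    have h4 : (2 ^ a) ^ k * τ (2 ^ k * y) ≤ τ y := by
      have := le_pow_mul_of_doubling (f := fun y => -τ y) (A := 2 ^ a) (by positivity)
        (by linarith) hd k y hy
      simp only [mul_neg] at this
      linarith
    calc (x / y) ^ a * τ x ≤ (2 ^ (k + 1)) ^ a * τ (2 ^ k * y) := by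
          have := h.anti k1
          have := (h.pos x).le
          have : x / y ≤ 2 ^ (k + 1) := ((div_lt_iff₀ hy0).2 k2).le
          gcongr
      _ = 2 ^ a * ((2 ^ a) ^ k * τ (2 ^ k * y)) := by
          rw [← two_pow_rpow, pow_succ]; ring
      _ ≤ 2 ^ a * τ y := by gcongr
  have hr : 1 ≤ x₀ / y₀ := (one_le_div hy₀).2 hx₀
  have hra : 1 ≤ (x₀ / y₀) ^ a := Real.one_le_rpow hr ha0.le
  have h2a : 1 ≤ (2 : ℝ) ^ a := Real.one_le_rpow one_le_two ha0.le
  refine ⟨2 ^ a * (x₀ / y₀) ^ a, by positivity, ?_⟩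
  intro x y hy hyx
  have hy0 : 0 < y := by linarith
  have hx0 : 0 < x := by linarith
  have hτy := h.pos y
  have hτx := h.pos x
  rcases le_total x₀ y with hc | hc
  · refine (key x y hc hyx).trans ?_
    have : 2 ^ a * 1 * τ y ≤ 2 ^ a * (x₀ / y₀) ^ a * τ y := by gcongr
    linarith
  · rcases le_total x x₀ with hx | hx
    · have h5 : (x / y) ^ a ≤ (x₀ / y₀) ^ a := by gcongr
      calc (x / y) ^ a * τ x ≤ (x₀ / y₀) ^ a * τ y := by
            have := h.anti hyx
            gcongr
        _ ≤ 2 ^ a * ((x₀ / y₀) ^ a * τ y) := le_mul_of_one_le_left (by positivity) h2a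
        _ = _ := by ring
    · have hx₀0 : 0 < x₀ := by linarith
      calc (x / y) ^ a * τ x = (x₀ / y) ^ a * ((x / x₀) ^ a * τ x) := by
            rw [← mul_assoc, ← Real.mul_rpow (by positivity) (by positivity)]
            congr 2; field_simp
        _ ≤ (x₀ / y₀) ^ a * (2 ^ a * τ x₀) := by
            have := key x x₀ le_rfl hx
            gcongr
        _ ≤ (x₀ / y₀) ^ a * (2 ^ a * τ y) := by
            have := h.anti hc
            gcongr
        _ = _ := by ring

section TailLaplace

variable {Y : Type*} [MeasurableSpace Y]

/-- The tail `x ↦ μ(φ > x)` of a return time, as a function of a real variable. -/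
noncomputable def returnTail (μ : Measure Y) (φ : Y → ℕ) (x : ℝ) : ℝ :=
  μ.real {y | x < (φ y : ℝ)}

variable (μ : Measure Y) [IsProbabilityMeasure μ] {φ : Y → ℕ}

theorem returnTail_antitone : Antitone (returnTail μ φ) := fun _ _ h =>
  measureReal_mono fun _ hy => lt_of_le_of_lt h hy

theorem returnTail_le_one (x : ℝ) : returnTail μ φ x ≤ 1 := measureReal_le_one

theorem integral_one_sub_exp_neg_mul (hφ : Measurable φ) {c : ℝ} (hc : 0 < c) :
    ∫ y, (1 - Real.exp (-(c * φ y))) ∂μ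
      = ∫ x in Set.Ioi (0 : ℝ), returnTail μ φ x * (c * Real.exp (-(c * x))) := by
  have hφ' : Measurable fun y => (φ y : ℝ) := measurable_from_nat.comp hφ
  have hprim : ∀ a : ℝ, ∫ t in (0 : ℝ)..a, c * Real.exp (-(c * t)) = 1 - Real.exp (-(c * a)) := by
    intro a
    have : ∀ x ∈ Set.uIcc 0 a,
        HasDerivAt (fun t => -Real.exp (-(c * t))) (c * Real.exp (-(c * x))) x := by
      intro x _
      have h : HasDerivAt (fun t => -Real.exp (-(c * t)))
          (-(Real.exp (-(c * x)) * -(c * 1))) x :=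
        (((hasDerivAt_id x).const_mul c).neg.exp).neg
      convert h using 1
      ring
    rw [intervalIntegral.integral_eq_sub_of_hasDerivAt this
      (Continuous.intervalIntegrable (by fun_prop) _ _)]
    simp; ring
  have hlc := lintegral_comp_eq_lintegral_meas_lt_mul (g := fun t => c * Real.exp (-(c * t))) μ
    (f := fun y => (φ y : ℝ)) (Eventually.of_forall fun y => by positivity) hφ'.aemeasurable
    (fun t _ => Continuous.intervalIntegrable (by fun_prop) _ _)
    (Eventually.of_forall fun t => by positivity)
  simp only [hprim] at hlc
  rw [integral_eq_lintegral_of_nonneg_ae, hlc, integral_eq_lintegral_of_nonneg_ae]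
  · congr 1
    refine lintegral_congr fun t => ?_
    rw [returnTail, ENNReal.ofReal_mul measureReal_nonneg, ofReal_measureReal]
  · exact Eventually.of_forall fun t => mul_nonneg measureReal_nonneg (by positivity)
  · exact ((returnTail_antitone μ).measurable.mul (by fun_prop)).aestronglyMeasurable
  · refine Eventually.of_forall fun y => ?_
    have : Real.exp (-(c * φ y)) ≤ 1 := Real.exp_le_one_iff.2 (by
      have : 0 ≤ c * (φ y : ℝ) := by positivity
      linarith)
    simpa using this
  · exact (by fun_prop : Measurable fun y => 1 - Real.exp (-(c * φ y))).aestronglyMeasurable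

theorem integral_one_sub_exp_neg_div (hφ : Measurable φ) {q X : ℝ} (hq : 0 < q) (hX : 0 < X) :
    ∫ y, (1 - Real.exp (-(q / X * φ y))) ∂μ
      = ∫ x in Set.Ioi (0 : ℝ), returnTail μ φ (X * x) * (q * Real.exp (-(q * x))) := by
  rw [integral_one_sub_exp_neg_mul μ hφ (div_pos hq hX)]
  have h := integral_comp_mul_left_Ioi
    (fun x => returnTail μ φ x * (q / X * Real.exp (-(q / X * x)))) 0 hX
  rw [mul_zero, smul_eq_mul] at h
  have h2 : ∫ x in Set.Ioi (0 : ℝ), returnTail μ φ x * (q / X * Real.exp (-(q / X * x)))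
      = X * (X⁻¹ * ∫ x in Set.Ioi (0 : ℝ),
          returnTail μ φ x * (q / X * Real.exp (-(q / X * x)))) := by
    rw [mul_inv_cancel_left₀ hX.ne']
  rw [h2, ← h, ← integral_const_mul]
  refine integral_congr_ae (Eventually.of_forall fun x => ?_)
  simp only
  have e : q / X * (X * x) = q * x := by field_simp
  rw [e]
  field_simp

theorem tendsto_laplace_div_returnTail (hφ : Measurable φ) {β : ℝ} (hβ1 : β < 1) (hβ0 : 0 < β)
    (hτ : IsRegVarTail (returnTail μ φ) β) {q : ℝ} (hq : 0 < q) :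
    Tendsto (fun X : ℝ => (∫ y, (1 - Real.exp (-(q / X * φ y))) ∂μ) / returnTail μ φ X) atTop
      (𝓝 (Real.Gamma (1 - β) * q ^ β)) := by
  obtain ⟨b, hb1, hb2⟩ := exists_between hβ1
  have hb0 : 0 < b := hβ0.trans hb1
  obtain ⟨C, hC, hpot⟩ := hτ.potter_upper hb0 hb1
  have hpot1 : ∃ C' : ℝ, 0 < C' ∧ ∀ X x : ℝ, 1 ≤ X → 0 < x → x ≤ 1 →
      returnTail μ φ (X * x) / returnTail μ φ X ≤ C' * x ^ (-b) := by
    refine ⟨C / returnTail μ φ 1 + C, by have := hτ.pos 1; positivity, ?_⟩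
    intro X x hX hx hx1
    rw [div_le_iff₀ (hτ.pos _)]
    have p1 := hτ.pos 1
    have pX := hτ.pos X
    rcases le_total 1 (X * x) with h | h
    · have h3 := hpot X (X * x) h (by nlinarith)
      have e : X / (X * x) = x⁻¹ := by field_simp
      rw [e, Real.inv_rpow hx.le, ← Real.rpow_neg hx.le] at h3
      refine h3.trans ?_
      gcongr
      have : 0 ≤ C / returnTail μ φ 1 := by positivity
      linarith
    · have h3 := hpot X 1 le_rfl hX
      have h5 : (X / 1) ^ b ≤ x ^ (-b) := by
        rw [Real.rpow_neg hx.le, ← Real.inv_rpow hx.le, div_one]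
        have : X ≤ x⁻¹ := by
          rw [le_inv_comm₀ (by linarith) hx, inv_eq_one_div, le_div_iff₀ (by linarith)]
          linarith
        gcongr
      have h4 : returnTail μ φ (X * x) ≤ 1 := returnTail_le_one μ _
      calc returnTail μ φ (X * x) ≤ 1 := h4
        _ = (returnTail μ φ 1)⁻¹ * returnTail μ φ 1 := by field_simp
        _ ≤ (returnTail μ φ 1)⁻¹ * (C * (X / 1) ^ b * returnTail μ φ X) := by gcongr
        _ ≤ (returnTail μ φ 1)⁻¹ * (C * x ^ (-b) * returnTail μ φ X) := by gcongr
        _ = (C / returnTail μ φ 1) * x ^ (-b) * returnTail μ φ X := by ring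
        _ ≤ _ := by
          gcongr
          linarith
  obtain ⟨C', hC', hdom⟩ := hpot1
  have hlim : Real.Gamma (1 - β) * q ^ β
      = ∫ x in Set.Ioi (0 : ℝ), x ^ (-β) * (q * Real.exp (-(q * x))) := by
    have h := Real.integral_rpow_mul_exp_neg_mul_Ioi (a := 1 - β) (r := q) (by linarith) hq
    have e : ∀ x : ℝ, x ^ (-β) * (q * Real.exp (-(q * x)))
        = q * (x ^ (1 - β - 1) * Real.exp (-(q * x))) := by
      intro x; rw [show 1 - β - 1 = -β by ring]; ring
    simp only [e]
    rw [integral_const_mul, h, one_div, Real.inv_rpow hq.le, ← Real.rpow_neg hq.le]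
    have : q * q ^ (-(1 - β)) = q ^ β := by
      rw [← Real.rpow_one_add' hq.le (by linarith)]; ring_nf
    rw [← this]; ring
  rw [hlim]
  have hF : ∀ᶠ X : ℝ in atTop,
      ∫ x in Set.Ioi (0 : ℝ), returnTail μ φ (X * x) / returnTail μ φ X * (q * Real.exp (-(q * x)))
      = (∫ y, (1 - Real.exp (-(q / X * φ y))) ∂μ) / returnTail μ φ X := by
    filter_upwards [eventually_gt_atTop 0] with X hX
    rw [integral_one_sub_exp_neg_div μ hφ hq hX, ← integral_div]
    refine integral_congr_ae (Eventually.of_forall fun x => ?_)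
    simp only
    ring
  refine Tendsto.congr' hF ?_
  refine tendsto_integral_filter_of_dominated_convergence
    (fun x => (C' * x ^ (-b) + 1) * (q * Real.exp (-(q * x)))) ?_ ?_ ?_ ?_
  · filter_upwards with X
    refine Measurable.aestronglyMeasurable ?_
    have : Measurable fun x => returnTail μ φ (X * x) :=
      (returnTail_antitone μ).measurable.comp (measurable_const_mul X)
    exact (this.div_const _).mul (by fun_prop)
  · filter_upwards [eventually_ge_atTop 1] with X hX
    filter_upwards [ae_restrict_mem measurableSet_Ioi] with x hx
    have hx0 : (0 : ℝ) < x := hx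
    have hn : 0 ≤ returnTail μ φ (X * x) / returnTail μ φ X :=
      div_nonneg (hτ.pos _).le (hτ.pos _).le
    rw [Real.norm_of_nonneg (by positivity)]
    gcongr
    rcases le_total x 1 with h | h
    · linarith [hdom X x hX hx0 h]
    · have : returnTail μ φ (X * x) / returnTail μ φ X ≤ 1 := by
        rw [div_le_one (hτ.pos _)]
        exact hτ.anti (by nlinarith)
      have : 0 ≤ C' * x ^ (-b) := by positivity
      linarith
  · have i1 : IntegrableOn (fun x : ℝ => x ^ (-b) * Real.exp (-q * x)) (Set.Ioi 0) :=
      integrableOn_rpow_mul_exp_neg_mul_rpow (p := 1) (s := -b) (by linarith) (by norm_num) hq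
        |>.congr_fun (fun x _ => by simp) measurableSet_Ioi
    have i2 : IntegrableOn (fun x : ℝ => Real.exp (-q * x)) (Set.Ioi 0) :=
      integrableOn_exp_mul_Ioi (by linarith) 0
    refine ((i1.const_mul (C' * q)).add (i2.const_mul q)).congr
      (Eventually.of_forall fun x => ?_)
    simp only [Pi.add_apply, neg_mul]
    ring
  · filter_upwards [ae_restrict_mem measurableSet_Ioi] with x hx
    have := (hτ.ratio x hx).mul_const (q * Real.exp (-(q * x)))
    simpa only [mul_comm x] using this

end TailLaplace

section Karamata

/-- `∑ₙ tₙ e^{-n/N} f(e^{-n/N})`. -/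
noncomputable def expWeightedSum (t : ℕ → ℝ) (N : ℕ) (f : ℝ → ℝ) : ℝ :=
  ∑' n : ℕ, t n * (Real.exp (-(n / N)) * f (Real.exp (-(n / N))))

/-- `∫₀^∞ x^{β-1} e^{-x} f(e^{-x}) dx`. -/
noncomputable def expWeightedIntegral (β : ℝ) (f : ℝ → ℝ) : ℝ :=
  ∫ x in Set.Ioi (0 : ℝ), x ^ (β - 1) * (Real.exp (-x) * f (Real.exp (-x)))

theorem exp_neg_natCast_div_mem (n N : ℕ) : Real.exp (-((n : ℝ) / N)) ∈ Set.Icc (0 : ℝ) 1 :=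
  ⟨(Real.exp_pos _).le, Real.exp_le_one_iff.2 (by
    have : 0 ≤ (n : ℝ) / N := by positivity
    linarith)⟩

theorem exp_neg_mem {x : ℝ} (hx : 0 < x) : Real.exp (-x) ∈ Set.Icc (0 : ℝ) 1 :=
  ⟨(Real.exp_pos _).le, Real.exp_le_one_iff.2 (by linarith)⟩

theorem summable_expWeighted {t : ℕ → ℝ} (ht : ∀ n, 0 ≤ t n) {N : ℕ}
    (hs : Summable fun n : ℕ => t n * Real.exp (-(n / N))) {f : ℝ → ℝ} {K : ℝ}
    (hf : ∀ u ∈ Set.Icc (0 : ℝ) 1, |f u| ≤ K) :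
    Summable fun n : ℕ => t n * (Real.exp (-(n / N)) * f (Real.exp (-(n / N)))) := by
  refine Summable.of_norm_bounded (hs.mul_right K) fun n => ?_
  rw [norm_mul, norm_mul, Real.norm_of_nonneg (ht n), Real.norm_of_nonneg (Real.exp_pos _).le,
    ← mul_assoc]
  have := ht n
  gcongr
  exact hf _ (exp_neg_natCast_div_mem n N)

theorem integrableOn_rpow_mul_exp_neg {β : ℝ} (hβ : 0 < β) :
    IntegrableOn (fun x : ℝ => x ^ (β - 1) * Real.exp (-x)) (Set.Ioi 0) :=
  (Real.GammaIntegral_convergent hβ).congr_fun (fun _ _ => mul_comm _ _) measurableSet_Ioi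

theorem integrableOn_expWeighted {β : ℝ} (hβ : 0 < β) {f : ℝ → ℝ}
    (hc : ContinuousOn f (Set.Icc 0 1)) {K : ℝ} (hf : ∀ u ∈ Set.Icc (0 : ℝ) 1, |f u| ≤ K) :
    IntegrableOn (fun x : ℝ => x ^ (β - 1) * (Real.exp (-x) * f (Real.exp (-x))))
      (Set.Ioi 0) := by
  refine Integrable.mono' ((integrableOn_rpow_mul_exp_neg hβ).mul_const K) ?_ ?_
  · refine ContinuousOn.aestronglyMeasurable ?_ measurableSet_Ioi
    refine ContinuousOn.mul ?_ (ContinuousOn.mul (by fun_prop) ?_)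
    · exact fun x hx => (Real.continuousAt_rpow_const x _
        (Or.inl (ne_of_gt hx))).continuousWithinAt
    · exact hc.comp (by fun_prop) fun x hx => exp_neg_mem hx
  · filter_upwards [ae_restrict_mem measurableSet_Ioi] with x hx
    have hx0 : (0 : ℝ) < x := hx
    rw [norm_mul, norm_mul, Real.norm_of_nonneg (by positivity),
      Real.norm_of_nonneg (Real.exp_pos _).le, ← mul_assoc]
    gcongr
    exact hf _ (exp_neg_mem hx)

theorem exists_bound_Icc {f : ℝ → ℝ} (hc : ContinuousOn f (Set.Icc 0 1)) :
    ∃ K, ∀ u ∈ Set.Icc (0 : ℝ) 1, |f u| ≤ K :=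
  isCompact_Icc.exists_bound_of_continuousOn hc

variable {t : ℕ → ℝ} {τ : ℕ → ℝ} {c β : ℝ}

theorem tendsto_expWeightedSum_polynomial (ht : ∀ n, 0 ≤ t n) (hβ : 0 < β)
    (hs : ∀ N : ℕ, 1 ≤ N → Summable fun n : ℕ => t n * Real.exp (-(n / N)))
    (h : ∀ q : ℕ, Tendsto (fun N : ℕ => τ N * ∑' n : ℕ, t n * Real.exp (-((q + 1) * (n / N))))
      atTop (𝓝 (c * ((1 / ((q : ℝ) + 1)) ^ β * Real.Gamma β)))) (p : Polynomial ℝ) :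
    Tendsto (fun N => τ N * expWeightedSum t N fun u => p.eval u) atTop
      (𝓝 (c * expWeightedIntegral β fun u => p.eval u)) := by
  induction p using Polynomial.induction_on' with
  | add p q hp hq =>
    obtain ⟨Kp, hKp⟩ := exists_bound_Icc p.continuousOn_aeval
    obtain ⟨Kq, hKq⟩ := exists_bound_Icc q.continuousOn_aeval
    simp only [Polynomial.coe_aeval_eq_eval] at hKp hKq
    have e2 : expWeightedIntegral β (fun u => (p + q).eval u)
        = expWeightedIntegral β (fun u => p.eval u)
          + expWeightedIntegral β (fun u => q.eval u) := by
      rw [expWeightedIntegral, expWeightedIntegral, expWeightedIntegral, ← integral_add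
        (integrableOn_expWeighted hβ p.continuousOn hKp)
        (integrableOn_expWeighted hβ q.continuousOn hKq)]
      refine integral_congr_ae (Eventually.of_forall fun x => ?_)
      simp only [Polynomial.eval_add]
      ring
    rw [e2, mul_add]
    refine (hp.add hq).congr' ?_
    filter_upwards [eventually_ge_atTop 1] with N hN
    rw [← mul_add, expWeightedSum, expWeightedSum, expWeightedSum,
      ← (summable_expWeighted ht (hs N hN) hKp).tsum_add
      (summable_expWeighted ht (hs N hN) hKq)]
    congr 2
    funext n
    simp only [Polynomial.eval_add]
    ring
  | monomial q a =>
    have e2 : expWeightedIntegral β (fun u => (Polynomial.monomial q a).eval u)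
        = a * ((1 / ((q : ℝ) + 1)) ^ β * Real.Gamma β) := by
      rw [← Real.integral_rpow_mul_exp_neg_mul_Ioi hβ (by positivity), expWeightedIntegral,
        ← integral_const_mul]
      refine integral_congr_ae (Eventually.of_forall fun x => ?_)
      simp only [Polynomial.eval_monomial]
      rw [show -(((q : ℝ) + 1) * x) = -x + q * (-x) by ring, Real.exp_add, Real.exp_nat_mul]
      ring
    rw [e2]
    have := (h q).const_mul a
    rw [show c * (a * ((1 / ((q : ℝ) + 1)) ^ β * Real.Gamma β))
      = a * (c * ((1 / ((q : ℝ) + 1)) ^ β * Real.Gamma β)) by ring]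
    refine this.congr fun N => ?_
    rw [expWeightedSum, mul_left_comm, ← tsum_mul_left]
    congr 2
    funext n
    simp only [Polynomial.eval_monomial]
    rw [show -(((q : ℝ) + 1) * (n / N : ℝ)) = -(n / N : ℝ) + q * (-(n / N : ℝ)) by ring,
      Real.exp_add, Real.exp_nat_mul]
    ring

theorem tendsto_expWeightedSum (ht : ∀ n, 0 ≤ t n) (hτ : ∀ n, 0 ≤ τ n) (hβ : 0 < β)
    (hs : ∀ N : ℕ, 1 ≤ N → Summable fun n : ℕ => t n * Real.exp (-(n / N)))
    (h : ∀ q : ℕ, Tendsto (fun N : ℕ => τ N * ∑' n : ℕ, t n * Real.exp (-((q + 1) * (n / N))))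
      atTop (𝓝 (c * ((1 / ((q : ℝ) + 1)) ^ β * Real.Gamma β)))) {g : ℝ → ℝ}
    (hg : ContinuousOn g (Set.Icc 0 1)) :
    Tendsto (fun N => τ N * expWeightedSum t N g) atTop (𝓝 (c * expWeightedIntegral β g)) := by
  obtain ⟨Kg, hKg⟩ := exists_bound_Icc hg
  have h0 : Tendsto (fun N : ℕ => τ N * ∑' n : ℕ, t n * Real.exp (-(n / N)))
      atTop (𝓝 (c * Real.Gamma β)) := by
    simpa using h 0
  set S := |c * Real.Gamma β| + 1 with hS
  have hS1 : c * Real.Gamma β < S := by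
    have := le_abs_self (c * Real.Gamma β); linarith
  have hS0 : 0 < S := by positivity
  rw [Metric.tendsto_atTop']
  intro ε hε
  obtain ⟨p, hp⟩ := exists_polynomial_near_of_continuousOn 0 1 g hg (ε / (4 * S)) (by positivity)
  obtain ⟨Kp, hKp⟩ := exists_bound_Icc p.continuousOn_aeval
  simp only [Polynomial.coe_aeval_eq_eval] at hKp
  have hpl := tendsto_expWeightedSum_polynomial ht hβ hs h p
  have hint : |c * expWeightedIntegral β g - c * expWeightedIntegral β fun u => p.eval u|
      ≤ ε / 4 := by
    rw [← mul_sub, expWeightedIntegral, expWeightedIntegral, ← integral_sub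
        (integrableOn_expWeighted hβ hg hKg)
        (integrableOn_expWeighted hβ p.continuousOn hKp), abs_mul]
    have hb : ‖∫ x in Set.Ioi (0 : ℝ), (x ^ (β - 1) * (Real.exp (-x) * g (Real.exp (-x)))
        - x ^ (β - 1) * (Real.exp (-x) * p.eval (Real.exp (-x))))‖
        ≤ ∫ x in Set.Ioi (0 : ℝ), x ^ (β - 1) * Real.exp (-x) * (ε / (4 * S)) := by
      refine norm_integral_le_of_norm_le ((integrableOn_rpow_mul_exp_neg hβ).mul_const _) ?_
      filter_upwards [ae_restrict_mem measurableSet_Ioi] with x hx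
      have hx0 : (0 : ℝ) < x := hx
      rw [← mul_sub, ← mul_sub, norm_mul, norm_mul, Real.norm_of_nonneg (by positivity),
        Real.norm_of_nonneg (Real.exp_pos _).le, ← mul_assoc]
      gcongr
      rw [Real.norm_eq_abs, abs_sub_comm]
      exact (hp _ (exp_neg_mem hx)).le
    have hG : ∫ x in Set.Ioi (0 : ℝ), x ^ (β - 1) * Real.exp (-x) = Real.Gamma β := by
      rw [Real.Gamma_eq_integral hβ]
      simp only [mul_comm]
    rw [integral_mul_const, hG] at hb
    calc |c| * _ ≤ |c| * (Real.Gamma β * (ε / (4 * S))) := by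
          gcongr
          exact hb
      _ = |c * Real.Gamma β| * (ε / (4 * S)) := by
          rw [abs_mul, abs_of_pos (Real.Gamma_pos_of_pos hβ)]; ring
      _ ≤ S * (ε / (4 * S)) := by gcongr; linarith
      _ = ε / 4 := by field_simp
  have hev := ((Metric.tendsto_nhds.1 hpl (ε / 4) (by positivity)).and
    (h0.eventually_lt_const hS1)).and (eventually_ge_atTop 1)
  obtain ⟨N₀, hN₀⟩ := eventually_atTop.1 hev
  refine ⟨N₀, fun N hN => ?_⟩
  obtain ⟨⟨h1, h2⟩, h3⟩ := hN₀ N hN.le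
  rw [Real.dist_eq] at h1 ⊢
  have hsum : |τ N * expWeightedSum t N g - τ N * expWeightedSum t N fun u => p.eval u|
      ≤ ε / 4 := by
    rw [← mul_sub, expWeightedSum, expWeightedSum,
      ← (summable_expWeighted ht (hs N h3) hKg).tsum_sub
      (summable_expWeighted ht (hs N h3) hKp), abs_mul, abs_of_nonneg (hτ N)]
    have hb : ‖∑' n : ℕ, (t n * (Real.exp (-(n / N)) * g (Real.exp (-(n / N))))
        - t n * (Real.exp (-(n / N)) * p.eval (Real.exp (-(n / N)))))‖
        ≤ (∑' n : ℕ, t n * Real.exp (-(n / N))) * (ε / (4 * S)) := by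
      rw [← tsum_mul_right]
      refine tsum_of_norm_bounded ((hs N h3).mul_right _).hasSum fun n => ?_
      have := ht n
      rw [← mul_sub, ← mul_sub, norm_mul, norm_mul, Real.norm_of_nonneg (by positivity),
        Real.norm_of_nonneg (Real.exp_pos _).le, ← mul_assoc]
      gcongr
      rw [Real.norm_eq_abs, abs_sub_comm]
      exact (hp _ (exp_neg_natCast_div_mem n N)).le
    have hτN := hτ N
    calc τ N * _ ≤ τ N * ((∑' n : ℕ, t n * Real.exp (-(n / N))) * (ε / (4 * S))) := by
          gcongr
          exact hb
      _ = (τ N * ∑' n : ℕ, t n * Real.exp (-(n / N))) * (ε / (4 * S)) := by ring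
      _ ≤ S * (ε / (4 * S)) := by gcongr
      _ = ε / 4 := by field_simp
  rw [abs_le] at hint hsum
  rw [abs_lt] at h1 ⊢
  constructor <;> linarith [hint.1, hint.2, hsum.1, hsum.2, h1.1, h1.2]

/-- A continuous cutoff, equal to `0` for `u ≤ a` and to `1` for `b ≤ u`. -/
noncomputable def ramp (a b u : ℝ) : ℝ := max 0 (min 1 ((u - a) / (b - a)))

theorem ramp_nonneg (a b u : ℝ) : 0 ≤ ramp a b u := le_max_left _ _

theorem ramp_le_one (a b u : ℝ) : ramp a b u ≤ 1 := max_le zero_le_one (min_le_left _ _)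

theorem ramp_of_le {a b u : ℝ} (hab : a < b) (hu : u ≤ a) : ramp a b u = 0 :=
  max_eq_left ((min_le_right _ _).trans
    (div_nonpos_of_nonpos_of_nonneg (by linarith) (by linarith)))

theorem ramp_of_ge {a b u : ℝ} (hab : a < b) (hu : b ≤ u) : ramp a b u = 1 := by
  rw [ramp, min_eq_left, max_eq_right zero_le_one]
  rw [le_div_iff₀ (by linarith)]
  linarith

theorem continuous_ramp_div {a : ℝ} (ha : 0 < a) (b : ℝ) :
    Continuous fun u => ramp a b u / max u a := by
  unfold ramp
  refine Continuous.div (by fun_prop) (by fun_prop) fun u => ?_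
  exact (lt_of_lt_of_le ha (le_max_right _ _)).ne'

theorem mul_ramp_div {a b u : ℝ} (ha : 0 < a) (hab : a < b) :
    u * (ramp a b u / max u a) = ramp a b u := by
  rcases le_total u a with h | h
  · rw [ramp_of_le hab h]; simp
  · have : u ≠ 0 := (ha.trans_le h).ne'
    rw [max_eq_left h]; field_simp

theorem integral_rpow_sub_one_Ioc {β x : ℝ} (hβ : 0 < β) (hx : 0 ≤ x) :
    ∫ s in Set.Ioc 0 x, s ^ (β - 1) = x ^ β / β := by
  rw [← intervalIntegral.integral_of_le hx, integral_rpow (Or.inl (by linarith))]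
  rw [sub_add_cancel, Real.zero_rpow hβ.ne', sub_zero]

theorem integrableOn_rpow_sub_one_Ioc {β : ℝ} (hβ : 0 < β) {x : ℝ} (hx : 0 ≤ x) :
    IntegrableOn (fun s : ℝ => s ^ (β - 1)) (Set.Ioc 0 x) :=
  (intervalIntegrable_iff_integrableOn_Ioc_of_le hx).1
    (intervalIntegral.intervalIntegrable_rpow' (by linarith))

theorem expWeightedIntegral_ramp_mem (hβ : 0 < β) {x₁ x₂ : ℝ} (h1 : 0 ≤ x₁) (h12 : x₁ < x₂) :
    expWeightedIntegral β (fun u => ramp (Real.exp (-x₂)) (Real.exp (-x₁)) u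
      / max u (Real.exp (-x₂))) ∈ Set.Icc (x₁ ^ β / β) (x₂ ^ β / β) := by
  set a := Real.exp (-x₂)
  set b := Real.exp (-x₁)
  have hab : a < b := Real.exp_lt_exp.2 (by linarith)
  have ha : 0 < a := Real.exp_pos _
  have hcont := (continuous_ramp_div ha b).continuousOn (s := Set.Icc 0 1)
  obtain ⟨K, hK⟩ := exists_bound_Icc hcont
  have hi := integrableOn_expWeighted hβ hcont hK
  unfold expWeightedIntegral
  have hmul : ∀ x : ℝ, Real.exp (-x) * (ramp a b (Real.exp (-x)) / max (Real.exp (-x)) a)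
      = ramp a b (Real.exp (-x)) := fun x => mul_ramp_div ha hab
  simp only [hmul] at hi ⊢
  constructor
  · rw [← integral_rpow_sub_one_Ioc hβ h1]
    calc ∫ s in Set.Ioc 0 x₁, s ^ (β - 1)
        = ∫ s in Set.Ioc 0 x₁, s ^ (β - 1) * ramp a b (Real.exp (-s)) := by
          refine setIntegral_congr_fun measurableSet_Ioc fun s hs => ?_
          rw [ramp_of_ge hab (Real.exp_le_exp.2 (by linarith [hs.2])), mul_one]
      _ ≤ _ := by
          refine setIntegral_mono_set hi ?_ (Set.Ioc_subset_Ioi_self.eventuallyLE)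
          filter_upwards [ae_restrict_mem measurableSet_Ioi] with x hx
          have hx0 : (0 : ℝ) < x := hx
          exact mul_nonneg (by positivity) (ramp_nonneg _ _ _)
  · rw [← integral_rpow_sub_one_Ioc hβ (h1.trans h12.le)]
    calc _ = ∫ s in Set.Ioc 0 x₂, s ^ (β - 1) * ramp a b (Real.exp (-s)) := by
          refine (setIntegral_eq_of_subset_of_forall_sdiff_eq_zero measurableSet_Ioi
            Set.Ioc_subset_Ioi_self fun x hx => ?_)
          have : x₂ < x := by
            by_contra hle
            exact hx.2 ⟨hx.1, not_lt.1 hle⟩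
          rw [ramp_of_le hab (Real.exp_le_exp.2 (by linarith)), mul_zero]
      _ ≤ _ := by
          refine setIntegral_mono_on (hi.mono_set Set.Ioc_subset_Ioi_self)
            (integrableOn_rpow_sub_one_Ioc hβ (h1.trans h12.le)) measurableSet_Ioc fun x hx => ?_
          have hx0 : (0 : ℝ) < x := hx.1
          exact mul_le_of_le_one_right (by positivity) (ramp_le_one _ _ _)

/-- Karamata's Tauberian theorem, along integer multiples. -/
theorem tendsto_sum_of_laplace (ht : ∀ n, 0 ≤ t n) (hτ : ∀ n, 0 ≤ τ n) (hβ : 0 < β) (hc : 0 ≤ c)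
    (hs : ∀ N : ℕ, 1 ≤ N → Summable fun n : ℕ => t n * Real.exp (-(n / N)))
    (h : ∀ q : ℕ, Tendsto (fun N : ℕ => τ N * ∑' n : ℕ, t n * Real.exp (-((q + 1) * (n / N))))
      atTop (𝓝 (c * ((1 / ((q : ℝ) + 1)) ^ β * Real.Gamma β)))) {k : ℕ} (hk : 1 ≤ k) :
    Tendsto (fun N : ℕ => τ N * ∑ n ∈ Finset.range (k * N), t n) atTop
      (𝓝 (c * ((k : ℝ) ^ β / β))) := by
  have hk0 : (0 : ℝ) < k := by exact_mod_cast hk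
  have key : ∀ x₁ x₂ : ℝ, 0 ≤ x₁ → x₁ < x₂ → ∃ J ∈ Set.Icc (x₁ ^ β / β) (x₂ ^ β / β),
      Tendsto (fun N : ℕ => τ N * ∑' n : ℕ,
        t n * ramp (Real.exp (-x₂)) (Real.exp (-x₁)) (Real.exp (-(n / N)))) atTop (𝓝 (c * J)) ∧
      ∀ N : ℕ, 1 ≤ N → Summable fun n : ℕ =>
        t n * ramp (Real.exp (-x₂)) (Real.exp (-x₁)) (Real.exp (-(n / N))) := by
    intro x₁ x₂ h1 h12
    refine ⟨_, expWeightedIntegral_ramp_mem hβ h1 h12, ?_, ?_⟩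
    · have := tendsto_expWeightedSum ht hτ hβ hs h
        (continuous_ramp_div (Real.exp_pos (-x₂)) (Real.exp (-x₁))).continuousOn
      refine this.congr fun N => ?_
      rw [expWeightedSum]
      congr 2
      funext n
      rw [mul_ramp_div (Real.exp_pos _) (Real.exp_lt_exp.2 (by linarith))]
    · intro N hN
      obtain ⟨K, hK⟩ := exists_bound_Icc
        (continuous_ramp_div (Real.exp_pos (-x₂)) (Real.exp (-x₁))).continuousOn
      refine (summable_expWeighted ht (hs N hN) hK).congr fun n => ?_
      rw [mul_ramp_div (Real.exp_pos _) (Real.exp_lt_exp.2 (by linarith))]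
  have hcont : Continuous fun x : ℝ => c * (x ^ β / β) :=
    continuous_const.mul ((Real.continuous_rpow_const hβ.le).div_const _)
  rw [tendsto_order]
  constructor
  · intro d hd
    obtain ⟨x₁, hx₁, hx₁k, hx₁0⟩ : ∃ x₁ : ℝ, d < c * (x₁ ^ β / β) ∧ x₁ < k ∧ 0 ≤ x₁ := by
      have e1 : ∀ᶠ x in 𝓝[<] (k : ℝ), d < c * (x ^ β / β) :=
        nhdsWithin_le_nhds (hcont.continuousAt.eventually_const_lt hd)
      have e2 : ∀ᶠ x in 𝓝[<] (k : ℝ), 0 < x := nhdsWithin_le_nhds (lt_mem_nhds hk0)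
      obtain ⟨x, hx⟩ := ((e1.and e2).and self_mem_nhdsWithin).exists
      exact ⟨x, hx.1.1, hx.2, hx.1.2.le⟩
    obtain ⟨J, hJ, hlim, hsum⟩ := key x₁ k hx₁0 hx₁k
    have : d < c * J := hx₁.trans_le (by gcongr; exact hJ.1)
    filter_upwards [hlim.eventually_const_lt this, eventually_ge_atTop 1] with N h1 hN
    refine h1.trans_le ?_
    have hτN := hτ N
    have hN0 : (0 : ℝ) < N := by exact_mod_cast hN
    gcongr
    rw [tsum_eq_sum (s := Finset.range (k * N))]
    · exact Finset.sum_le_sum fun n _ => mul_le_of_le_one_right (ht n) (ramp_le_one _ _ _)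
    · intro n hn
      rw [Finset.mem_range, not_lt] at hn
      rw [ramp_of_le (Real.exp_lt_exp.2 (by linarith)), mul_zero]
      refine Real.exp_le_exp.2 (neg_le_neg ?_)
      rw [le_div_iff₀ hN0]
      exact_mod_cast hn
  · intro d hd
    obtain ⟨x₂, hx₂, hx₂k⟩ : ∃ x₂ : ℝ, c * (x₂ ^ β / β) < d ∧ k < x₂ := by
      have e1 : ∀ᶠ x in 𝓝[>] (k : ℝ), c * (x ^ β / β) < d :=
        nhdsWithin_le_nhds (hcont.continuousAt.eventually_lt_const hd)
      obtain ⟨x, hx⟩ := (e1.and self_mem_nhdsWithin).exists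
      exact ⟨x, hx.1, hx.2⟩
    obtain ⟨J, hJ, hlim, hsum⟩ := key k x₂ hk0.le hx₂k
    have : c * J < d := lt_of_le_of_lt (by gcongr; exact hJ.2) hx₂
    filter_upwards [hlim.eventually_lt_const this, eventually_ge_atTop 1] with N h1 hN
    refine lt_of_le_of_lt ?_ h1
    have hτN := hτ N
    have hN0 : (0 : ℝ) < N := by exact_mod_cast hN
    gcongr
    calc ∑ n ∈ Finset.range (k * N), t n
        = ∑ n ∈ Finset.range (k * N),
          t n * ramp (Real.exp (-x₂)) (Real.exp (-k)) (Real.exp (-(n / N))) := by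
          refine Finset.sum_congr rfl fun n hn => ?_
          rw [Finset.mem_range] at hn
          rw [ramp_of_ge (Real.exp_lt_exp.2 (by linarith)), mul_one]
          refine Real.exp_le_exp.2 (neg_le_neg ?_)
          rw [div_le_iff₀ hN0]
          exact_mod_cast hn.le
      _ ≤ _ := (hsum N hN).sum_le_tsum _ fun n _ => mul_nonneg (ht n) (ramp_nonneg _ _ _)

end Karamata

section ZeroDensity

theorem hasDensityZero_of_blocks {E : Set ℕ}
    (h : ∀ η : ℝ, 0 < η → ∃ J : ℕ, 1 ≤ J ∧ ∀ᶠ M : ℕ in atTop,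
      ((E ∩ Set.Ico (J * M) (2 * (J * M))).ncard : ℝ) ≤ η * (J * M : ℕ)) :
    HasDensityZero E := by
  set f : ℕ → ℕ := fun n => (E ∩ Set.Icc 1 n).ncard with hf
  have hfin : ∀ n, (E ∩ Set.Icc 1 n).Finite := fun n => (Set.finite_Icc 1 n).inter_of_right _
  have hmono : ∀ {m n}, m ≤ n → f m ≤ f n := fun {m n} hmn =>
    Set.ncard_le_ncard (Set.inter_subset_inter_right _ (Set.Icc_subset_Icc_right hmn)) (hfin n)
  have hfn : ∀ n, f n ≤ n := by
    intro n
    refine (Set.ncard_le_ncard Set.inter_subset_right (Set.finite_Icc 1 n)).trans ?_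
    simp [Set.ncard_eq_toFinset_card']
  have hrec : ∀ η : ℝ, 0 < η → ∃ n₀ : ℕ, ∀ n, n₀ ≤ n → (f n : ℝ) ≤ f (n / 2) + η * n := by
    intro η hη
    obtain ⟨J, hJ, hM⟩ := h η hη
    obtain ⟨M₀, hM₀⟩ := eventually_atTop.1 hM
    obtain ⟨n₁, hn₁⟩ := exists_nat_ge ((2 * J + 2) / (η / 2))
    refine ⟨max n₁ (2 * J * M₀), fun n hn => ?_⟩
    set M := n / (2 * J)
    have hMM : M₀ ≤ M := by
      rw [Nat.le_div_iff_mul_le (by omega), mul_comm]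
      exact (le_max_right _ _).trans hn
    have h1 : 2 * J * M ≤ n := Nat.mul_div_le n (2 * J)
    have h2 : n < 2 * J * (M + 1) := Nat.lt_mul_div_succ n (by omega)
    have hsub : E ∩ Set.Icc 1 n ⊆ (E ∩ Set.Icc 1 (J * M)) ∪
        ((E ∩ Set.Ico (J * M) (2 * (J * M))) ∪ Set.Ico (2 * (J * M)) (2 * (J * M) + 2 * J)) := by
      rintro j ⟨hjE, hj1, hjn⟩
      rcases le_or_gt j (J * M) with h3 | h3
      · exact Or.inl ⟨hjE, hj1, h3⟩
      · rcases lt_or_ge j (2 * (J * M)) with h4 | h4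
        · exact Or.inr (Or.inl ⟨hjE, h3.le, h4⟩)
        · exact Or.inr (Or.inr ⟨h4, by nlinarith⟩)
    have hcard : f n ≤ f (J * M) + ((E ∩ Set.Ico (J * M) (2 * (J * M))).ncard + 2 * J) := by
      refine (Set.ncard_le_ncard hsub ?_).trans ((Set.ncard_union_le _ _).trans ?_)
      · exact (hfin _).union (((Set.finite_Ico _ _).inter_of_right _).union (Set.finite_Ico _ _))
      · refine Nat.add_le_add_left ((Set.ncard_union_le _ _).trans ?_) _
        refine Nat.add_le_add_left ?_ _
        simp [Set.ncard_eq_toFinset_card']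
    have h5 : f (J * M) ≤ f (n / 2) := hmono (by
      rw [Nat.le_div_iff_mul_le two_pos]; linarith)
    have h6 := hM₀ M hMM
    have h7 : ((J * M : ℕ) : ℝ) ≤ n / 2 := by
      rw [le_div_iff₀ two_pos]
      have : J * M * 2 ≤ n := by linarith
      exact_mod_cast this
    have h8 : (2 * J : ℝ) ≤ η / 2 * n := by
      have : (2 * J + 2 : ℝ) / (η / 2) ≤ n := hn₁.trans (by exact_mod_cast (le_max_left _ _).trans hn)
      rw [div_le_iff₀ (by positivity)] at this
      linarith
    have hcard' : (f n : ℝ) ≤ f (J * M)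
        + ((E ∩ Set.Ico (J * M) (2 * (J * M))).ncard + 2 * J) := by exact_mod_cast hcard
    have h5' : (f (J * M) : ℝ) ≤ f (n / 2) := by exact_mod_cast h5
    nlinarith
  rw [HasDensityZero, Metric.tendsto_atTop]
  intro ε hε
  obtain ⟨n₀, hn₀⟩ := hrec (ε / 4) (by positivity)
  have hbound : ∀ n : ℕ, (f n : ℝ) ≤ ε / 2 * n + (n₀ + 1) := by
    intro n
    induction n using Nat.strong_induction_on with
    | _ n ih =>
      rcases le_or_gt n n₀ with h1 | h1
      · have h2 : (f n : ℝ) ≤ n := by exact_mod_cast hfn n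
        have h3 : (n : ℝ) ≤ n₀ := by exact_mod_cast h1
        have : 0 ≤ ε / 2 * n := by positivity
        linarith
      · have h2 := hn₀ n h1.le
        have h3 := ih (n / 2) (by omega)
        have h4 : ((n / 2 : ℕ) : ℝ) ≤ n / 2 := Nat.cast_div_le
        nlinarith
  obtain ⟨n₁, hn₁⟩ := exists_nat_gt ((n₀ + 1) / (ε / 2))
  refine ⟨n₁ + 1, fun n hn => ?_⟩
  have hn0 : (0 : ℝ) < n := by exact_mod_cast (by omega : 0 < n)
  rw [Real.dist_eq, sub_zero, abs_of_nonneg (by positivity), div_lt_iff₀ hn0]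
  have h1 : (n₁ : ℝ) ≤ n := by exact_mod_cast (by omega : n₁ ≤ n)
  have h2 : ((n₀ : ℝ) + 1) / (ε / 2) < n := hn₁.trans_le h1
  rw [div_lt_iff₀ (by positivity)] at h2
  have := hbound n
  simp only [hf] at this
  linarith

/-- Convergence outside a set of density zero, from density zero of each set of large
deviations. -/
theorem exists_densityZero_tendsto {a : ℕ → ℝ} {c : ℝ}
    (h : ∀ ε : ℝ, 0 < ε → HasDensityZero {n | ε < |a n - c|}) :
    ∃ E : Set ℕ, HasDensityZero E ∧ Tendsto a (atTop ⊓ 𝓟 Eᶜ) (𝓝 c) := by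
  classical
  set D : ℕ → Set ℕ := fun m => {n | 1 / ((m : ℝ) + 1) < |a n - c|} with hD
  have hDmono : Monotone D := by
    intro m m' hm n hn
    simp only [hD, Set.mem_ofPred_eq] at hn ⊢
    refine lt_of_le_of_lt ?_ hn
    have : (m : ℝ) ≤ m' := by exact_mod_cast hm
    gcongr
  have hfin : ∀ (S : Set ℕ) n, (S ∩ Set.Icc 1 n).Finite := fun S n =>
    (Set.finite_Icc 1 n).inter_of_right _
  set Q : ℕ → ℕ → Prop := fun n m =>
    ∀ n', n ≤ n' → ((D m ∩ Set.Icc 1 n').ncard : ℝ) / n' ≤ 1 / ((m : ℝ) + 1) with hQ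
  set m : ℕ → ℕ := fun n => Nat.findGreatest (Q n) n with hm
  have hmmono : Monotone m := fun n n' hn =>
    Nat.findGreatest_mono (fun k hk => fun n'' hn'' => hk n'' (hn.trans hn'')) hn
  have hQ0 : ∀ n, Q n 0 := by
    intro n n' _
    have h1 : (D 0 ∩ Set.Icc 1 n').ncard ≤ n' := by
      refine (Set.ncard_le_ncard Set.inter_subset_right (Set.finite_Icc 1 n')).trans ?_
      simp [Set.ncard_eq_toFinset_card']
    have h2 : ((D 0 ∩ Set.Icc 1 n').ncard : ℝ) ≤ n' := by exact_mod_cast h1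
    simpa using div_le_one_of_le₀ h2 (by positivity)
  have hQm : ∀ n, Q n (m n) := fun n => Nat.findGreatest_spec (Nat.zero_le n) (hQ0 n)
  have hmtop : Tendsto m atTop atTop := by
    refine tendsto_atTop.2 fun k => ?_
    have hk := (h (1 / ((k : ℝ) + 1)) (by positivity)).eventually_le_const
      (show (0 : ℝ) < 1 / ((k : ℝ) + 1) by positivity)
    obtain ⟨n₀, hn₀⟩ := eventually_atTop.1 hk
    filter_upwards [eventually_ge_atTop n₀, eventually_ge_atTop k] with n h1 h2
    exact Nat.le_findGreatest h2 fun n' hn' => hn₀ n' (h1.trans hn')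
  have hinv : Tendsto (fun n => 1 / ((m n : ℝ) + 1)) atTop (𝓝 0) :=
    tendsto_one_div_add_atTop_nhds_zero_nat.comp hmtop
  refine ⟨{n | n ∈ D (m n)}, ?_, ?_⟩
  · refine squeeze_zero (fun n => by positivity) (fun n => ?_) hinv
    refine le_trans ?_ (hQm n n le_rfl)
    have hsub : {n | n ∈ D (m n)} ∩ Set.Icc 1 n ⊆ D (m n) ∩ Set.Icc 1 n := by
      rintro j ⟨hj, hj1, hjn⟩
      exact ⟨hDmono (hmmono hjn) hj, hj1, hjn⟩
    have hcard := Set.ncard_le_ncard hsub (hfin _ _)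
    gcongr
  · rw [tendsto_iff_dist_tendsto_zero]
    refine squeeze_zero' (Eventually.of_forall fun n => dist_nonneg) ?_
      (hinv.mono_left inf_le_left)
    refine Eventually.filter_mono inf_le_right ?_
    rw [eventually_principal]
    intro n hn
    rw [Real.dist_eq]
    exact not_lt.1 hn

theorem sum_Ico_blocks (f : ℕ → ℝ) (J M i : ℕ) :
    ∑ n ∈ Finset.Ico (J * M) ((J + i) * M), f n
      = ∑ k ∈ Finset.Ico J (J + i), ∑ n ∈ Finset.Ico (k * M) ((k + 1) * M), f n := by
  induction i with
  | zero => simp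
  | succ i ih =>
    rw [← add_assoc, Finset.sum_Ico_succ_top (by omega), ← ih,
      Finset.sum_Ico_consecutive f (Nat.mul_le_mul_right _ (by omega))
        (Nat.mul_le_mul_right _ (by omega))]

/-- The average of `t` over the window `[kM, (k+1)M)`. -/
noncomputable def windowMean (t : ℕ → ℝ) (k M : ℕ) : ℝ :=
  (∑ n ∈ Finset.Ico (k * M) ((k + 1) * M), t n) / M

theorem abs_sub_le_of_lipschitz {W : ℕ → ℝ} {L : ℝ} {m : ℕ}
    (h : ∀ n, n < m → |W (n + 1) - W n| ≤ L) {a : ℕ} (i : ℕ) (hi : a + i ≤ m) :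
    |W (a + i) - W a| ≤ i * L := by
  induction i with
  | zero => simp
  | succ i ih =>
    have h1 := ih (by omega)
    have h2 := h (a + i) (by omega)
    calc |W (a + (i + 1)) - W a| ≤ |W (a + i + 1) - W (a + i)| + |W (a + i) - W a| :=
          abs_sub_le _ _ _
      _ ≤ L + i * L := add_le_add h2 h1
      _ = ((i + 1 : ℕ) : ℝ) * L := by push_cast; ring

theorem sum_window_abs_sub_mean_le {t W : ℕ → ℝ} {k M m : ℕ} {L : ℝ} (hM : 1 ≤ M) (hL : 0 ≤ L)
    (hm : (k + 1) * M ≤ m) (h : ∀ n, n < m → |W (n + 1) - W n| ≤ L) :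
    ∑ n ∈ Finset.Ico (k * M) ((k + 1) * M), |t n - windowMean t k M|
      ≤ 2 * ∑ n ∈ Finset.Ico (k * M) ((k + 1) * M), |t n - W n| + 2 * (M * (M * L)) := by
  set w := Finset.Ico (k * M) ((k + 1) * M) with hw
  have hM0 : (0 : ℝ) < M := by exact_mod_cast hM
  have hcard : (w.card : ℝ) = M := by
    rw [hw, Nat.card_Ico, add_mul, one_mul, Nat.add_sub_cancel_left]
  have h1 : ∑ n ∈ w, |W n - W (k * M)| ≤ M * (M * L) := by
    rw [← hcard, ← nsmul_eq_mul]
    refine Finset.sum_le_card_nsmul _ _ _ fun n hn => ?_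
    rw [hw, Finset.mem_Ico] at hn
    obtain ⟨i, rfl⟩ := Nat.exists_eq_add_of_le hn.1
    refine (abs_sub_le_of_lipschitz h i (by omega)).trans ?_
    rw [hcard]
    have : i ≤ M := by have := hn.2; rw [add_mul] at this; omega
    gcongr
  have h2 : M * |W (k * M) - windowMean t k M|
      ≤ ∑ n ∈ w, |W n - W (k * M)| + ∑ n ∈ w, |t n - W n| := by
    have e : M * (W (k * M) - windowMean t k M)
        = ∑ n ∈ w, ((W (k * M) - W n) + (W n - t n)) := by
      simp only [sub_add_sub_cancel]
      rw [Finset.sum_sub_distrib, Finset.sum_const, nsmul_eq_mul, hcard, windowMean, ← hw,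
        mul_sub, mul_div_cancel₀ _ hM0.ne']
    calc M * |W (k * M) - windowMean t k M| = |M * (W (k * M) - windowMean t k M)| := by
          rw [abs_mul, abs_of_pos hM0]
      _ ≤ ∑ n ∈ w, |(W (k * M) - W n) + (W n - t n)| := by
          rw [e]; exact Finset.abs_sum_le_sum_abs _ _
      _ ≤ ∑ n ∈ w, (|W n - W (k * M)| + |t n - W n|) := by
          refine Finset.sum_le_sum fun n _ => (abs_add_le _ _).trans ?_
          rw [abs_sub_comm, abs_sub_comm (W n) (t n)]
      _ = _ := Finset.sum_add_distrib
  calc ∑ n ∈ w, |t n - windowMean t k M|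
      ≤ ∑ n ∈ w, (|t n - W n| + |W n - W (k * M)| + |W (k * M) - windowMean t k M|) := by
        refine Finset.sum_le_sum fun n _ => ?_
        have e : t n - windowMean t k M
            = (t n - W n) + (W n - W (k * M)) + (W (k * M) - windowMean t k M) := by ring
        rw [e]
        exact (abs_add_le _ _).trans (add_le_add_left (abs_add_le _ _) _)
    _ = ∑ n ∈ w, |t n - W n| + ∑ n ∈ w, |W n - W (k * M)|
        + M * |W (k * M) - windowMean t k M| := by
        rw [Finset.sum_add_distrib, Finset.sum_add_distrib, Finset.sum_const, nsmul_eq_mul, hcard]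
    _ ≤ _ := by linarith

theorem tendsto_windowMean {t : ℕ → ℝ} {τ : ℝ → ℝ} {c β : ℝ} (hτ : IsRegVarTail τ β)
    (hsum : ∀ k : ℕ, 1 ≤ k → Tendsto (fun N : ℕ => τ N * ∑ n ∈ Finset.range (k * N), t n) atTop
      (𝓝 (c * ((k : ℝ) ^ β / β)))) {a b k : ℕ} (hb : 1 ≤ b) (hk : 1 ≤ k) :
    Tendsto (fun M : ℕ => (a * M : ℕ) * τ (b * M : ℕ) * windowMean t k M) atTop
      (𝓝 (a * (b : ℝ) ^ (-β) * (c * (((k : ℝ) + 1) ^ β / β) - c * ((k : ℝ) ^ β / β)))) := by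
  have h1 := (hsum (k + 1) (by omega)).sub (hsum k hk)
  have h2 := (hτ.ratio b (by exact_mod_cast hb)).comp tendsto_natCast_atTop_atTop
  push_cast at h1
  have h3 := (h2.const_mul (a : ℝ)).mul h1
  refine h3.congr' ?_
  filter_upwards [eventually_ge_atTop 1] with M hM
  have hM0 : (0 : ℝ) < M := by exact_mod_cast hM
  have hτM := hτ.pos M
  rw [windowMean, Finset.sum_Ico_eq_sub _ (Nat.mul_le_mul_right _ (by omega))]
  simp only [Function.comp_apply]
  push_cast
  field_simp

theorem tendsto_mul_succ_rpow_sub (β : ℝ) :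
    Tendsto (fun k : ℕ => (k : ℝ) * (k : ℝ) ^ (-β) * (((k : ℝ) + 1) ^ β - (k : ℝ) ^ β)) atTop
      (𝓝 β) := by
  have hd : HasDerivAt (fun x : ℝ => x ^ β) (β * 1 ^ (β - 1)) 1 :=
    Real.hasDerivAt_rpow_const (Or.inl one_ne_zero)
  rw [Real.one_rpow, mul_one, hasDerivAt_iff_tendsto_slope_zero] at hd
  have hz : Tendsto (fun k : ℕ => ((k : ℝ))⁻¹) atTop (𝓝[≠] 0) := by
    refine tendsto_nhdsWithin_iff.2 ⟨tendsto_inv_atTop_nhds_zero_nat, ?_⟩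
    filter_upwards [eventually_ge_atTop 1] with k hk
    have : (0 : ℝ) < k := by exact_mod_cast hk
    exact (inv_pos.2 this).ne'
  refine (hd.comp hz).congr' ?_
  filter_upwards [eventually_ge_atTop 1] with k hk
  have hk0 : (0 : ℝ) < k := by exact_mod_cast hk
  simp only [Function.comp_apply, smul_eq_mul, inv_inv, Real.one_rpow]
  have e : (1 : ℝ) + (k : ℝ)⁻¹ = ((k : ℝ) + 1) / k := by field_simp
  rw [e, Real.div_rpow (by positivity) hk0.le, Real.rpow_neg hk0.le]
  have : (0 : ℝ) < (k : ℝ) ^ β := by positivity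
  field_simp

/-- On late windows, the window mean is close to its expected size. -/
theorem eventually_windowMean_close {t : ℕ → ℝ} {τ : ℝ → ℝ} {c β : ℝ} (hβ : 0 < β)
    (hτ : IsRegVarTail τ β) (ht : ∀ n, 0 ≤ t n)
    (hsum : ∀ k : ℕ, 1 ≤ k → Tendsto (fun N : ℕ => τ N * ∑ n ∈ Finset.range (k * N), t n) atTop
      (𝓝 (c * ((k : ℝ) ^ β / β)))) {ε : ℝ} (hε : 0 < ε) :
    ∀ᶠ k : ℕ in atTop, ∀ᶠ M : ℕ in atTop, ∀ n ∈ Finset.Ico (k * M) ((k + 1) * M),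
      |n * τ n * windowMean t k M - c| ≤ ε := by
  have hone : Tendsto (fun k : ℕ => ((k : ℝ) + 1) / k) atTop (𝓝 1) := by
    have := (tendsto_natCast_div_add_atTop (1 : ℝ)).inv₀ one_ne_zero
    simpa using this
  have hratio : Tendsto (fun k : ℕ => (((k : ℝ) + 1) / k) ^ (-β)) atTop (𝓝 1) := by
    have := hone.rpow_const (p := -β) (Or.inl one_ne_zero)
    simpa using this
  have hbase := tendsto_mul_succ_rpow_sub β
  have hlow : Tendsto (fun k : ℕ => (k : ℝ) * ((k + 1 : ℕ) : ℝ) ^ (-β)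
      * (c * (((k : ℝ) + 1) ^ β / β) - c * ((k : ℝ) ^ β / β))) atTop (𝓝 c) := by
    have := ((hbase.mul hratio).const_mul (c / β))
    rw [mul_one, div_mul_cancel₀ _ hβ.ne'] at this
    refine this.congr' ?_
    filter_upwards [eventually_ge_atTop 1] with k hk
    have hk0 : (0 : ℝ) < k := by exact_mod_cast hk
    rw [Real.div_rpow (by positivity) hk0.le]
    have : (0 : ℝ) < (k : ℝ) ^ (-β) := by positivity
    push_cast
    field_simp
  have hup : Tendsto (fun k : ℕ => ((k + 1 : ℕ) : ℝ) * (k : ℝ) ^ (-β)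
      * (c * (((k : ℝ) + 1) ^ β / β) - c * ((k : ℝ) ^ β / β))) atTop (𝓝 c) := by
    have := ((hbase.mul hone).const_mul (c / β))
    rw [mul_one, div_mul_cancel₀ _ hβ.ne'] at this
    refine this.congr' ?_
    filter_upwards [eventually_ge_atTop 1] with k hk
    have hk0 : (0 : ℝ) < k := by exact_mod_cast hk
    push_cast
    field_simp
  filter_upwards [hlow.eventually_const_lt (show c - ε < c by linarith),
    hup.eventually_lt_const (show c < c + ε by linarith), eventually_ge_atTop 1] with k h1 h2 hk
  filter_upwards [(tendsto_windowMean hτ hsum (by omega) hk).eventually_const_lt h1,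
    (tendsto_windowMean hτ hsum hk hk).eventually_lt_const h2] with M h3 h4 n hn
  rw [Finset.mem_Ico] at hn
  have hm : 0 ≤ windowMean t k M :=
    div_nonneg (Finset.sum_nonneg fun n _ => ht n) (by positivity)
  have hn1 : ((k * M : ℕ) : ℝ) ≤ n := by exact_mod_cast hn.1
  have hn2 : (n : ℝ) ≤ ((k + 1) * M : ℕ) := by exact_mod_cast hn.2.le
  have l1 : ((k * M : ℕ) : ℝ) * τ ((k + 1) * M : ℕ) * windowMean t k M
      ≤ n * τ n * windowMean t k M := by
    have := (hτ.pos ((k + 1) * M : ℕ)).le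
    have := hτ.anti hn2
    gcongr
  have l2 : n * τ n * windowMean t k M
      ≤ (((k + 1) * M : ℕ) : ℝ) * τ (k * M : ℕ) * windowMean t k M := by
    have := (hτ.pos n).le
    have := hτ.anti hn1
    gcongr
  rw [abs_le]
  constructor <;> linarith

theorem hasDensityZero_deviation {t : ℕ → ℝ} {τ : ℝ → ℝ} {c β : ℝ} (hβ : 0 < β)
    (hτ : IsRegVarTail τ β) (ht : ∀ n, 0 ≤ t n)
    (hsum : ∀ k : ℕ, 1 ≤ k → Tendsto (fun N : ℕ => τ N * ∑ n ∈ Finset.range (k * N), t n) atTop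
      (𝓝 (c * ((k : ℝ) ^ β / β))))
    (hW : ∀ δ : ℝ, 0 < δ → ∃ C : ℝ, 0 ≤ C ∧ ∀ᶠ N : ℕ in atTop, ∃ W : ℕ → ℝ,
      ∑ n ∈ Finset.range (2 * N), |t n - W n| ≤ δ / τ N ∧
      ∀ n, n < 2 * N → |W (n + 1) - W n| ≤ C / ((N : ℝ) ^ 2 * τ N)) {ε : ℝ} (hε : 0 < ε) :
    HasDensityZero {n : ℕ | ε < |n * τ n * t n - c|} := by
  refine hasDensityZero_of_blocks fun η hη => ?_
  obtain ⟨C, hC, hWC⟩ := hW (η * ε / 16) (by positivity)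
  obtain ⟨K, hK⟩ := eventually_atTop.1 (eventually_windowMean_close hβ hτ ht hsum
    (show 0 < ε / 2 by positivity))
  obtain ⟨J₀, hJ₀⟩ := exists_nat_ge (16 * C / (ε * η))
  set J := max (max K J₀) 1
  have hJ1 : 1 ≤ J := le_max_right _ _
  have hJr : (0 : ℝ) < J := by exact_mod_cast hJ1
  have hJC : 16 * C / (ε * η) ≤ J := hJ₀.trans (by
    exact_mod_cast (le_max_right K J₀).trans (le_max_left _ 1))
  refine ⟨J, hJ1, ?_⟩
  have hall : ∀ᶠ M : ℕ in atTop, ∀ k ∈ Finset.Ico J (J + J),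
      ∀ n ∈ Finset.Ico (k * M) ((k + 1) * M), |n * τ n * windowMean t k M - c| ≤ ε / 2 := by
    rw [Filter.eventually_all_finset]
    intro k hk
    exact hK k (((le_max_left K J₀).trans (le_max_left _ 1)).trans (Finset.mem_Ico.1 hk).1)
  have hJM : Tendsto (fun M : ℕ => J * M) atTop atTop :=
    tendsto_id.const_mul_atTop' (by omega)
  filter_upwards [hall, hJM.eventually hWC, eventually_ge_atTop 1] with M h1 ⟨W, h2, h3⟩ hM
  set N := J * M with hN
  have hN1 : 1 ≤ N := Nat.mul_pos hJ1 hM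
  have hN0 : (0 : ℝ) < N := by exact_mod_cast hN1
  have hM0 : (0 : ℝ) < M := by exact_mod_cast hM
  have hτN := hτ.pos N
  have h2N : 2 * N = (J + J) * M := by rw [hN]; ring
  set g : ℕ → ℝ := fun n => 4 * N * τ N / ε * |t n - windowMean t (n / M) M| with hg
  have hdiv : ∀ {k n : ℕ}, n ∈ Finset.Ico (k * M) ((k + 1) * M) → n / M = k := by
    intro k n hn
    rw [Finset.mem_Ico] at hn
    exact Nat.div_eq_of_lt_le hn.1 hn.2
  have hbad : ∀ n ∈ Finset.Ico N (2 * N), ε < |n * τ n * t n - c| → 1 ≤ g n := by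
    intro n hn hlt
    rw [Finset.mem_Ico] at hn
    have hkmem : n / M ∈ Finset.Ico J (J + J) := by
      rw [Finset.mem_Ico, Nat.le_div_iff_mul_le (by omega), Nat.div_lt_iff_lt_mul (by omega)]
      exact ⟨hn.1, by rw [← h2N]; exact hn.2⟩
    have hnw : n ∈ Finset.Ico (n / M * M) ((n / M + 1) * M) := by
      rw [Finset.mem_Ico]
      exact ⟨Nat.div_mul_le_self n M, by
        rw [mul_comm]; exact Nat.lt_mul_div_succ n (by omega)⟩
    have h4 := h1 _ hkmem n hnw
    have h5 : |n * τ n * t n - c| ≤ n * τ n * |t n - windowMean t (n / M) M|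
        + |n * τ n * windowMean t (n / M) M - c| := by
      have e : n * τ n * t n - c = n * τ n * (t n - windowMean t (n / M) M)
        + (n * τ n * windowMean t (n / M) M - c) := by ring
      have hp : 0 ≤ n * τ n := mul_nonneg (by positivity) (hτ.pos n).le
      calc |n * τ n * t n - c| ≤ |n * τ n * (t n - windowMean t (n / M) M)|
            + |n * τ n * windowMean t (n / M) M - c| := by
            rw [e]; exact abs_add_le _ _
        _ = _ := by rw [abs_mul, abs_of_nonneg hp]
    have h6 : n * τ n ≤ 2 * N * τ N := by
      have a1 : (n : ℝ) ≤ 2 * N := by exact_mod_cast hn.2.le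
      have a2 : τ n ≤ τ N := hτ.anti (by exact_mod_cast hn.1)
      have := (hτ.pos n).le
      gcongr
    have h7 : n * τ n * |t n - windowMean t (n / M) M|
        ≤ 2 * N * τ N * |t n - windowMean t (n / M) M| := by gcongr
    have h8 : ε ≤ 4 * N * τ N * |t n - windowMean t (n / M) M| := by linarith
    simp only [hg]
    rw [div_mul_eq_mul_div, le_div_iff₀ hε, one_mul]
    exact h8
  classical
  have hcount : (({n : ℕ | ε < |n * τ n * t n - c|} ∩ Set.Ico N (2 * N)).ncard : ℝ)
      ≤ ∑ n ∈ Finset.Ico N (2 * N), g n := by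
    have e : {n : ℕ | ε < |n * τ n * t n - c|} ∩ Set.Ico N (2 * N)
        = ((Finset.Ico N (2 * N)).filter fun n : ℕ => ε < |n * τ n * t n - c| : Finset ℕ) := by
      ext n
      simp [and_comm]
    rw [e, Set.ncard_coe_finset, Finset.card_eq_sum_ones, Nat.cast_sum]
    simp only [Nat.cast_one]
    refine (Finset.sum_le_sum fun n hn => ?_).trans
      (Finset.sum_le_sum_of_subset_of_nonneg (Finset.filter_subset _ _) fun n _ _ => ?_)
    · rw [Finset.mem_filter] at hn
      exact hbad n hn.1 hn.2
    · simp only [hg]; positivity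
  refine hcount.trans ?_
  have hL1 : ∑ n ∈ Finset.Ico N (2 * N), |t n - windowMean t (n / M) M|
      ≤ (2 * (η * ε / 16) + 2 * (C / J)) / τ N := by
    rw [h2N, hN, sum_Ico_blocks]
    set L := C / ((N : ℝ) ^ 2 * τ N) with hLdef
    calc ∑ k ∈ Finset.Ico J (J + J), ∑ n ∈ Finset.Ico (k * M) ((k + 1) * M),
          |t n - windowMean t (n / M) M|
        ≤ ∑ k ∈ Finset.Ico J (J + J), (2 * ∑ n ∈ Finset.Ico (k * M) ((k + 1) * M),
          |t n - W n| + 2 * (M * (M * L))) := by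
          refine Finset.sum_le_sum fun k hk => ?_
          rw [Finset.sum_congr rfl fun n hn => by rw [hdiv hn]]
          refine sum_window_abs_sub_mean_le hM (by positivity) ?_ h3
          rw [h2N]
          exact Nat.mul_le_mul_right _ (by have := (Finset.mem_Ico.1 hk).2; omega)
      _ = 2 * ∑ n ∈ Finset.Ico N (2 * N), |t n - W n| + J * (2 * (M * (M * L))) := by
          rw [Finset.sum_add_distrib, ← Finset.mul_sum, ← sum_Ico_blocks, ← h2N, ← hN,
            Finset.sum_const, Nat.card_Ico, Nat.add_sub_cancel, nsmul_eq_mul]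
      _ ≤ 2 * (η * ε / 16 / τ N) + J * (2 * (M * (M * L))) := by
          gcongr
          refine le_trans ?_ h2
          refine Finset.sum_le_sum_of_subset_of_nonneg ?_ fun n _ _ => abs_nonneg _
          intro n hn
          exact Finset.mem_range.2 (Finset.mem_Ico.1 hn).2
      _ = (2 * (η * ε / 16) + 2 * (C / J)) / τ N := by
          rw [hLdef, hN]
          push_cast
          rw [hN] at hτN
          push_cast at hτN
          field_simp
  rw [← Finset.mul_sum]
  calc 4 * N * τ N / ε * ∑ n ∈ Finset.Ico N (2 * N), |t n - windowMean t (n / M) M|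
      ≤ 4 * N * τ N / ε * ((2 * (η * ε / 16) + 2 * (C / J)) / τ N) := by gcongr
    _ = N * (η / 2 + 8 * C / (ε * J)) := by field_simp; ring
    _ ≤ N * (η / 2 + η / 2) := by
        have : 8 * C / (ε * J) ≤ η / 2 := by
          rw [div_le_iff₀ (by positivity)] at hJC ⊢
          nlinarith
        gcongr
    _ = η * N := by ring

end ZeroDensity

section RankOne

variable {B : Type*} [NormedAddCommGroup B] [NormedSpace ℂ B]

theorem isUnit_and_inverse_of_mul_eq_one {R : Type*} [MonoidWithZero R] {a b : R} (h : a * b = 1)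
    (h' : b * a = 1) : IsUnit a ∧ Ring.inverse a = b :=
  ⟨⟨⟨a, b, h, h'⟩, rfl⟩, Ring.inverse_unit ⟨a, b, h, h'⟩⟩

/-- The Sherman–Morrison formula for a rank one perturbation of an invertible operator. -/
theorem inverse_sub_smulRight {N : B →L[ℂ] B} (hN : IsUnit N) (ψ : B →L[ℂ] ℂ) (e : B)
    (hD : 1 - ψ (Ring.inverse N e) ≠ 0) :
    IsUnit (N - ψ.smulRight e) ∧ ∀ v, Ring.inverse (N - ψ.smulRight e) v = Ring.inverse N v
      + (ψ (Ring.inverse N v) / (1 - ψ (Ring.inverse N e))) • Ring.inverse N e := by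
  set N' := Ring.inverse N
  have h1 : ∀ v, N (N' v) = v := fun v => DFunLike.congr_fun (Ring.mul_inverse_cancel N hN) v
  have h2 : ∀ v, N' (N v) = v := fun v => DFunLike.congr_fun (Ring.inverse_mul_cancel N hN) v
  set D := 1 - ψ (N' e) with hDdef
  have hDe : ψ (N' e) = 1 - D := by rw [hDdef]; ring
  obtain ⟨hu, hinv⟩ := isUnit_and_inverse_of_mul_eq_one (a := N - ψ.smulRight e)
    (b := N' + (D⁻¹ • ψ.comp N').smulRight (N' e)) (by
      ext v
      simp only [mul_apply_eq_comp, add_apply, sub_apply,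
        ContinuousLinearMap.smulRight_apply, smul_apply,
        ContinuousLinearMap.comp_apply, map_add, map_smul, h1, hDe, smul_eq_mul,
        one_apply_eq_self]
      match_scalars <;> field_simp
      ring) (by
      ext v
      simp only [mul_apply_eq_comp, add_apply, sub_apply,
        ContinuousLinearMap.smulRight_apply, smul_apply,
        ContinuousLinearMap.comp_apply, map_sub, map_smul, h2, hDe, smul_eq_mul,
        one_apply_eq_self]
      match_scalars <;> field_simp
      ring)
  refine ⟨hu, fun v => ?_⟩
  rw [hinv]
  simp only [add_apply, ContinuousLinearMap.smulRight_apply,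
    smul_apply, ContinuousLinearMap.comp_apply, smul_eq_mul]
  rw [div_eq_inv_mul]

variable [CompleteSpace B]

theorem circleIntegral_mul_left (X : B →L[ℂ] B) {f : ℂ → B →L[ℂ] B} {a : ℂ} {r : ℝ}
    (hf : CircleIntegrable f a r) :
    X * (∮ ζ in C(a, r), f ζ) = ∮ ζ in C(a, r), X * f ζ := by
  have := ((ContinuousLinearMap.mul ℂ (B →L[ℂ] B)) X).intervalIntegral_comp_comm hf.out
  simp only [ContinuousLinearMap.mul_apply', mul_smul_comm] at this
  exact this.symm

theorem circleIntegral_mul_right (X : B →L[ℂ] B) {f : ℂ → B →L[ℂ] B} {a : ℂ} {r : ℝ}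
    (hf : CircleIntegrable f a r) :
    (∮ ζ in C(a, r), f ζ) * X = ∮ ζ in C(a, r), f ζ * X := by
  have := ((ContinuousLinearMap.mul ℂ (B →L[ℂ] B)).flip X).intervalIntegral_comp_comm hf.out
  simp only [ContinuousLinearMap.flip_apply, ContinuousLinearMap.mul_apply',
    smul_mul_assoc] at this
  exact this.symm

theorem exists_mul_eq_one_sub_spectralProjection {A : B →L[ℂ] B} {r : ℝ} (hr : 0 < r)
    (hs : spectrum ℂ A ∩ Metric.closedBall 1 r = {1}) :
    ∃ S : B →L[ℂ] B, (1 - A) * S = 1 - spectralProjection A 1 r ∧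
      S * (1 - A) = 1 - spectralProjection A 1 r := by
  have hne : ∀ ζ ∈ Metric.sphere (1 : ℂ) r, ζ - 1 ≠ 0 := by
    intro ζ hζ h0
    rw [mem_sphere_iff_norm, h0, norm_zero] at hζ
    exact hr.ne hζ
  have hres : ∀ ζ ∈ Metric.sphere (1 : ℂ) r, ζ ∈ resolventSet ℂ A := by
    intro ζ hζ
    by_contra hc
    have : ζ ∈ ({1} : Set ℂ) := hs ▸ ⟨hc, Metric.sphere_subset_closedBall hζ⟩
    rw [Set.mem_singleton_iff] at this
    exact hne ζ hζ (by rw [this, sub_self])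
  have hcont : ContinuousOn (resolvent A) (Metric.sphere (1 : ℂ) r) := fun ζ hζ =>
    (spectrum.hasDerivAt_resolvent_const_left (hres ζ hζ)).continuousAt.continuousWithinAt
  have hcinv : ContinuousOn (fun ζ : ℂ => (ζ - 1)⁻¹) (Metric.sphere (1 : ℂ) r) :=
    ContinuousOn.inv₀ (by fun_prop) hne
  have i1 : CircleIntegrable (resolvent A) 1 r := hcont.circleIntegrable hr.le
  have i2 : CircleIntegrable (fun ζ : ℂ => (ζ - 1)⁻¹ • resolvent A ζ) 1 r :=
    (hcinv.smul hcont).circleIntegrable hr.le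
  have i3 : CircleIntegrable (fun ζ : ℂ => (ζ - 1)⁻¹ • (1 : B →L[ℂ] B)) 1 r :=
    (hcinv.smul continuousOn_const).circleIntegrable hr.le
  have hpi : (2 * Real.pi * Complex.I : ℂ) ≠ 0 := by simp [Real.pi_ne_zero]
  have hval : (2 * Real.pi * Complex.I : ℂ)⁻¹ •
      ((∮ ζ in C((1 : ℂ), r), (ζ - 1)⁻¹ • (1 : B →L[ℂ] B)) - ∮ ζ in C((1 : ℂ), r), resolvent A ζ)
      = 1 - spectralProjection A 1 r := by
    rw [spectralProjection, smul_sub, circleIntegral.integral_smul_const,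
      circleIntegral.integral_sub_center_inv _ hr.ne', smul_smul, inv_mul_cancel₀ hpi, one_smul]
  have hunit : ∀ ζ ∈ Metric.sphere (1 : ℂ) r, IsUnit (algebraMap ℂ (B →L[ℂ] B) ζ - A) :=
    fun ζ hζ => hres ζ hζ
  have hsplit : ∀ ζ : ℂ, (1 - A : B →L[ℂ] B) = (algebraMap ℂ (B →L[ℂ] B) ζ - A)
      - (ζ - 1) • 1 := by
    intro ζ
    rw [Algebra.algebraMap_eq_smul_one, sub_smul, one_smul]
    abel
  refine ⟨(2 * Real.pi * Complex.I : ℂ)⁻¹ • ∮ ζ in C((1 : ℂ), r), (ζ - 1)⁻¹ • resolvent A ζ,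
    ?_, ?_⟩
  · rw [mul_smul_comm, circleIntegral_mul_left _ i2, ← hval, ← circleIntegral.integral_sub i3 i1]
    congr 1
    refine circleIntegral.integral_congr hr.le fun ζ hζ => ?_
    rw [mul_smul_comm, hsplit ζ, sub_mul, resolvent, Ring.mul_inverse_cancel _ (hunit ζ hζ),
      smul_mul_assoc, one_mul, smul_sub, smul_smul, inv_mul_cancel₀ (hne ζ hζ), one_smul]
  · rw [smul_mul_assoc, circleIntegral_mul_right _ i2, ← hval, ← circleIntegral.integral_sub i3 i1]
    congr 1
    refine circleIntegral.integral_congr hr.le fun ζ hζ => ?_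
    rw [smul_mul_assoc, hsplit ζ, mul_sub, resolvent, Ring.inverse_mul_cancel _ (hunit ζ hζ),
      mul_smul_comm, mul_one, smul_sub, smul_smul, inv_mul_cancel₀ (hne ζ hζ), one_smul]

theorem spectralProjection_apply_fixed {A : B →L[ℂ] B} {r : ℝ} (hr : 0 < r)
    (hs : spectrum ℂ A ∩ Metric.closedBall 1 r = {1}) {e : B} (he : A e = e) :
    spectralProjection A 1 r e = e := by
  obtain ⟨S, -, hS⟩ := exists_mul_eq_one_sub_spectralProjection hr hs
  have h := DFunLike.congr_fun hS e
  simp only [mul_apply_eq_comp, sub_apply,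
    one_apply_eq_self, he, sub_self, map_zero] at h
  exact (sub_eq_zero.1 h.symm).symm

/-- If `1` is a simple isolated eigenvalue of `A` with eigenvector `e`, and `ψ` is an invariant
functional with `ψ e = 1`, then `I - A + ψ(·) e` is invertible. -/
theorem isUnit_one_sub_add_smulRight {A : B →L[ℂ] B} (hA : IsSimpleIsolatedEigenvalue A 1)
    {e : B} (he : A e = e) {ψ : B →L[ℂ] ℂ} (hψ : ∀ v, ψ (A v) = ψ v) (hψe : ψ e = 1) :
    IsUnit (1 - A + ψ.smulRight e) := by
  obtain ⟨-, r, hr, hs, hrank⟩ := hA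
  obtain ⟨S, hS1, hS2⟩ := exists_mul_eq_one_sub_spectralProjection hr hs
  have hPe := spectralProjection_apply_fixed hr hs he
  have he0 : e ≠ 0 := by
    rintro rfl
    simp at hψe
  set P := spectralProjection A 1 r
  have hP : P = ψ.smulRight e := by
    ext v
    have hmem : e ∈ LinearMap.range (P : B →ₗ[ℂ] B) := ⟨e, hPe⟩
    obtain ⟨c, hc⟩ := (finrank_eq_one_iff_of_nonzero' (⟨e, hmem⟩ : LinearMap.range (P : B →ₗ[ℂ] B))
      (by simpa [Subtype.ext_iff] using he0)).1 hrank ⟨P v, ⟨v, rfl⟩⟩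
    have hc' : c • e = P v := congrArg Subtype.val hc
    have h := congrArg ψ (DFunLike.congr_fun hS1 v)
    simp only [mul_apply_eq_comp, sub_apply,
      one_apply_eq_self, map_sub, hψ, sub_self] at h
    rw [← hc', map_smul, hψe, smul_eq_mul, mul_one] at h
    rw [ContinuousLinearMap.smulRight_apply, ← hc', sub_eq_zero.1 h.symm]
  rw [← hP]
  have hPP : P * P = P := by
    ext v; simp [hP, hψe]
  have hAP : A * P = P := by
    ext v; simp [hP, he]
  have hPA : P * A = P := by
    ext v; simp [hP, hψ]
  have hcomm : S * P = P * S := by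
    have h1 : S * (1 - P) = (1 - P) * S := by
      rw [← hS1, ← mul_assoc, hS2, hS1]
    rw [mul_sub, sub_mul, mul_one, one_mul] at h1
    exact sub_right_injective h1
  refine (isUnit_and_inverse_of_mul_eq_one (b := S * (1 - P) + P) ?_ ?_).1
  · have : (1 - A + P) * (S * (1 - P) + P)
        = ((1 - A) * S) * (1 - P) + (P - A * P) + (P * S) * (1 - P) + P * P := by noncomm_ring
    rw [this, hS1, hAP, ← hcomm]
    have : (1 - P) * (1 - P) + (P - P) + S * P * (1 - P) + P * P
      = 1 - P - P + P * P + (S * P - S * (P * P)) + P * P := by noncomm_ring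
    rw [this, hPP]
    abel
  · have : (S * (1 - P) + P) * (1 - A + P)
        = S * (1 - A) - S * (P - P * A) + S * (P - P * P) + (P - P * A) + P * P := by noncomm_ring
    rw [this, hS2, hPA, hPP]
    simp

end RankOne

set_option linter.unusedSectionVars false

section ReturnOperators

variable {Y : Type*} [MeasurableSpace Y] {μ : Measure Y} [IsProbabilityMeasure μ]
  {F : Y → Y} {φ : Y → ℕ} {B : Type*} [NormedAddCommGroup B] [NormedSpace ℂ B]

theorem Lp_top_ae_norm_le (f : Lp ℂ ∞ μ) : ∀ᵐ y ∂μ, ‖f y‖ ≤ ‖f‖ := by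
  filter_upwards [ae_le_eLpNormEssSup (f := f) (μ := μ)] with y hy
  rw [Lp.norm_def, eLpNorm_exponent_top]
  have hfin : eLpNormEssSup f μ ≠ ∞ := by
    have := Lp.eLpNorm_ne_top f
    rwa [eLpNorm_exponent_top] at this
  rw [← ENNReal.ofReal_le_iff_le_toReal hfin, ofReal_norm]
  exact hy

theorem Lp_top_integrable (f : Lp ℂ ∞ μ) : Integrable f μ := (Lp.memLp f).integrable le_top

theorem norm_setIntegral_Lp_top_le (f : Lp ℂ ∞ μ) (s : Set Y) :
    ‖∫ y in s, f y ∂μ‖ ≤ ‖f‖ * μ.real s :=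
  norm_setIntegral_le_of_norm_le_const_ae (measure_lt_top μ s) (ae_restrict_of_ae (by
    filter_upwards [Lp_top_ae_norm_le f] with y hy using hy))

/-- The functional `v ↦ ∫_s v dμ`. -/
noncomputable def setFunctional (ι : B →ₗ[ℂ] Lp ℂ ∞ μ) (hι : ∀ v : B, ‖ι v‖ ≤ ‖v‖) (s : Set Y) :
    B →L[ℂ] ℂ :=
  LinearMap.mkContinuous
    { toFun := fun v => ∫ y in s, ι v y ∂μ
      map_add' := fun u v => by
        rw [← integral_add (Lp_top_integrable _).integrableOn (Lp_top_integrable _).integrableOn,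
          map_add]
        exact integral_congr_ae (ae_restrict_of_ae (Lp.coeFn_add _ _))
      map_smul' := fun c v => by
        rw [RingHom.id_apply, ← integral_smul, map_smul]
        exact integral_congr_ae (ae_restrict_of_ae (Lp.coeFn_smul _ _)) } 1 fun v => by
    refine (norm_setIntegral_Lp_top_le _ _).trans ?_
    rw [one_mul]
    exact (mul_le_of_le_one_right (norm_nonneg _) measureReal_le_one).trans (hι v)

theorem setFunctional_apply (ι : B →ₗ[ℂ] Lp ℂ ∞ μ) (hι : ∀ v : B, ‖ι v‖ ≤ ‖v‖) (s : Set Y)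
    (v : B) : setFunctional ι hι s v = ∫ y in s, ι v y ∂μ := rfl

theorem norm_setFunctional_apply_le (ι : B →ₗ[ℂ] Lp ℂ ∞ μ) (hι : ∀ v : B, ‖ι v‖ ≤ ‖v‖)
    (s : Set Y) (v : B) : ‖setFunctional ι hι s v‖ ≤ ‖v‖ :=
  (norm_setIntegral_Lp_top_le _ _).trans
    ((mul_le_of_le_one_right (norm_nonneg _) measureReal_le_one).trans (hι v))

theorem norm_one_sub_pow_le {z : ℂ} (hz : ‖z‖ ≤ 1) (n : ℕ) : ‖1 - z ^ n‖ ≤ 2 := by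
  have h1 : ‖z ^ n‖ ≤ 1 := by rw [norm_pow]; exact pow_le_one₀ (norm_nonneg _) hz
  have h2 := norm_sub_le (1 : ℂ) (z ^ n)
  rw [norm_one] at h2
  linarith

/-- The operators `R_n v = R(1_{φ = n} v)` act on a space `B` of bounded functions, with
`‖R_n‖ ≤ C μ(φ = n)`; `e` is the constant function `1`. -/
structure IsReturnOperators (μ : Measure Y) (F : Y → Y) (φ : Y → ℕ) (ι : B →ₗ[ℂ] Lp ℂ ∞ μ)
    (Rn : ℕ → B →L[ℂ] B) (e : B) (C : ℝ) : Prop where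
  preserving : MeasurePreserving F μ μ
  measurable : Measurable φ
  one_le : ∀ y, 1 ≤ φ y
  injective : Function.Injective ι
  norm_le : ∀ v, ‖ι v‖ ≤ ‖v‖
  const_one : ι e =ᵐ[μ] fun _ => (1 : ℂ)
  transfer : ∀ n : ℕ, 1 ≤ n → ∀ v : B,
    ι (Rn n v) =ᵐ[μ] transferOperator μ F ({y | φ y = n}.indicator (ι v))
  nonneg : 0 ≤ C
  bound : ∀ n : ℕ, 1 ≤ n → ‖Rn n‖ ≤ C * μ.real {y | φ y = n}

namespace IsReturnOperators

variable {ι : B →ₗ[ℂ] Lp ℂ ∞ μ} {Rn : ℕ → B →L[ℂ] B} {e : B} {C : ℝ}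
  (h : IsReturnOperators μ F φ ι Rn e C)

include h

theorem measurableSet_eq (n : ℕ) : MeasurableSet {y | φ y = n} :=
  h.measurable (measurableSet_singleton n)

theorem hasSum_setIntegral {E : Type*} [NormedAddCommGroup E] [NormedSpace ℝ E] {f : Y → E}
    (hf : Integrable f μ) {s : Set Y} (hs : MeasurableSet s) :
    HasSum (fun n : ℕ => ∫ y in s ∩ {y | φ y = n + 1}, f y ∂μ) (∫ y in s, f y ∂μ) := by
  have hU : ⋃ n : ℕ, s ∩ {y | φ y = n + 1} = s := by
    ext y
    simp only [Set.mem_iUnion, Set.mem_inter_iff, Set.mem_ofPred_eq, exists_and_left,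
      and_iff_left_iff_imp]
    intro _
    exact ⟨φ y - 1, by have := h.one_le y; omega⟩
  have := hasSum_integral_iUnion (μ := μ) (f := f) (s := fun n : ℕ => s ∩ {y | φ y = n + 1})
    (fun n => hs.inter (h.measurableSet_eq _)) (fun i j hij => by
      refine Set.disjoint_left.2 fun y hy hy' => hij ?_
      have h1 : φ y = i + 1 := hy.2
      have h2 : φ y = j + 1 := hy'.2
      omega) hf.integrableOn
  rwa [hU] at this

theorem integrable_comp {g : ℕ → ℝ} {K : ℝ} (hg : ∀ n, |g n| ≤ K) :
    Integrable (fun y => g (φ y)) μ :=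
  Integrable.of_bound (measurable_from_nat.comp h.measurable).aestronglyMeasurable K
    (Eventually.of_forall fun _ => hg _)

theorem integrable_comp_complex {g : ℕ → ℂ} {K : ℝ} (hg : ∀ n, ‖g n‖ ≤ K) :
    Integrable (fun y => g (φ y)) μ :=
  Integrable.of_bound (measurable_from_nat.comp h.measurable).aestronglyMeasurable K
    (Eventually.of_forall fun _ => hg _)

theorem hasSum_measureReal_mul {g : ℕ → ℝ} {K : ℝ} (hg : ∀ n, |g n| ≤ K) :
    HasSum (fun n : ℕ => μ.real {y | φ y = n + 1} * g (n + 1)) (∫ y, g (φ y) ∂μ) := by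
  have h1 := h.hasSum_setIntegral (h.integrable_comp hg) MeasurableSet.univ
  rw [setIntegral_univ] at h1
  refine h1.congr_fun fun n => ?_
  rw [Set.univ_inter, setIntegral_congr_fun (g := fun _ => g (n + 1)) (h.measurableSet_eq _)
    fun y hy => by rw [show φ y = n + 1 from hy], setIntegral_const, smul_eq_mul]

theorem setIntegral_renewal (n : ℕ) (hn : 1 ≤ n) (v : B) {s : Set Y} (hs : MeasurableSet s) :
    ∫ y in s, ι (Rn n v) y ∂μ = ∫ y in (F ⁻¹' s) ∩ {y | φ y = n}, ι v y ∂μ := by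
  have hint : Integrable ({y | φ y = n}.indicator (ι v)) μ :=
    (Lp_top_integrable (ι v)).indicator (h.measurableSet_eq n)
  have hspec := (transferOperator_spec h.preserving hint).2 (s.indicator fun _ => 1)
    (measurable_const.indicator hs)
    ⟨1, fun y => (norm_indicator_le_norm_self _ _).trans (by simp)⟩
  have e : ∀ (t : Set Y) (g : Y → ℂ), (fun y => g y * t.indicator (fun _ => (1 : ℂ)) y)
      = t.indicator g := by
    intro t g
    funext y
    by_cases hy : y ∈ t <;> simp [hy]
  have e2 : (fun y => {y | φ y = n}.indicator (ι v) y * s.indicator (fun _ => (1 : ℂ)) (F y))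
      = ((F ⁻¹' s) ∩ {y | φ y = n}).indicator (ι v) := by
    funext y
    by_cases h1 : F y ∈ s <;> by_cases h2 : φ y = n <;> simp [Set.indicator, h1, h2]
  rw [e, integral_indicator hs, e2, integral_indicator
    ((h.preserving.measurable hs).inter (h.measurableSet_eq n))] at hspec
  rw [← hspec]
  exact integral_congr_ae (ae_restrict_of_ae (h.transfer n hn v))

theorem summable_bound : Summable fun n : ℕ => C * μ.real {y | φ y = n + 1} := by
  have := (h.hasSum_measureReal_mul (g := fun _ => 1) (K := 1) (by simp)).summable
  simp only [mul_one] at this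
  exact this.mul_left C

theorem norm_term_le {z : ℂ} (hz : ‖z‖ ≤ 1) (n : ℕ) :
    ‖z ^ (n + 1) • Rn (n + 1)‖ ≤ C * μ.real {y | φ y = n + 1} := by
  rw [norm_smul, norm_pow]
  exact (mul_le_of_le_one_left (norm_nonneg _) (pow_le_one₀ (norm_nonneg _) hz)).trans
    (h.bound _ (by omega))

variable [CompleteSpace B]

theorem hasSum_returnSeries {z : ℂ} (hz : ‖z‖ ≤ 1) :
    HasSum (fun n : ℕ => z ^ (n + 1) • Rn (n + 1)) (returnSeries Rn z) :=
  (Summable.of_norm_bounded h.summable_bound (h.norm_term_le hz)).hasSum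

theorem continuousOn_returnSeries :
    ContinuousOn (returnSeries Rn) (Metric.closedBall 0 1) :=
  continuousOn_tsum (fun n => by fun_prop) h.summable_bound fun n z hz =>
    h.norm_term_le (by simpa using hz) n

theorem differentiableOn_returnSeries :
    DifferentiableOn ℂ (returnSeries Rn) (Metric.ball 0 1) :=
  Complex.differentiableOn_tsum_of_summable_norm h.summable_bound
    (fun n => by fun_prop) Metric.isOpen_ball fun n z hz =>
    h.norm_term_le (by simpa using (Metric.ball_subset_closedBall hz)) n

theorem norm_returnSeries_sub_le {z : ℂ} (hz : ‖z‖ ≤ 1) :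
    ‖returnSeries Rn 1 - returnSeries Rn z‖ ≤ C * ∫ y, ‖1 - z ^ φ y‖ ∂μ := by
  have h1 := (h.hasSum_returnSeries (z := 1) (by simp)).sub (h.hasSum_returnSeries hz)
  have h2 := (h.hasSum_measureReal_mul (g := fun n => ‖1 - z ^ n‖) (K := 2) fun n => by
    rw [abs_norm]; exact norm_one_sub_pow_le hz n).mul_left C
  refine h1.norm_le_of_bounded h2 fun n => ?_
  rw [← sub_smul, norm_smul, one_pow, mul_comm, ← mul_assoc]
  gcongr
  exact h.bound _ (by omega)

theorem setFunctional_returnSeries_one (v : B) {s : Set Y} (hs : MeasurableSet s) :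
    setFunctional ι h.norm_le s (returnSeries Rn 1 v) = setFunctional ι h.norm_le (F ⁻¹' s) v := by
  have h1 := ((h.hasSum_returnSeries (z := 1) (by simp)).mapL
    (ContinuousLinearMap.apply ℂ B v)).mapL (setFunctional ι h.norm_le s)
  refine h1.unique ?_
  have h2 := h.hasSum_setIntegral (Lp_top_integrable (ι v)) (h.preserving.measurable hs)
  refine h2.congr_fun fun n => ?_
  simp only [one_pow, one_smul, ContinuousLinearMap.apply_apply, setFunctional_apply]
  exact h.setIntegral_renewal (n + 1) (by omega) v hs

theorem setFunctional_univ_returnSeries (v : B) {z : ℂ} (hz : ‖z‖ ≤ 1) :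
    setFunctional ι h.norm_le Set.univ (returnSeries Rn z v) = ∫ y, z ^ φ y * ι v y ∂μ := by
  have h1 := ((h.hasSum_returnSeries hz).mapL
    (ContinuousLinearMap.apply ℂ B v)).mapL (setFunctional ι h.norm_le Set.univ)
  refine h1.unique ?_
  have hint : Integrable (fun y => z ^ φ y * ι v y) μ :=
    (Lp_top_integrable (ι v)).bdd_mul (c := 1)
      (measurable_from_nat.comp h.measurable).aestronglyMeasurable
      (Eventually.of_forall fun y => by
        rw [norm_pow]; exact pow_le_one₀ (norm_nonneg _) hz)
  have h2 := h.hasSum_setIntegral hint MeasurableSet.univ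
  rw [setIntegral_univ] at h2
  refine h2.congr_fun fun n => ?_
  simp only [ContinuousLinearMap.apply_apply, map_smul, setFunctional_apply]
  rw [h.setIntegral_renewal (n + 1) (by omega) v MeasurableSet.univ, Set.preimage_univ,
    Set.univ_inter, ← integral_smul]
  refine setIntegral_congr_fun (h.measurableSet_eq _) fun y hy => ?_
  rw [show φ y = n + 1 from hy, smul_eq_mul]

theorem returnSeries_one_apply_one : returnSeries Rn 1 e = e := by
  refine h.injective (Lp.ext ?_)
  refine (Lp_top_integrable _).ae_eq_of_forall_setIntegral_eq _ _ (Lp_top_integrable _)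
    fun s hs _ => ?_
  have h1 := h.setFunctional_returnSeries_one e hs
  rw [setFunctional_apply, setFunctional_apply] at h1
  rw [h1, integral_congr_ae (ae_restrict_of_ae h.const_one),
    integral_congr_ae (ae_restrict_of_ae h.const_one)]
  simp only [integral_const, measureReal_restrict_apply_univ]
  rw [measureReal_def, measureReal_def, h.preserving.measure_preimage hs.nullMeasurableSet]

end IsReturnOperators

end ReturnOperators

section ScalarEstimates

/-- A size function comparable with `‖1 - z‖` near `z = 1` in the unit disk. -/
noncomputable def polarGap (z : ℂ) : ℝ := |Real.log ‖z‖| + |z.arg|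

theorem polarGap_nonneg (z : ℂ) : 0 ≤ polarGap z := by unfold polarGap; positivity

theorem polarGap_pos {z : ℂ} (h0 : z ≠ 0) (h1 : z ≠ 1) : 0 < polarGap z := by
  refine lt_of_le_of_ne (polarGap_nonneg z) fun h => h1 ?_
  have hl : |Real.log ‖z‖| = 0 := by
    have := abs_nonneg z.arg
    have := abs_nonneg (Real.log ‖z‖)
    unfold polarGap at h
    linarith
  have ha : |z.arg| = 0 := by
    unfold polarGap at h
    linarith
  have hn : 0 < ‖z‖ := norm_pos_iff.2 h0
  have hz : ‖z‖ = 1 := by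
    rw [abs_eq_zero, Real.log_eq_zero] at hl
    rcases hl with h | h | h <;> linarith
  rw [← Complex.norm_mul_exp_arg_mul_I z, hz, abs_eq_zero.1 ha]
  simp

theorem norm_eq_exp_neg_abs_log {z : ℂ} (h0 : z ≠ 0) (hz : ‖z‖ ≤ 1) :
    ‖z‖ = Real.exp (-|Real.log ‖z‖|) := by
  rw [abs_of_nonpos (Real.log_nonpos (norm_nonneg _) hz), neg_neg,
    Real.exp_log (norm_pos_iff.2 h0)]

theorem norm_one_sub_le_polarGap {z : ℂ} (h0 : z ≠ 0) (hz : ‖z‖ ≤ 1) : ‖1 - z‖ ≤ polarGap z := by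
  have hn : 0 < ‖z‖ := norm_pos_iff.2 h0
  have e : 1 - z = ((1 - ‖z‖ : ℝ) : ℂ)
      - (‖z‖ : ℂ) * (Complex.exp (Complex.I * (z.arg : ℝ)) - 1) := by
    conv_lhs => rw [← Complex.norm_mul_exp_arg_mul_I z]
    rw [mul_comm (z.arg : ℂ)]
    push_cast
    ring
  have h1 : |1 - ‖z‖| ≤ |Real.log ‖z‖| := by
    rw [abs_of_nonneg (by linarith), abs_of_nonpos (Real.log_nonpos hn.le hz)]
    linarith [Real.log_le_sub_one_of_pos hn]
  rw [e]
  refine (norm_sub_le _ _).trans ?_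
  rw [norm_mul, Complex.norm_real, Complex.norm_real, norm_norm, Real.norm_eq_abs]
  refine add_le_add h1 ((mul_le_of_le_one_left (norm_nonneg _) hz).trans ?_)
  exact Real.norm_exp_I_mul_ofReal_sub_one_le

theorem norm_one_sub_pow_le_mul {z : ℂ} (hz : ‖z‖ ≤ 1) (n : ℕ) : ‖1 - z ^ n‖ ≤ n * ‖1 - z‖ := by
  have e : 1 - z ^ n = (1 - z) * ∑ i ∈ Finset.range n, z ^ i := by
    rw [mul_neg_geom_sum]
  rw [e, norm_mul, mul_comm]
  refine mul_le_mul_of_nonneg_right ?_ (norm_nonneg _)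
  refine (norm_sum_le _ _).trans ((Finset.sum_le_card_nsmul _ _ 1 fun i _ => ?_).trans ?_)
  · rw [norm_pow]; exact pow_le_one₀ (norm_nonneg _) hz
  · simp

theorem div_one_add_le_one_sub_exp_neg {x : ℝ} (hx : 0 ≤ x) :
    x / (1 + x) ≤ 1 - Real.exp (-x) := by
  have h1 : Real.exp (-x) ≤ 1 / (1 + x) := by
    rw [Real.exp_neg, ← one_div]
    have := Real.add_one_le_exp x
    gcongr
    linarith
  have h2 : x / (1 + x) = 1 - 1 / (1 + x) := by field_simp; ring
  linarith

theorem norm_one_sub_pow_le_exp {z : ℂ} (h0 : z ≠ 0) (hz : ‖z‖ ≤ 1) (n : ℕ) :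
    ‖1 - z ^ n‖ ≤ 4 * (1 - Real.exp (-(polarGap z * n))) := by
  set x := polarGap z * n with hx
  have hx0 : 0 ≤ x := mul_nonneg (polarGap_nonneg z) (by positivity)
  have h1 : ‖1 - z ^ n‖ ≤ x := by
    refine (norm_one_sub_pow_le_mul hz n).trans ?_
    rw [hx, mul_comm]
    have := norm_one_sub_le_polarGap h0 hz
    gcongr
  have h2 := norm_one_sub_pow_le hz n
  have h3 := div_one_add_le_one_sub_exp_neg hx0
  rcases le_total x 1 with h | h
  · have : x / 2 ≤ x / (1 + x) := by gcongr; linarith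
    linarith
  · have : (1 : ℝ) / 2 ≤ x / (1 + x) := by
      rw [div_le_div_iff₀ two_pos (by linarith)]; linarith
    linarith

theorem re_pow_eq (z : ℂ) (n : ℕ) : (z ^ n).re = ‖z‖ ^ n * Real.cos (n * z.arg) := by
  conv_lhs => rw [← Complex.norm_mul_exp_arg_mul_I z]
  rw [mul_pow, ← Complex.exp_nat_mul, ← Complex.ofReal_pow, Complex.re_ofReal_mul]
  congr 1
  have : (n : ℂ) * ((z.arg : ℂ) * Complex.I) = ((n * z.arg : ℝ) : ℂ) * Complex.I := by
    push_cast; ring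
  rw [this, Complex.exp_ofReal_mul_I_re]

end ScalarEstimates

section ReturnOperators

variable {Y : Type*} [MeasurableSpace Y] {μ : Measure Y} [IsProbabilityMeasure μ]
  {F : Y → Y} {φ : Y → ℕ} {B : Type*} [NormedAddCommGroup B] [NormedSpace ℂ B]

theorem tendsto_one_div_nhdsGT_zero : Tendsto (fun u : ℝ => 1 / u) (𝓝[>] 0) atTop := by
  simpa only [one_div] using tendsto_inv_nhdsGT_zero

theorem exists_integral_norm_one_sub_pow_le (hφ : Measurable φ) {β : ℝ} (hβ0 : 0 < β)
    (hβ1 : β < 1) (hτ : IsRegVarTail (returnTail μ φ) β) :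
    ∃ K : ℝ, 0 < K ∧ ∀ᶠ u in 𝓝[>] (0 : ℝ), ∀ z : ℂ, z ≠ 0 → ‖z‖ ≤ 1 → polarGap z = u →
      ∫ y, ‖1 - z ^ φ y‖ ∂μ ≤ K * returnTail μ φ (1 / u) := by
  have hlim := (tendsto_laplace_div_returnTail μ hφ hβ1 hβ0 hτ one_pos).comp
    tendsto_one_div_nhdsGT_zero
  have hG : 0 < Real.Gamma (1 - β) * 1 ^ β :=
    mul_pos (Real.Gamma_pos_of_pos (by linarith)) (by positivity)
  refine ⟨4 * (Real.Gamma (1 - β) * 1 ^ β + 1), by positivity, ?_⟩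
  filter_upwards [hlim.eventually_lt_const (lt_add_one _)] with u hu z h0 hz hzu
  simp only [Function.comp_apply, one_div_one_div] at hu
  rw [div_lt_iff₀ (hτ.pos _)] at hu
  have hi : Integrable (fun y => 4 * (1 - Real.exp (-(u * φ y)))) μ := by
    refine Integrable.of_bound (C := 4) ?_ (Eventually.of_forall fun y => ?_)
    · exact ((measurable_from_nat (f := fun n : ℕ => 4 * (1 - Real.exp (-(u * n))))).comp
        hφ).aestronglyMeasurable
    · have h1 : Real.exp (-(u * φ y)) ≤ 1 := Real.exp_le_one_iff.2 (by
        have : 0 ≤ u * φ y := mul_nonneg (hzu ▸ polarGap_nonneg z) (by positivity)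
        linarith)
      have h2 := Real.exp_pos (-(u * φ y))
      rw [Real.norm_eq_abs, abs_le]
      constructor <;> linarith
  calc ∫ y, ‖1 - z ^ φ y‖ ∂μ ≤ ∫ y, 4 * (1 - Real.exp (-(u * φ y))) ∂μ := by
        refine integral_mono_of_nonneg (Eventually.of_forall fun y => norm_nonneg _) hi
          (Eventually.of_forall fun y => ?_)
        have := norm_one_sub_pow_le_exp h0 hz (φ y)
        rwa [hzu] at this
    _ = 4 * ∫ y, (1 - Real.exp (-(u * φ y))) ∂μ := integral_const_mul _ _
    _ ≤ _ := by
        rw [mul_assoc]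
        have : u * 1 = u := mul_one u
        simp only [one_div] at hu
        gcongr
        simpa only [one_div] using hu.le

theorem integrable_re_one_sub_pow (hφ : Measurable φ) {z : ℂ} (hz : ‖z‖ ≤ 1) :
    Integrable (fun y => 1 - (z ^ φ y).re) μ := by
  refine Integrable.of_bound (C := 2) ?_ (Eventually.of_forall fun y => ?_)
  · exact ((measurable_from_nat (f := fun n : ℕ => 1 - (z ^ n).re)).comp hφ).aestronglyMeasurable
  · have h1 := (Complex.abs_re_le_norm (1 - z ^ φ y)).trans (norm_one_sub_pow_le hz (φ y))
    simpa using h1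

theorem one_sub_re_pow_nonneg {z : ℂ} (hz : ‖z‖ ≤ 1) (n : ℕ) : 0 ≤ 1 - (z ^ n).re := by
  have h1 := (Complex.re_le_norm (z ^ n))
  rw [norm_pow] at h1
  have := pow_le_one₀ (norm_nonneg z) hz (n := n)
  linarith

theorem mul_measureReal_le_integral (hφ : Measurable φ) {z : ℂ} (hz : ‖z‖ ≤ 1) {s : Set Y}
    (hs : MeasurableSet s) {c : ℝ} (h : ∀ y ∈ s, c ≤ 1 - (z ^ φ y).re) :
    c * μ.real s ≤ ∫ y, (1 - (z ^ φ y).re) ∂μ := by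
  calc c * μ.real s = ∫ y in s, c ∂μ := by rw [setIntegral_const, smul_eq_mul, mul_comm]
    _ ≤ ∫ y in s, (1 - (z ^ φ y).re) ∂μ :=
        setIntegral_mono_on (integrable_const c).integrableOn
          (integrable_re_one_sub_pow hφ hz).integrableOn hs h
    _ ≤ _ := setIntegral_le_integral (integrable_re_one_sub_pow hφ hz)
        (Eventually.of_forall fun y => one_sub_re_pow_nonneg hz _)

theorem exists_le_integral_re_one_sub_pow (hφ : Measurable φ) {β : ℝ} (hβ0 : 0 < β)
    (hτ : IsRegVarTail (returnTail μ φ) β) :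
    ∃ c : ℝ, 0 < c ∧ ∀ᶠ u in 𝓝[>] (0 : ℝ), ∀ z : ℂ, z ≠ 0 → ‖z‖ ≤ 1 → polarGap z = u →
      c * returnTail μ φ (1 / u) ≤ ∫ y, (1 - (z ^ φ y).re) ∂μ := by
  have hmeas : ∀ x : ℝ, MeasurableSet {y | x < (φ y : ℝ)} := fun x =>
    measurableSet_lt measurable_const (measurable_from_nat.comp hφ)
  have h3lt : (3 : ℝ) ^ (-β) < 1 := Real.rpow_lt_one_of_one_lt_of_neg (by norm_num) (by linarith)
  obtain ⟨κ, hκ1, hκ2⟩ := exists_between h3lt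
  have hκ0 : 0 < κ := lt_trans (by positivity) hκ1
  obtain ⟨x₁, hx₁⟩ := eventually_atTop.1 ((hτ.ratio 3 (by norm_num)).eventually_lt_const hκ1)
  have hpi : (0 : ℝ) < Real.pi ^ (-β) := Real.rpow_pos_of_pos Real.pi_pos _
  have hpihalf : Real.pi ^ (-β) / 2 < Real.pi ^ (-β) := by linarith
  have hratπ := ((hτ.ratio Real.pi Real.pi_pos).comp
    tendsto_one_div_nhdsGT_zero).eventually_const_lt hpihalf
  refine ⟨min (1 / 3) ((1 - κ) * (Real.pi ^ (-β) / 2)),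
    lt_min (by norm_num) (mul_pos (by linarith) (by positivity)), ?_⟩
  filter_upwards [hratπ, self_mem_nhdsWithin,
    tendsto_one_div_nhdsGT_zero.eventually_ge_atTop x₁] with u hu hu0 hux z h0 hz hzu
  have hu0' : 0 < u := hu0
  have hτu := hτ.pos (1 / u)
  rcases le_total (u / 2) |Real.log ‖z‖| with hcase | hcase
  · have h1 : (1 / 3) * returnTail μ φ (1 / u) ≤ ∫ y, (1 - (z ^ φ y).re) ∂μ := by
      refine mul_measureReal_le_integral hφ hz (hmeas _) fun y hy => ?_
      have hy' : 1 / u < (φ y : ℝ) := hy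
      rw [div_lt_iff₀ hu0'] at hy'
      have h2 : (z ^ φ y).re ≤ Real.exp (-(1 / 2)) := by
        refine (Complex.re_le_norm _).trans ?_
        rw [norm_pow, norm_eq_exp_neg_abs_log h0 hz, ← Real.exp_nat_mul]
        refine Real.exp_le_exp.2 ?_
        have : (φ y : ℝ) * (u / 2) ≤ φ y * |Real.log ‖z‖| := by gcongr
        nlinarith
      have h3 := div_one_add_le_one_sub_exp_neg (x := 1 / 2) (by norm_num)
      norm_num at h3 h2 ⊢
      linarith
    exact (mul_le_mul_of_nonneg_right (min_le_left _ _) hτu.le).trans h1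
  · have hθ : u / 2 ≤ |z.arg| := by
      unfold polarGap at hzu
      linarith
    have hθu : |z.arg| ≤ u := by
      have := abs_nonneg (Real.log ‖z‖)
      unfold polarGap at hzu
      linarith
    have hθ0 : 0 < |z.arg| := by linarith
    set x := Real.pi / (2 * |z.arg|) with hx
    have hxx₁ : x₁ ≤ x := by
      refine hux.trans ?_
      rw [hx, div_le_div_iff₀ hu0' (by positivity)]
      have := Real.pi_gt_three
      nlinarith
    have hxπ : x ≤ Real.pi * (1 / u) := by
      rw [hx, div_le_iff₀ (by positivity)]
      have : 1 ≤ 1 / u * (2 * |z.arg|) := by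
        rw [one_div, inv_mul_eq_div, le_div_iff₀ hu0']; linarith
      have := Real.pi_pos
      nlinarith
    have h3 := hx₁ x hxx₁
    rw [div_lt_iff₀ (hτ.pos _)] at h3
    have hu' : Real.pi ^ (-β) / 2 * returnTail μ φ (1 / u)
        < returnTail μ φ (Real.pi * (1 / u)) := by
      have := hu
      simp only [Function.comp_apply] at this
      rwa [lt_div_iff₀ hτu] at this
    have hdiff : μ.real ({y | x < (φ y : ℝ)} \ {y | 3 * x < (φ y : ℝ)})
        = returnTail μ φ x - returnTail μ φ (3 * x) := by
      rw [measureReal_sdiff _ (hmeas _)]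
      · rfl
      · intro y hy
        have hy' : 3 * x < (φ y : ℝ) := hy
        have : 0 < x := by positivity
        show x < (φ y : ℝ)
        linarith
    have h1 : 1 * μ.real ({y | x < (φ y : ℝ)} \ {y | 3 * x < (φ y : ℝ)})
        ≤ ∫ y, (1 - (z ^ φ y).re) ∂μ := by
      refine mul_measureReal_le_integral hφ hz ((hmeas _).diff (hmeas _)) fun y hy => ?_
      have hy1 : x < (φ y : ℝ) := hy.1
      have hy2 : (φ y : ℝ) ≤ 3 * x := not_lt.1 hy.2
      have hxθ : x * |z.arg| = Real.pi / 2 := by rw [hx]; field_simp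
      have hcos : Real.cos (φ y * z.arg) ≤ 0 := by
        rw [← Real.cos_abs, abs_mul, Nat.abs_cast]
        refine Real.cos_nonpos_of_pi_div_two_le_of_le ?_ ?_
        · rw [← hxθ]; gcongr
        · have : (φ y : ℝ) * |z.arg| ≤ 3 * x * |z.arg| := by gcongr
          nlinarith
      have : (z ^ φ y).re ≤ 0 := by
        rw [re_pow_eq]
        exact mul_nonpos_of_nonneg_of_nonpos (by positivity) hcos
      linarith
    rw [one_mul, hdiff] at h1
    have h4 : returnTail μ φ (Real.pi * (1 / u)) ≤ returnTail μ φ x := hτ.anti hxπ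
    refine (mul_le_mul_of_nonneg_right (min_le_right _ _) hτu.le).trans (le_trans ?_ h1)
    calc (1 - κ) * (Real.pi ^ (-β) / 2) * returnTail μ φ (1 / u)
        = (1 - κ) * (Real.pi ^ (-β) / 2 * returnTail μ φ (1 / u)) := by ring
      _ ≤ (1 - κ) * returnTail μ φ x := by
          have : 0 ≤ 1 - κ := by linarith
          gcongr
          linarith
      _ ≤ _ := by linarith

end ReturnOperators

section Resolvent

variable {Y : Type*} [MeasurableSpace Y] {μ : Measure Y} [IsProbabilityMeasure μ]
  {F : Y → Y} {φ : Y → ℕ} {B : Type*} [NormedAddCommGroup B] [NormedSpace ℂ B]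

/-- `I - s R(z)`. -/
noncomputable def renewalSymbol (Rn : ℕ → B →L[ℂ] B) (s : ℝ) (z : ℂ) : B →L[ℂ] B :=
  1 - (s : ℂ) • returnSeries Rn z

/-- `∫ ‖1 - z^φ‖ dμ`. -/
noncomputable def gapIntegral (μ : Measure Y) (φ : Y → ℕ) (z : ℂ) : ℝ := ∫ y, ‖1 - z ^ φ y‖ ∂μ

theorem gapIntegral_nonneg (z : ℂ) : 0 ≤ gapIntegral μ φ z :=
  integral_nonneg fun _ => norm_nonneg _

namespace IsReturnOperators

variable {ι : B →ₗ[ℂ] Lp ℂ ∞ μ} {Rn : ℕ → B →L[ℂ] B} {e : B} {C : ℝ}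
  (h : IsReturnOperators μ F φ ι Rn e C)

/-- The functional `v ↦ ∫ v dμ`. -/
noncomputable def mean (h : IsReturnOperators μ F φ ι Rn e C) : B →L[ℂ] ℂ :=
  setFunctional ι h.norm_le Set.univ

theorem mean_apply (v : B) : h.mean v = ∫ y, ι v y ∂μ := by
  rw [mean, setFunctional_apply, setIntegral_univ]

theorem mean_one : h.mean e = 1 := by
  rw [mean_apply, integral_congr_ae h.const_one]
  simp

theorem norm_mean_apply_le (v : B) : ‖h.mean v‖ ≤ ‖v‖ := norm_setFunctional_apply_le _ _ _ _

/-- The invertible operator `I - s R(z) + ∫(·) dμ`. -/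
noncomputable def shiftedSymbol (h : IsReturnOperators μ F φ ι Rn e C) (s : ℝ) (z : ℂ) :
    B →L[ℂ] B :=
  renewalSymbol Rn s z + h.mean.smulRight e

theorem renewalSymbol_eq (s : ℝ) (z : ℂ) :
    renewalSymbol Rn s z = h.shiftedSymbol s z - h.mean.smulRight e := by
  rw [shiftedSymbol, add_sub_cancel_right]

include h

variable [CompleteSpace B]

theorem mean_returnSeries_one (v : B) : h.mean (returnSeries Rn 1 v) = h.mean v := by
  rw [mean, h.setFunctional_returnSeries_one v MeasurableSet.univ, Set.preimage_univ]

theorem isUnit_shiftedSymbol_one (hH2 : HypothesisH2 Rn) : IsUnit (h.shiftedSymbol 1 1) := by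
  have := isUnit_one_sub_add_smulRight hH2.1 h.returnSeries_one_apply_one
    h.mean_returnSeries_one h.mean_one
  simpa [shiftedSymbol, renewalSymbol] using this

theorem continuousOn_renewalSymbol :
    ContinuousOn (fun p : ℝ × ℂ => renewalSymbol Rn p.1 p.2)
      (Set.univ ×ˢ Metric.closedBall 0 1) := by
  unfold renewalSymbol
  refine continuousOn_const.sub (ContinuousOn.smul
    (Complex.continuous_ofReal.comp continuous_fst).continuousOn ?_)
  exact h.continuousOn_returnSeries.comp (by fun_prop) fun p hp => hp.2

theorem continuousOn_shiftedSymbol :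
    ContinuousOn (fun p : ℝ × ℂ => h.shiftedSymbol p.1 p.2)
      (Set.univ ×ˢ Metric.closedBall 0 1) :=
  h.continuousOn_renewalSymbol.add continuousOn_const

theorem integrable_pow {z : ℂ} (hz : ‖z‖ ≤ 1) : Integrable (fun y => z ^ φ y) μ :=
  h.integrable_comp_complex (g := fun n => z ^ n) (K := 1) fun n => by
    rw [norm_pow]; exact pow_le_one₀ (norm_nonneg _) hz

theorem mean_renewalSymbol (s : ℝ) {z : ℂ} (hz : ‖z‖ ≤ 1) (v : B) :
    h.mean (renewalSymbol Rn s z v) = ∫ y, (1 - s * z ^ φ y) * ι v y ∂μ := by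
  have hint : Integrable (fun y => z ^ φ y * ι v y) μ :=
    (Lp_top_integrable (ι v)).bdd_mul (c := 1) (h.integrable_pow hz).aestronglyMeasurable
      (Eventually.of_forall fun y => by
        rw [norm_pow]; exact pow_le_one₀ (norm_nonneg _) hz)
  have h1 := h.setFunctional_univ_returnSeries v hz
  simp only [renewalSymbol, sub_apply, one_apply_eq_self, smul_apply, map_sub, map_smul]
  rw [mean_apply, mean, h1, smul_eq_mul, ← integral_const_mul, ← integral_sub
    (Lp_top_integrable _) (hint.const_mul _)]
  refine integral_congr_ae (Eventually.of_forall fun y => ?_)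
  simp only
  ring

theorem norm_mean_renewalSymbol_le {s : ℝ} (hs0 : 0 ≤ s) (hs : s ≤ 1) {z : ℂ} (hz : ‖z‖ ≤ 1)
    (v : B) : ‖h.mean (renewalSymbol Rn s z v)‖ ≤ ((1 - s) + gapIntegral μ φ z) * ‖v‖ := by
  rw [h.mean_renewalSymbol s hz]
  have hint : Integrable (fun y => ‖1 - z ^ φ y‖) μ :=
    ((integrable_const 1).sub (h.integrable_pow hz)).norm
  have hint2 : Integrable (fun y => ((1 - s) + ‖1 - z ^ φ y‖) * ‖v‖) μ :=
    ((integrable_const _).add hint).mul_const _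
  refine (norm_integral_le_of_norm_le hint2 ?_).trans ?_
  · filter_upwards [Lp_top_ae_norm_le (ι v)] with y hy
    rw [norm_mul]
    have e1 : (1 : ℂ) - s * z ^ φ y = ((1 - s : ℝ) : ℂ) + s * (1 - z ^ φ y) := by
      push_cast; ring
    have e2 : ‖(1 : ℂ) - s * z ^ φ y‖ ≤ (1 - s) + ‖1 - z ^ φ y‖ := by
      rw [e1]
      refine (norm_add_le _ _).trans ?_
      rw [norm_mul, Complex.norm_real, Complex.norm_real, Real.norm_of_nonneg (by linarith),
        Real.norm_of_nonneg hs0]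
      gcongr
      exact mul_le_of_le_one_left (norm_nonneg _) hs
    have : 0 ≤ 1 - s := by linarith
    have := hy.trans (h.norm_le v)
    gcongr
  · rw [integral_mul_const, integral_add (integrable_const _) hint]
    simp [gapIntegral]

theorem norm_renewalSymbol_one_le {s : ℝ} (hs0 : 0 ≤ s) (hs : s ≤ 1) {z : ℂ} (hz : ‖z‖ ≤ 1) :
    ‖renewalSymbol Rn s z e‖ ≤ (1 + C) * ((1 - s) + gapIntegral μ φ z) * ‖e‖ := by
  have e1 : renewalSymbol Rn s z e
      = ((1 - s : ℝ) : ℂ) • e + (s : ℂ) • (returnSeries Rn 1 - returnSeries Rn z) e := by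
    simp only [renewalSymbol, sub_apply, one_apply_eq_self, smul_apply,
      h.returnSeries_one_apply_one]
    push_cast
    module
  have h1 : ‖(returnSeries Rn 1 - returnSeries Rn z) e‖ ≤ C * gapIntegral μ φ z * ‖e‖ :=
    (ContinuousLinearMap.le_opNorm _ _).trans (by
      have := h.norm_returnSeries_sub_le hz
      gcongr
      exact this)
  rw [e1]
  refine (norm_add_le _ _).trans ?_
  rw [norm_smul, norm_smul, Complex.norm_real, Complex.norm_real,
    Real.norm_of_nonneg (by linarith), Real.norm_of_nonneg hs0]
  have hg := gapIntegral_nonneg (μ := μ) (φ := φ) z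
  have hC := h.nonneg
  have h2 : s * ‖(returnSeries Rn 1 - returnSeries Rn z) e‖ ≤ C * gapIntegral μ φ z * ‖e‖ :=
    (mul_le_of_le_one_left (norm_nonneg _) hs).trans h1
  have h3 : 0 ≤ C * (1 - s) * ‖e‖ := by
    have : 0 ≤ 1 - s := by linarith
    positivity
  have h4 : 0 ≤ gapIntegral μ φ z * ‖e‖ := by positivity
  nlinarith

/-- The Sherman–Morrison denominator is `∫ (1 - s z^φ) dμ` up to a quadratic error. -/
theorem norm_denominator_sub_le {s : ℝ} (hs0 : 0 ≤ s) (hs : s ≤ 1) {z : ℂ} (hz : ‖z‖ ≤ 1)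
    (hu : IsUnit (h.shiftedSymbol s z)) :
    ‖(1 - h.mean (Ring.inverse (h.shiftedSymbol s z) e)) - ∫ y, (1 - s * z ^ φ y) ∂μ‖
      ≤ ‖Ring.inverse (h.shiftedSymbol s z)‖ * (1 + C) * ‖e‖
        * ((1 - s) + gapIntegral μ φ z) ^ 2 := by
  set N := h.shiftedSymbol s z with hN
  set N' := Ring.inverse N
  have h1 : ∀ v, N (N' v) = v := fun v => DFunLike.congr_fun (Ring.mul_inverse_cancel N hu) v
  have h2 : ∀ v, N' (N v) = v := fun v => DFunLike.congr_fun (Ring.inverse_mul_cancel N hu) v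
  have hNv : ∀ v, N v = renewalSymbol Rn s z v + h.mean v • e := by
    intro v
    rw [hN, shiftedSymbol, add_apply, ContinuousLinearMap.smulRight_apply]
  have hD : 1 - h.mean (N' e) = h.mean (renewalSymbol Rn s z (N' e)) := by
    have := congrArg h.mean (h1 e)
    rw [hNv, map_add, map_smul, h.mean_one, smul_eq_mul, mul_one] at this
    rw [← this]; ring
  have he' : N' e - e = -N' (renewalSymbol Rn s z e) := by
    have := h2 e
    rw [hNv, h.mean_one, one_smul, map_add] at this
    rw [eq_neg_iff_add_eq_zero, sub_add_eq_add_sub, add_comm, this, sub_self]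
  have hme : h.mean (renewalSymbol Rn s z e) = ∫ y, (1 - s * z ^ φ y) ∂μ := by
    rw [h.mean_renewalSymbol s hz]
    refine integral_congr_ae ?_
    filter_upwards [h.const_one] with y hy
    rw [hy, mul_one]
  rw [hD, ← hme, ← map_sub, ← map_sub, he']
  refine (h.norm_mean_renewalSymbol_le hs0 hs hz _).trans ?_
  have hg := gapIntegral_nonneg (μ := μ) (φ := φ) z
  have hg' : 0 ≤ (1 - s) + gapIntegral μ φ z := by linarith
  calc ((1 - s) + gapIntegral μ φ z) * ‖-N' (renewalSymbol Rn s z e)‖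
      ≤ ((1 - s) + gapIntegral μ φ z)
        * (‖N'‖ * ((1 + C) * ((1 - s) + gapIntegral μ φ z) * ‖e‖)) := by
        gcongr
        rw [norm_neg]
        refine (N'.le_opNorm _).trans ?_
        gcongr
        exact h.norm_renewalSymbol_one_le hs0 hs hz
    _ = _ := by ring

theorem eventually_shiftedSymbol_unit (hH2 : HypothesisH2 Rn) :
    ∃ K : ℝ, 0 < K ∧ ∀ᶠ p : ℝ × ℂ in 𝓝[Set.univ ×ˢ Metric.closedBall 0 1] ((1 : ℝ), (1 : ℂ)),
      IsUnit (h.shiftedSymbol p.1 p.2) ∧ ‖Ring.inverse (h.shiftedSymbol p.1 p.2)‖ ≤ K := by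
  have hu := h.isUnit_shiftedSymbol_one hH2
  have hc : ContinuousWithinAt (fun p : ℝ × ℂ => h.shiftedSymbol p.1 p.2)
      (Set.univ ×ˢ Metric.closedBall 0 1) ((1 : ℝ), (1 : ℂ)) :=
    h.continuousOn_shiftedSymbol _ ⟨Set.mem_univ _, by simp⟩
  have hi : ContinuousAt Ring.inverse (h.shiftedSymbol 1 1) := by
    have := NormedRing.inverse_continuousAt hu.unit
    simpa using this
  have hlim := (hi.tendsto.comp hc.tendsto).norm
  refine ⟨‖Ring.inverse (h.shiftedSymbol 1 1)‖ + 1, by positivity, ?_⟩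
  filter_upwards [hlim.eventually_lt_const (lt_add_one _),
    hc.tendsto.eventually (Units.isOpen.mem_nhds hu)] with p h1 h2
  exact ⟨h2, h1.le⟩

theorem isUnit_renewalSymbol_one (hH2 : HypothesisH2 Rn) {z : ℂ} (hz : ‖z‖ ≤ 1) (hz1 : z ≠ 1) :
    IsUnit (renewalSymbol Rn 1 z) := by
  have := hH2.2 z hz hz1
  rw [spectrum.mem_iff, not_not, map_one] at this
  simpa [renewalSymbol] using this

/-- Away from `z = 1` the resolvent is bounded, uniformly for `s` near `1`. -/
theorem exists_bound_resolvent_far (hH2 : HypothesisH2 Rn) {ε : ℝ} (hε : 0 < ε) :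
    ∃ K : ℝ, 0 < K ∧ ∀ᶠ s in 𝓝 (1 : ℝ), ∀ z : ℂ, ‖z‖ ≤ 1 → ε ≤ ‖z - 1‖ →
      IsUnit (renewalSymbol Rn s z) ∧ ‖Ring.inverse (renewalSymbol Rn s z)‖ ≤ K := by
  set S : Set ℂ := Metric.closedBall 0 1 ∩ {z | ε ≤ ‖z - 1‖} with hS
  have hSc : IsCompact S := (isCompact_closedBall 0 1).inter_right
    (isClosed_le continuous_const (by fun_prop))
  have hmem : ∀ z ∈ S, ‖z‖ ≤ 1 ∧ z ≠ 1 := by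
    rintro z ⟨h1, h2⟩
    refine ⟨by simpa using h1, ?_⟩
    rintro rfl
    have : ε ≤ ‖(1 : ℂ) - 1‖ := h2
    rw [sub_self, norm_zero] at this
    linarith
  have hcont : ∀ z ∈ S, ContinuousWithinAt
      (fun p : ℝ × ℂ => ‖Ring.inverse (renewalSymbol Rn p.1 p.2)‖)
      (Set.univ ×ˢ Metric.closedBall 0 1) ((1 : ℝ), z) := by
    intro z hz
    have hu := h.isUnit_renewalSymbol_one hH2 (hmem z hz).1 (hmem z hz).2
    have hi : ContinuousAt Ring.inverse (renewalSymbol Rn 1 z) := by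
      have := NormedRing.inverse_continuousAt hu.unit
      simpa using this
    have hc := h.continuousOn_renewalSymbol ((1 : ℝ), z) ⟨Set.mem_univ _, hz.1⟩
    exact (hi.tendsto.comp hc.tendsto).norm
  have hcontS : ContinuousOn (fun z => Ring.inverse (renewalSymbol Rn 1 z)) S := by
    intro z hz
    have hu := h.isUnit_renewalSymbol_one hH2 (hmem z hz).1 (hmem z hz).2
    have hi : ContinuousAt Ring.inverse (renewalSymbol Rn 1 z) := by
      have := NormedRing.inverse_continuousAt hu.unit
      simpa using this
    have hc : ContinuousWithinAt (renewalSymbol Rn 1) S z := by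
      have := (h.continuousOn_renewalSymbol.comp (f := fun z : ℂ => ((1 : ℝ), z))
        (s := Metric.closedBall 0 1) (by fun_prop) fun z hz => ⟨Set.mem_univ _, hz⟩) z hz.1
      exact this.mono Set.inter_subset_left
    exact hi.comp_continuousWithinAt hc
  obtain ⟨K, hK⟩ := hSc.exists_bound_of_continuousOn hcontS
  refine ⟨max K 0 + 1, by positivity, ?_⟩
  have hev := hSc.eventually_forall_of_forall_eventually (x₀ := (1 : ℝ))
    (P := fun s z => z ∈ Metric.closedBall (0 : ℂ) 1 → IsUnit (renewalSymbol Rn s z) ∧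
      ‖Ring.inverse (renewalSymbol Rn s z)‖ ≤ max K 0 + 1) (by
      intro z hz
      have hu := h.isUnit_renewalSymbol_one hH2 (hmem z hz).1 (hmem z hz).2
      have hc := h.continuousOn_renewalSymbol ((1 : ℝ), z) ⟨Set.mem_univ _, hz.1⟩
      have hlt : ‖Ring.inverse (renewalSymbol Rn 1 z)‖ < max K 0 + 1 :=
        lt_of_le_of_lt ((hK z hz).trans (le_max_left _ _)) (lt_add_one _)
      have e1 := (hcont z hz).tendsto.eventually_lt_const hlt
      have e2 := hc.tendsto.eventually (Units.isOpen.mem_nhds hu)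
      rw [eventually_nhdsWithin_iff] at e1 e2
      filter_upwards [e1, e2] with p h1 h2 hp
      exact ⟨h2 ⟨Set.mem_univ _, hp⟩, (h1 ⟨Set.mem_univ _, hp⟩).le⟩)
  filter_upwards [hev] with s hs z hz hzε
  have hzb : z ∈ Metric.closedBall (0 : ℂ) 1 := by simpa using hz
  exact hs z ⟨hzb, hzε⟩ hzb

end IsReturnOperators

end Resolvent

section ResolventBounds

theorem IsRegVarTail.exists_le_rpow {τ : ℝ → ℝ} {β : ℝ} (h : IsRegVarTail τ β) (hβ : 0 < β) :
    ∃ C : ℝ, 0 < C ∧ ∀ x : ℝ, 1 ≤ x → τ x ≤ C * x ^ (-(β / 2)) := by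
  obtain ⟨C, hC, hp⟩ := h.potter_lower (a := β / 2) (by positivity) (by linarith) one_pos
  refine ⟨C * τ 1, mul_pos hC (h.pos 1), fun x hx => ?_⟩
  have := hp x 1 le_rfl hx
  have hx0 : 0 < x := by linarith
  rw [div_one] at this
  rw [Real.rpow_neg hx0.le, ← div_eq_mul_inv, le_div_iff₀ (by positivity)]
  linarith

theorem IsRegVarTail.tendsto_zero {τ : ℝ → ℝ} {β : ℝ} (h : IsRegVarTail τ β) (hβ : 0 < β) :
    Tendsto τ atTop (𝓝 0) := by
  obtain ⟨C, hC, hp⟩ := h.exists_le_rpow hβ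
  have h1 : Tendsto (fun x : ℝ => C * x ^ (-(β / 2))) atTop (𝓝 0) := by
    simpa using (tendsto_rpow_neg_atTop (show 0 < β / 2 by positivity)).const_mul C
  refine squeeze_zero' (Eventually.of_forall fun x => (h.pos x).le) ?_ h1
  filter_upwards [eventually_ge_atTop 1] with x hx using hp x hx

theorem mul_add_sq_le {K K₁ a t d : ℝ} (hK : 0 ≤ K) (ha : 0 ≤ a) (ht : 0 ≤ t)
    (h1 : 2 * K * a ≤ 1) (h2 : 2 * K * K₁ ^ 2 * t ≤ d) :
    K * (a + K₁ * t) ^ 2 ≤ a + d * t := by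
  have a1 : (a + K₁ * t) ^ 2 ≤ 2 * a ^ 2 + 2 * (K₁ * t) ^ 2 := by
    nlinarith [sq_nonneg (a - K₁ * t)]
  have a2 := mul_le_mul_of_nonneg_left a1 hK
  have a3 := mul_le_mul_of_nonneg_right h1 ha
  have a4 := mul_le_mul_of_nonneg_right h2 ht
  linarith

theorem continuousAt_polarGap_one : ContinuousAt polarGap 1 := by
  unfold polarGap
  refine ContinuousAt.add ?_ ?_
  · exact ((Real.continuousAt_log (by simp)).comp continuous_norm.continuousAt).abs
  · exact (Complex.continuousAt_arg (by simp)).abs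

theorem polarGap_one : polarGap 1 = 0 := by simp [polarGap]

variable {Y : Type*} [MeasurableSpace Y] {μ : Measure Y} [IsProbabilityMeasure μ]
  {F : Y → Y} {φ : Y → ℕ} {B : Type*} [NormedAddCommGroup B] [NormedSpace ℂ B]
  [CompleteSpace B] {ι : B →ₗ[ℂ] Lp ℂ ∞ μ} {Rn : ℕ → B →L[ℂ] B} {e : B} {C : ℝ}

namespace IsReturnOperators

variable (h : IsReturnOperators μ F φ ι Rn e C)

include h

theorem re_integral_one_sub (s : ℝ) {z : ℂ} (hz : ‖z‖ ≤ 1) :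
    (∫ y, (1 - s * z ^ φ y) ∂μ).re = (1 - s) + s * ∫ y, (1 - (z ^ φ y).re) ∂μ := by
  have hi : Integrable (fun y => 1 - (s : ℂ) * z ^ φ y) μ :=
    (integrable_const 1).sub ((h.integrable_pow hz).const_mul _)
  have h1 := integral_re (𝕜 := ℂ) hi
  simp only [RCLike.re_eq_complex_re] at h1
  rw [← h1, ← integral_const_mul]
  have h2 : (1 - s : ℝ) = ∫ _ : Y, (1 - s) ∂μ := by simp
  rw [h2, ← integral_add (integrable_const _)
    ((integrable_re_one_sub_pow h.measurable hz).const_mul s)]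
  refine integral_congr_ae (Eventually.of_forall fun y => ?_)
  simp only [Complex.sub_re, Complex.one_re, Complex.re_ofReal_mul]
  ring

theorem exists_bound_resolvent_near (hH2 : HypothesisH2 Rn) {β : ℝ} (hβ0 : 0 < β) (hβ1 : β < 1)
    (hτ : IsRegVarTail (returnTail μ φ) β) :
    ∃ K δ : ℝ, 0 < K ∧ 0 < δ ∧ ∀ᶠ s in 𝓝[≤] (1 : ℝ), ∀ z : ℂ, ‖z‖ ≤ 1 → z ≠ 1 → ‖z - 1‖ < δ →
      IsUnit (renewalSymbol Rn s z) ∧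
        ‖Ring.inverse (renewalSymbol Rn s z)‖ ≤ K / returnTail μ φ (1 / polarGap z) := by
  obtain ⟨K₀, hK₀, hev⟩ := h.eventually_shiftedSymbol_unit hH2
  obtain ⟨K₁, hK₁, hgap⟩ := exists_integral_norm_one_sub_pow_le h.measurable hβ0 hβ1 hτ
  obtain ⟨c, hc, hlow⟩ := exists_le_integral_re_one_sub_pow h.measurable hβ0 hτ
  set K₂ := K₀ * (1 + C) * ‖e‖ with hK₂
  have hC := h.nonneg
  have hK₂0 : 0 ≤ K₂ := by positivity
  have hsmall : ∀ᶠ u in 𝓝[>] (0 : ℝ), 2 * K₂ * K₁ ^ 2 * returnTail μ φ (1 / u) ≤ c / 4 := by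
    have := ((hτ.tendsto_zero hβ0).comp tendsto_one_div_nhdsGT_zero).const_mul (2 * K₂ * K₁ ^ 2)
    rw [mul_zero] at this
    exact this.eventually_le_const (by positivity)
  obtain ⟨u₁, hu₁, hIoo⟩ := mem_nhdsGT_iff_exists_Ioo_subset.1 ((hgap.and hlow).and hsmall)
  rw [nhdsWithin_prod_eq, nhdsWithin_univ, eventually_prod_iff] at hev
  obtain ⟨pa, hpa, pb, hpb, hab⟩ := hev
  have hz1 : ∀ᶠ z in 𝓝 (1 : ℂ), polarGap z < u₁ :=
    continuousAt_polarGap_one.eventually_lt_const (by rw [polarGap_one]; exact hu₁)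
  have hz2 : ∀ᶠ z in 𝓝 (1 : ℂ), z ≠ 0 := isOpen_ne.mem_nhds one_ne_zero
  rw [eventually_nhdsWithin_iff] at hpb
  obtain ⟨δ, hδ, hball⟩ := Metric.eventually_nhds_iff.1 ((hz1.and hz2).and hpb)
  have hs1 : ∀ᶠ s in 𝓝 (1 : ℝ), 2 * K₂ * (1 - s) < 1 := by
    have : ContinuousAt (fun s : ℝ => 2 * K₂ * (1 - s)) 1 := by fun_prop
    exact this.eventually_lt_const (by simp)
  have hs2 : ∀ᶠ s in 𝓝 (1 : ℝ), 1 / 2 < s := lt_mem_nhds (by norm_num)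
  refine ⟨K₀ * (1 + 4 * K₀ * ‖e‖ / c), δ, by positivity, hδ, ?_⟩
  filter_upwards [nhdsWithin_le_nhds hpa, nhdsWithin_le_nhds hs1, nhdsWithin_le_nhds hs2,
    self_mem_nhdsWithin] with s hps hs1 hs2 hs z hz hz1 hzδ
  have hs' : s ≤ 1 := hs
  obtain ⟨⟨hzu, hz0⟩, hzb⟩ := hball (by rwa [dist_eq_norm])
  obtain ⟨hunit, hnorm⟩ := hab hps (hzb (by simpa using hz))
  simp only at hunit hnorm
  have hupos := polarGap_pos hz0 hz1
  obtain ⟨⟨hg, hl⟩, hsm⟩ := hIoo ⟨hupos, hzu⟩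
  replace hg := hg z hz0 hz rfl
  replace hl := hl z hz0 hz rfl
  set t := returnTail μ φ (1 / polarGap z) with ht
  have ht0 : 0 < t := hτ.pos _
  have ht1 : t ≤ 1 := returnTail_le_one μ _
  set N' := Ring.inverse (h.shiftedSymbol s z)
  set D := 1 - h.mean (N' e) with hD
  have hDlow : c / 4 * t ≤ ‖D‖ := by
    have h1 := h.norm_denominator_sub_le (by linarith) hs' hz hunit
    have hg' : gapIntegral μ φ z ≤ K₁ * t := hg
    have hg0 := gapIntegral_nonneg (μ := μ) (φ := φ) z
    have h2 : ‖D - ∫ y, (1 - s * z ^ φ y) ∂μ‖ ≤ K₂ * ((1 - s) + K₁ * t) ^ 2 := by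
      refine h1.trans ?_
      rw [hK₂]
      have : 0 ≤ 1 - s := by linarith
      gcongr
    have h3 := h.re_integral_one_sub s hz
    have h4 : (∫ y, (1 - s * z ^ φ y) ∂μ).re - D.re ≤ K₂ * ((1 - s) + K₁ * t) ^ 2 := by
      rw [← Complex.sub_re]
      refine (Complex.re_le_norm _).trans ?_
      rwa [norm_sub_rev]
    have h5 := mul_add_sq_le hK₂0 (show 0 ≤ 1 - s by linarith) ht0.le hs1.le hsm
    have h6 : s * (c * t) ≤ s * ∫ y, (1 - (z ^ φ y).re) ∂μ := by gcongr
    have h7 : 1 / 2 * (c * t) ≤ s * (c * t) := by gcongr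
    have h8 : c / 4 * t ≤ D.re := by linarith
    exact h8.trans (Complex.re_le_norm D)
  have hD0 : D ≠ 0 := by
    intro h0
    rw [h0, norm_zero] at hDlow
    have : 0 < c / 4 * t := by positivity
    linarith
  obtain ⟨hu, hinv⟩ := inverse_sub_smulRight hunit h.mean e hD0
  rw [← h.renewalSymbol_eq] at hu hinv
  refine ⟨hu, ?_⟩
  refine ContinuousLinearMap.opNorm_le_bound _ (by positivity) fun v => ?_
  rw [hinv v]
  have b1 : ‖N' v‖ ≤ K₀ * ‖v‖ := (N'.le_opNorm v).trans (by gcongr)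
  have b2 : ‖N' e‖ ≤ K₀ * ‖e‖ := (N'.le_opNorm e).trans (by gcongr)
  have b3 : ‖h.mean (N' v) / D‖ ≤ K₀ * ‖v‖ / (c / 4 * t) := by
    rw [norm_div]
    have := (h.norm_mean_apply_le (N' v)).trans b1
    gcongr
  calc ‖N' v + (h.mean (N' v) / D) • N' e‖
      ≤ K₀ * ‖v‖ + K₀ * ‖v‖ / (c / 4 * t) * (K₀ * ‖e‖) := by
        refine (norm_add_le _ _).trans ?_
        rw [norm_smul]
        gcongr
    _ ≤ K₀ * ‖v‖ / t + K₀ * ‖v‖ / (c / 4 * t) * (K₀ * ‖e‖) := by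
        gcongr
        rw [le_div_iff₀ ht0]
        exact mul_le_of_le_one_right (by positivity) ht1
    _ = K₀ * (1 + 4 * K₀ * ‖e‖ / c) / t * ‖v‖ := by field_simp

/-- The resolvent bound on the closed unit disk. -/
theorem exists_bound_resolvent (hH2 : HypothesisH2 Rn) {β : ℝ} (hβ0 : 0 < β) (hβ1 : β < 1)
    (hτ : IsRegVarTail (returnTail μ φ) β) :
    ∃ K : ℝ, 0 < K ∧ ∀ᶠ s in 𝓝[≤] (1 : ℝ), ∀ z : ℂ, ‖z‖ ≤ 1 → z ≠ 1 →
      IsUnit (renewalSymbol Rn s z) ∧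
        ‖Ring.inverse (renewalSymbol Rn s z)‖ ≤ K / returnTail μ φ (1 / polarGap z) := by
  obtain ⟨K₁, δ, hK₁, hδ, hnear⟩ := h.exists_bound_resolvent_near hH2 hβ0 hβ1 hτ
  obtain ⟨K₂, hK₂, hfar⟩ := h.exists_bound_resolvent_far hH2 hδ
  refine ⟨max K₁ K₂, by positivity, ?_⟩
  filter_upwards [hnear, nhdsWithin_le_nhds hfar] with s h1 h2 z hz hz1
  have ht0 := hτ.pos (1 / polarGap z)
  rcases lt_or_ge ‖z - 1‖ δ with hc | hc
  · refine (h1 z hz hz1 hc).imp_right fun hb => hb.trans ?_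
    gcongr
    exact le_max_left _ _
  · refine (h2 z hz hc).imp_right fun hb => hb.trans ((le_max_right K₁ K₂).trans ?_)
    rw [le_div_iff₀ ht0]
    exact mul_le_of_le_one_right (by positivity) (returnTail_le_one μ _)

theorem tendsto_inverse_shiftedSymbol (hH2 : HypothesisH2 Rn) {z : ℝ → ℂ}
    (hp : Tendsto (fun X => ((1 : ℝ), z X)) atTop
      (𝓝[Set.univ ×ˢ Metric.closedBall 0 1] ((1 : ℝ), (1 : ℂ)))) :
    Tendsto (fun X => Ring.inverse (h.shiftedSymbol 1 (z X))) atTop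
      (𝓝 (Ring.inverse (h.shiftedSymbol 1 1))) := by
  have hu1 := h.isUnit_shiftedSymbol_one hH2
  have hi : ContinuousAt Ring.inverse (h.shiftedSymbol 1 1) := by
    have := NormedRing.inverse_continuousAt hu1.unit
    rwa [hu1.unit_spec] at this
  have hcw : ContinuousWithinAt (fun p : ℝ × ℂ => h.shiftedSymbol p.1 p.2)
      (Set.univ ×ˢ Metric.closedBall 0 1) ((1 : ℝ), (1 : ℂ)) :=
    h.continuousOn_shiftedSymbol _ ⟨Set.mem_univ _, by simp⟩
  have h1 := hi.tendsto.comp hcw.tendsto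
  have h2 := h1.comp hp
  exact h2

set_option maxHeartbeats 1000000 in
/-- The asymptotics of the resolvent as `z = e^{-q/X}` increases to `1`. -/
theorem tendsto_resolvent_real (hH2 : HypothesisH2 Rn) {β : ℝ} (hβ0 : 0 < β) (hβ1 : β < 1)
    (hτ : IsRegVarTail (returnTail μ φ) β) {q : ℝ} (hq : 0 < q) (v : B) :
    Tendsto (fun X : ℝ => (returnTail μ φ X : ℂ)
      • Ring.inverse (renewalSymbol Rn 1 (Real.exp (-(q / X)) : ℝ)) v) atTop
      (𝓝 ((((Real.Gamma (1 - β) * q ^ β : ℝ) : ℂ)⁻¹ * h.mean v) • e)) := by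
  set z : ℝ → ℂ := fun X => ((Real.exp (-(q / X)) : ℝ) : ℂ) with hz
  set τ := returnTail μ φ with hτdef
  set L := Real.Gamma (1 - β) * q ^ β with hL
  have hL0 : 0 < L := mul_pos (Real.Gamma_pos_of_pos (by linarith)) (by positivity)
  have hqX : Tendsto (fun X : ℝ => q / X) atTop (𝓝 0) := tendsto_const_nhds.div_atTop tendsto_id
  have hzlim : Tendsto z atTop (𝓝 1) := by
    have : Tendsto (fun X : ℝ => ((Real.exp (-(q / X)) : ℝ) : ℂ)) atTop
        (𝓝 ((Real.exp (-0) : ℝ) : ℂ)) :=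
      (Complex.continuous_ofReal.tendsto _).comp ((Real.continuous_exp.tendsto _).comp hqX.neg)
    rw [neg_zero, Real.exp_zero, Complex.ofReal_one] at this
    exact this
  have hznorm : ∀ᶠ X in atTop, ‖z X‖ ≤ 1 := by
    filter_upwards [eventually_gt_atTop 0] with X hX
    rw [hz, Complex.norm_real, Real.norm_of_nonneg (Real.exp_pos _).le, Real.exp_le_one_iff]
    have : 0 < q / X := by positivity
    linarith
  have hp : Tendsto (fun X => ((1 : ℝ), z X)) atTop
      (𝓝[Set.univ ×ˢ Metric.closedBall 0 1] ((1 : ℝ), (1 : ℂ))) := by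
    refine tendsto_nhdsWithin_iff.2 ⟨tendsto_const_nhds.prodMk_nhds hzlim, ?_⟩
    filter_upwards [hznorm] with X hX
    exact ⟨Set.mem_univ _, by simpa using hX⟩
  obtain ⟨K₀, hK₀, hev⟩ := h.eventually_shiftedSymbol_unit hH2
  have hunit := hp.eventually hev
  have hu1 := h.isUnit_shiftedSymbol_one hH2
  set N' : ℝ → B →L[ℂ] B := fun X => Ring.inverse (h.shiftedSymbol 1 (z X)) with hN'
  have hN'lim : Tendsto N' atTop (𝓝 (Ring.inverse (h.shiftedSymbol 1 1))) :=
    h.tendsto_inverse_shiftedSymbol hH2 hp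
  have hN'v : ∀ w, Tendsto (fun X => N' X w) atTop (𝓝 (Ring.inverse (h.shiftedSymbol 1 1) w)) :=
    fun w => ((ContinuousLinearMap.apply ℂ B w).continuous.tendsto _).comp hN'lim
  have hN1 : ∀ w, h.shiftedSymbol 1 1 w = w - returnSeries Rn 1 w + h.mean w • e := by
    intro w
    simp [shiftedSymbol, renewalSymbol]
  have hinv1 : ∀ w, h.shiftedSymbol 1 1 (Ring.inverse (h.shiftedSymbol 1 1) w) = w := fun w =>
    DFunLike.congr_fun (Ring.mul_inverse_cancel _ hu1) w
  have hinv2 : ∀ w, Ring.inverse (h.shiftedSymbol 1 1) (h.shiftedSymbol 1 1 w) = w := fun w =>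
    DFunLike.congr_fun (Ring.inverse_mul_cancel _ hu1) w
  have hone : Ring.inverse (h.shiftedSymbol 1 1) e = e := by
    have h1 : h.shiftedSymbol 1 1 e = e := by
      rw [hN1, h.returnSeries_one_apply_one, h.mean_one]; simp
    have h2 := hinv2 e
    rwa [h1] at h2
  have hmean : h.mean (Ring.inverse (h.shiftedSymbol 1 1) v) = h.mean v := by
    have h1 := congrArg h.mean (hinv1 v)
    rw [hN1, map_add, map_sub, h.mean_returnSeries_one, sub_self, zero_add, map_smul,
      h.mean_one, smul_eq_mul, mul_one] at h1
    exact h1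
  have hgap : ∀ᶠ X in atTop, gapIntegral μ φ (z X) = ∫ y, (1 - Real.exp (-(q / X * φ y))) ∂μ ∧
      ∫ y, (1 - ((1 : ℝ) : ℂ) * z X ^ φ y) ∂μ = (gapIntegral μ φ (z X) : ℂ) := by
    filter_upwards [eventually_gt_atTop 0] with X hX
    have e1 : ∀ n : ℕ, 1 - z X ^ n = ((1 - Real.exp (-(q / X * n)) : ℝ) : ℂ) := by
      intro n
      rw [hz, ← Complex.ofReal_pow, ← Real.exp_nat_mul]
      push_cast
      ring_nf
    have e2 : ∀ n : ℕ, 0 ≤ 1 - Real.exp (-(q / X * n)) := by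
      intro n
      have : 0 ≤ q / X * n := by positivity
      have := Real.exp_le_one_iff.2 (show -(q / X * n) ≤ 0 by linarith)
      linarith
    have e3 : gapIntegral μ φ (z X) = ∫ y, (1 - Real.exp (-(q / X * φ y))) ∂μ := by
      unfold gapIntegral
      refine integral_congr_ae (Eventually.of_forall fun y => ?_)
      simp only
      rw [e1, Complex.norm_real, Real.norm_of_nonneg (e2 _)]
    refine ⟨e3, ?_⟩
    rw [e3, ← integral_complex_ofReal]
    refine integral_congr_ae (Eventually.of_forall fun y => ?_)
    simp only
    rw [Complex.ofReal_one, one_mul, e1]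
  have hw : Tendsto (fun X => gapIntegral μ φ (z X) / τ X) atTop (𝓝 L) := by
    refine (tendsto_laplace_div_returnTail μ h.measurable hβ1 hβ0 hτ hq).congr' ?_
    filter_upwards [hgap] with X hX
    rw [hX.1]
  set D : ℝ → ℂ := fun X => 1 - h.mean (N' X e) with hDdef
  have hDlim : Tendsto (fun X => D X / (τ X : ℂ)) atTop (𝓝 (L : ℂ)) := by
    have herr : Tendsto (fun X => D X / (τ X : ℂ)
        - ((gapIntegral μ φ (z X) / τ X : ℝ) : ℂ)) atTop (𝓝 0) := by
      have hb : Tendsto (fun X => K₀ * (1 + C) * ‖e‖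
          * ((gapIntegral μ φ (z X) / τ X) ^ 2 * τ X)) atTop (𝓝 0) := by
        have := ((hw.pow 2).mul (hτ.tendsto_zero hβ0)).const_mul (K₀ * (1 + C) * ‖e‖)
        simpa using this
      refine squeeze_zero_norm' ?_ hb
      filter_upwards [hgap, hznorm, hunit] with X hX hX1 hXu
      have h1 := h.norm_denominator_sub_le (s := 1) zero_le_one le_rfl hX1 hXu.1
      rw [hX.2, sub_self, zero_add] at h1
      have hτX : 0 < τ X := hτ.pos X
      have hC := h.nonneg
      have e1 : D X / (τ X : ℂ) - ((gapIntegral μ φ (z X) / τ X : ℝ) : ℂ)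
          = (D X - (gapIntegral μ φ (z X) : ℂ)) / (τ X : ℂ) := by
        push_cast; ring
      rw [e1, norm_div, Complex.norm_real, Real.norm_of_nonneg hτX.le, div_le_iff₀ hτX]
      refine h1.trans ?_
      calc ‖Ring.inverse (h.shiftedSymbol 1 (z X))‖ * (1 + C) * ‖e‖ * gapIntegral μ φ (z X) ^ 2
          ≤ K₀ * (1 + C) * ‖e‖ * gapIntegral μ φ (z X) ^ 2 := by
            have := hXu.2
            gcongr
        _ = _ := by field_simp
    have h2 := herr.add ((Complex.continuous_ofReal.tendsto L).comp hw)
    simpa using h2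
  have hLc : (L : ℂ) ≠ 0 := by exact_mod_cast hL0.ne'
  have hD0 : ∀ᶠ X in atTop, D X ≠ 0 := by
    filter_upwards [hDlim.eventually_ne hLc] with X hX h0
    rw [h0, zero_div] at hX
    exact hX rfl
  have hτc : Tendsto (fun X => (τ X : ℂ)) atTop (𝓝 0) := by
    simpa [Function.comp_def] using
      (Complex.continuous_ofReal.tendsto 0).comp (hτ.tendsto_zero hβ0)
  have hmv : Tendsto (fun X => h.mean (N' X v)) atTop (𝓝 (h.mean v)) := by
    have := (h.mean.continuous.tendsto _).comp (hN'v v)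
    rwa [hmean] at this
  have hNe := hN'v e
  rw [hone] at hNe
  have hfin := (hτc.smul (hN'v v)).add (((hDlim.inv₀ hLc).mul hmv).smul hNe)
  rw [zero_smul, zero_add] at hfin
  refine hfin.congr' ?_
  filter_upwards [hunit, hD0] with X hX hDX
  have hinv := (inverse_sub_smulRight hX.1 h.mean e hDX).2 v
  rw [← h.renewalSymbol_eq] at hinv
  rw [hinv, smul_add, smul_smul, inv_div]
  congr 2
  ring

end IsReturnOperators

end ResolventBounds

section Evaluation

variable {A : Type*} [NormedRing A] [NormedAlgebra ℂ A]

/-- The power series `a` converges absolutely to `f` in the open unit disk. -/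
def PowerSeriesEval (f : ℂ → A) (a : PowerSeries A) : Prop :=
  ∀ z : ℂ, ‖z‖ < 1 → (Summable fun n : ℕ => ‖z ^ n • PowerSeries.coeff n a‖) ∧
    HasSum (fun n : ℕ => z ^ n • PowerSeries.coeff n a) (f z)

namespace PowerSeriesEval

variable {f g : ℂ → A} {a b : PowerSeries A}

theorem congr (h : PowerSeriesEval f a) (hfg : ∀ z : ℂ, ‖z‖ < 1 → f z = g z) :
    PowerSeriesEval g a := fun z hz => ⟨(h z hz).1, hfg z hz ▸ (h z hz).2⟩

theorem one : PowerSeriesEval (fun _ => (1 : A)) 1 := by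
  intro z _
  have h0 : ∀ n : ℕ, n ≠ 0 → z ^ n • PowerSeries.coeff n (1 : PowerSeries A) = 0 := by
    intro n hn
    rw [PowerSeries.coeff_one, if_neg hn, smul_zero]
  refine ⟨summable_of_ne_finset_zero (s := {0}) fun n hn => ?_, ?_⟩
  · rw [h0 n (by simpa using hn), norm_zero]
  · have := hasSum_single (f := fun n : ℕ => z ^ n • PowerSeries.coeff n (1 : PowerSeries A)) 0 h0
    simpa using this

theorem sub (hf : PowerSeriesEval f a) (hg : PowerSeriesEval g b) :
    PowerSeriesEval (fun z => f z - g z) (a - b) := by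
  intro z hz
  simp only [map_sub, smul_sub]
  exact ⟨.of_nonneg_of_le (fun _ => norm_nonneg _) (fun n => norm_sub_le _ _)
    ((hf z hz).1.add (hg z hz).1), (hf z hz).2.sub (hg z hz).2⟩

theorem X_mul (hf : PowerSeriesEval f a) :
    PowerSeriesEval (fun z => z • f z) (PowerSeries.X * a) := by
  intro z hz
  have e : ∀ n : ℕ, z ^ (n + 1) • PowerSeries.coeff (n + 1) (PowerSeries.X * a)
      = z • (z ^ n • PowerSeries.coeff n a) := by
    intro n
    rw [PowerSeries.coeff_succ_X_mul, smul_smul, pow_succ']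
  constructor
  · refine (summable_nat_add_iff 1).1 ?_
    simp only [e, norm_smul z]
    exact (hf z hz).1.mul_left _
  · refine (hasSum_nat_add_iff' 1).1 ?_
    simp only [e]
    have := (hf z hz).2.const_smul z
    simpa using this

theorem const_smul (c : ℂ) (hf : PowerSeriesEval f a) :
    PowerSeriesEval (fun z => c • f z) (c • a) := by
  intro z hz
  have e : ∀ n : ℕ, z ^ n • PowerSeries.coeff n (c • a) = c • (z ^ n • PowerSeries.coeff n a) := by
    intro n
    rw [smul_comm c]
    rfl
  simp only [e, norm_smul c]
  exact ⟨(hf z hz).1.mul_left _, (hf z hz).2.const_smul c⟩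

variable [CompleteSpace A]

theorem mul (hf : PowerSeriesEval f a) (hg : PowerSeriesEval g b) :
    PowerSeriesEval (fun z => f z * g z) (a * b) := by
  intro z hz
  obtain ⟨h1, h2⟩ := hf z hz
  obtain ⟨h3, h4⟩ := hg z hz
  have e : ∀ n : ℕ, z ^ n • PowerSeries.coeff n (a * b)
      = ∑ kl ∈ Finset.HasAntidiagonal.antidiagonal n,
        (z ^ kl.1 • PowerSeries.coeff kl.1 a) * (z ^ kl.2 • PowerSeries.coeff kl.2 b) := by
    intro n
    rw [PowerSeries.coeff_mul, Finset.smul_sum]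
    refine Finset.sum_congr rfl fun kl hkl => ?_
    rw [smul_mul_smul_comm, ← pow_add, Finset.HasAntidiagonal.mem_antidiagonal.1 hkl]
  have hs := summable_norm_sum_mul_antidiagonal_of_summable_norm h1 h3
  simp only [e]
  refine ⟨hs, ?_⟩
  rw [← h2.tsum_eq, ← h4.tsum_eq, tsum_mul_tsum_eq_tsum_sum_antidiagonal_of_summable_norm h1 h3]
  exact hs.of_norm.hasSum

theorem pow (hf : PowerSeriesEval f a) (n : ℕ) : PowerSeriesEval (fun z => f z ^ n) (a ^ n) := by
  induction n with
  | zero => simpa using one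
  | succ n ih => simpa only [pow_succ] using ih.mul hf

/-- The coefficients of `a` as a formal multilinear series. -/
theorem hasFPowerSeriesAt_coeff {p : FormalMultilinearSeries ℂ ℂ A}
    (hf : PowerSeriesEval f a) (hp : HasFPowerSeriesAt f p 0) (n : ℕ) :
    p.coeff n = PowerSeries.coeff n a := by
  set q : FormalMultilinearSeries ℂ ℂ A := fun n =>
    ContinuousMultilinearMap.mkPiRing ℂ (Fin n) (PowerSeries.coeff n a) with hq
  have hqc : ∀ n, q.coeff n = PowerSeries.coeff n a := by
    intro n
    simp [FormalMultilinearSeries.coeff, hq]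
  have h1 : HasFPowerSeriesAt f q 0 := by
    rw [hasFPowerSeriesAt_iff]
    filter_upwards [Metric.ball_mem_nhds (0 : ℂ) one_pos] with z hz
    simp only [hqc, zero_add]
    exact (hf z (by simpa using hz)).2
  rw [hp.eq_formalMultilinearSeries h1, hqc]

theorem hasFPowerSeriesOnBall_cauchy (hd : DifferentiableOn ℂ f (Metric.ball 0 1)) {r : ℝ}
    (hr0 : 0 < r) (hr1 : r < 1) :
    HasFPowerSeriesOnBall f (cauchyPowerSeries f 0 r) 0 (ENNReal.ofReal r) := by
  lift r to NNReal using hr0.le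
  have := (hd.mono (Metric.closedBall_subset_ball hr1)).hasFPowerSeriesOnBall
    (by exact_mod_cast hr0)
  simpa using this

theorem of_differentiableOn (hd : DifferentiableOn ℂ f (Metric.ball 0 1)) :
    ∃ a : PowerSeries A, PowerSeriesEval f a := by
  set p := cauchyPowerSeries f 0 (1 / 2 : ℝ)
  refine ⟨PowerSeries.mk fun n => p.coeff n, fun z hz => ?_⟩
  obtain ⟨r, hr1, hr2⟩ := exists_between (max_lt hz (show (1 / 2 : ℝ) < 1 by norm_num))
  have hr0 : 0 < r := lt_of_lt_of_le (by norm_num) ((le_max_right ‖z‖ (1 / 2)).trans hr1.le)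
  have h1 := hasFPowerSeriesOnBall_cauchy hd hr0 hr2
  have h2 := hasFPowerSeriesOnBall_cauchy hd (r := 1 / 2) (by norm_num) (by norm_num)
  have e : cauchyPowerSeries f 0 r = p :=
    h1.hasFPowerSeriesAt.eq_formalMultilinearSeries h2.hasFPowerSeriesAt
  rw [e] at h1
  have hzr : ‖z‖ < r := lt_of_le_of_lt (le_max_left _ _) hr1
  have hmem : z ∈ Metric.eball (0 : ℂ) (ENNReal.ofReal r) := by
    rw [Metric.eball_ofReal]
    simpa using hzr
  have hmem' : z ∈ Metric.eball (0 : ℂ) p.radius :=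
    Metric.eball_subset_eball h1.r_le hmem
  have hs := p.summable_norm_apply hmem'
  have hsum := h1.hasSum hmem
  rw [zero_add] at hsum
  have e2 : ∀ n : ℕ, (p n fun _ => z) = z ^ n • p.coeff n := fun n => by
    rw [FormalMultilinearSeries.apply_eq_pow_smul_coeff]
  simp only [e2] at hs hsum
  simp only [PowerSeries.coeff_mk]
  exact ⟨hs, hsum⟩

theorem unique (hd : DifferentiableOn ℂ f (Metric.ball 0 1)) (hf : PowerSeriesEval f a)
    (hf' : PowerSeriesEval f b) : a = b := by
  have hp := (hasFPowerSeriesOnBall_cauchy hd (r := 1 / 2) (by norm_num)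
    (by norm_num)).hasFPowerSeriesAt
  ext n
  rw [← hf.hasFPowerSeriesAt_coeff hp, ← hf'.hasFPowerSeriesAt_coeff hp]

theorem norm_coeff_mul_pow_le (hd : DifferentiableOn ℂ f (Metric.ball 0 1))
    (hf : PowerSeriesEval f a) {r : ℝ} (hr0 : 0 < r) (hr1 : r < 1) (n : ℕ) :
    ‖PowerSeries.coeff n a‖ * r ^ n
      ≤ (2 * Real.pi)⁻¹ * ∫ θ in -Real.pi..Real.pi, ‖f (circleMap 0 r θ)‖ := by
  have hp := (hasFPowerSeriesOnBall_cauchy hd hr0 hr1).hasFPowerSeriesAt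
  rw [← hf.hasFPowerSeriesAt_coeff hp]
  have h1 := norm_cauchyPowerSeries_le f 0 r n
  rw [FormalMultilinearSeries.norm_apply_eq_norm_coef, abs_of_pos hr0, inv_pow,
    ← div_eq_mul_inv, le_div_iff₀ (by positivity)] at h1
  refine h1.trans_eq ?_
  congr 1
  have hper : Function.Periodic (fun θ => ‖f (circleMap 0 r θ)‖) (2 * Real.pi) := fun θ => by
    simp only [periodic_circleMap 0 r θ]
  have := hper.intervalIntegral_add_eq 0 (-Real.pi)
  rw [zero_add, show -Real.pi + 2 * Real.pi = Real.pi by ring] at this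
  exact this

end PowerSeriesEval

end Evaluation

section RenewalSeries

variable {B : Type*} [NormedAddCommGroup B] [NormedSpace ℂ B]

/-- The formal series `∑_{n ≥ 1} S_n Xⁿ`. -/
noncomputable def returnPowerSeries (S : ℕ → B →L[ℂ] B) : PowerSeries (B →L[ℂ] B) :=
  PowerSeries.mk fun n => if n = 0 then 0 else S n

/-- The formal series `∑_{n ≥ 0} T_n Xⁿ` of the renewal operators of `S`. -/
noncomputable def renewalPowerSeries (S : ℕ → B →L[ℂ] B) : PowerSeries (B →L[ℂ] B) :=
  PowerSeries.mk (renewalOperator S)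

theorem renewalPowerSeries_eq (S : ℕ → B →L[ℂ] B) :
    renewalPowerSeries S = 1 + renewalPowerSeries S * returnPowerSeries S := by
  ext1 n
  rw [map_add, PowerSeries.coeff_mul, ← Finset.Nat.sum_antidiagonal_swap,
    Finset.Nat.sum_antidiagonal_eq_sum_range_succ_mk, PowerSeries.coeff_one]
  simp only [renewalPowerSeries, returnPowerSeries, PowerSeries.coeff_mk, Prod.swap_prod_mk]
  rcases Nat.eq_zero_or_pos n with rfl | hn
  · simp [renewalOperator_zero]
    rfl
  · rw [renewalOperator_eq S hn, if_neg hn.ne', zero_add, Finset.sum_range_succ', if_pos rfl,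
      mul_zero, add_zero, Finset.range_eq_Ico,
      Finset.sum_Ico_add' (fun j => renewalOperator S (n - j) * if j = 0 then 0 else S j) 0 n 1,
      zero_add]
    refine Finset.sum_congr (by ext; simp) fun j hj => ?_
    rw [if_neg (by have := (Finset.mem_Ico.1 hj).1; omega)]
    rfl

theorem renewalPowerSeries_mul (S : ℕ → B →L[ℂ] B) :
    renewalPowerSeries S * (1 - returnPowerSeries S) = 1 := by
  rw [mul_sub, mul_one, sub_eq_iff_eq_add]
  exact renewalPowerSeries_eq S

theorem returnPowerSeries_smul (c : ℂ) (S : ℕ → B →L[ℂ] B) :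
    returnPowerSeries (fun n => c • S n) = c • returnPowerSeries S := by
  ext1 n
  change _ = c • PowerSeries.coeff n (returnPowerSeries S)
  simp only [returnPowerSeries, PowerSeries.coeff_mk]
  split_ifs <;> simp

variable {Y : Type*} [MeasurableSpace Y] {μ : Measure Y} [IsProbabilityMeasure μ]
  {F : Y → Y} {φ : Y → ℕ}

namespace IsReturnOperators

variable {ι : B →ₗ[ℂ] Lp ℂ ∞ μ} {Rn : ℕ → B →L[ℂ] B} {e : B} {C : ℝ}
  (h : IsReturnOperators μ F φ ι Rn e C) [CompleteSpace B]

include h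

theorem eval_returnPowerSeries : PowerSeriesEval (returnSeries Rn) (returnPowerSeries Rn) := by
  intro z hz
  have e : ∀ n : ℕ, z ^ (n + 1) • PowerSeries.coeff (n + 1) (returnPowerSeries Rn)
      = z ^ (n + 1) • Rn (n + 1) := fun n => by simp [returnPowerSeries]
  constructor
  · refine (summable_nat_add_iff 1).1 ?_
    simp only [e]
    exact .of_nonneg_of_le (fun _ => norm_nonneg _) (h.norm_term_le hz.le) h.summable_bound
  · refine (hasSum_nat_add_iff' 1).1 ?_
    simp only [e]
    have := h.hasSum_returnSeries hz.le
    simpa [returnPowerSeries] using this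

theorem eval_symbol (s : ℝ) : PowerSeriesEval (renewalSymbol Rn s)
    (1 - returnPowerSeries fun n => (s : ℂ) • Rn n) := by
  rw [returnPowerSeries_smul]
  exact PowerSeriesEval.one.sub (h.eval_returnPowerSeries.const_smul _)

theorem differentiableOn_inverse_renewalSymbol {s : ℝ}
    (hs : ∀ z : ℂ, ‖z‖ < 1 → IsUnit (renewalSymbol Rn s z)) :
    DifferentiableOn ℂ (fun z => Ring.inverse (renewalSymbol Rn s z)) (Metric.ball 0 1) := by
  intro z hz
  obtain ⟨u, hu⟩ := hs z (by simpa using hz)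
  have h1 : DifferentiableWithinAt ℂ (renewalSymbol Rn s) (Metric.ball 0 1) z :=
    (differentiableWithinAt_const _).sub
      ((h.differentiableOn_returnSeries z hz).const_smul (s : ℂ))
  have h2 : DifferentiableAt ℂ Ring.inverse (renewalSymbol Rn s z) := by
    rw [← hu]; exact differentiableAt_inverse u.isUnit
  exact h2.comp_differentiableWithinAt z h1

theorem mul_renewalPowerSeries_and_eval {s : ℝ}
    (hs : ∀ z : ℂ, ‖z‖ < 1 → IsUnit (renewalSymbol Rn s z)) :
    (1 - returnPowerSeries fun n => (s : ℂ) • Rn n)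
        * renewalPowerSeries (fun n => (s : ℂ) • Rn n) = 1 ∧
      PowerSeriesEval (fun z => Ring.inverse (renewalSymbol Rn s z))
        (renewalPowerSeries fun n => (s : ℂ) • Rn n) := by
  obtain ⟨a, ha⟩ := PowerSeriesEval.of_differentiableOn
    (h.differentiableOn_inverse_renewalSymbol hs)
  have h1 : (1 - returnPowerSeries fun n => (s : ℂ) • Rn n) * a = 1 :=
    PowerSeriesEval.unique (f := fun _ => 1) (differentiableOn_const _)
      (((h.eval_symbol s).mul ha).congr fun z hz => Ring.mul_inverse_cancel _ (hs z hz))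
      PowerSeriesEval.one
  have h2 : renewalPowerSeries (fun n => (s : ℂ) • Rn n) = a := by
    rw [← mul_one (renewalPowerSeries _), ← h1, ← mul_assoc, renewalPowerSeries_mul, one_mul]
  rw [h2]
  exact ⟨h1, ha⟩

end IsReturnOperators

/-- The damped series `(1 - s) ∑_n G_n Xⁿ`, where `G_n` are the renewal operators of `s S_n`. -/
noncomputable def dampedSeries (Rn : ℕ → B →L[ℂ] B) (s : ℝ) : PowerSeries (B →L[ℂ] B) :=
  ((1 - s : ℝ) : ℂ) • renewalPowerSeries fun n => (s : ℂ) • Rn n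

theorem renewalPowerSeries_sub_mul_dampedSeries_pow {Rn : ℕ → B →L[ℂ] B} {s : ℝ}
    (hs : (1 - returnPowerSeries fun n => (s : ℂ) • Rn n)
        * renewalPowerSeries (fun n => (s : ℂ) • Rn n) = 1) (p : ℕ) :
    renewalPowerSeries Rn - renewalPowerSeries Rn * dampedSeries Rn s ^ p
      = (s : ℂ) • ∑ i ∈ Finset.range p,
        renewalPowerSeries (fun n => (s : ℂ) • Rn n) * dampedSeries Rn s ^ i := by
  set G := renewalPowerSeries (fun n => (s : ℂ) • Rn n) with hG
  set T := renewalPowerSeries Rn with hT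
  set U := dampedSeries Rn s with hU
  have h1 : T - T * U = (s : ℂ) • G := by
    have e1 : ((1 - s : ℝ) : ℂ) • (1 : PowerSeries (B →L[ℂ] B))
        = (1 - returnPowerSeries fun n => (s : ℂ) • Rn n)
          - (s : ℂ) • (1 - returnPowerSeries Rn) := by
      rw [returnPowerSeries_smul, smul_sub, Complex.ofReal_sub, Complex.ofReal_one, sub_smul,
        one_smul]
      abel
    have e2 : U = ((1 - s : ℝ) : ℂ) • (1 : PowerSeries (B →L[ℂ] B)) * G := by
      rw [hU, dampedSeries, smul_mul_assoc, one_mul]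
    rw [e2, e1, sub_mul, hs, mul_sub, mul_one, sub_sub_cancel, smul_mul_assoc, mul_smul_comm,
      ← mul_assoc, renewalPowerSeries_mul, one_mul]
  induction p with
  | zero => simp
  | succ p ih =>
    rw [Finset.sum_range_succ, smul_add, ← ih, ← smul_mul_assoc, ← h1, pow_succ', sub_mul,
      mul_assoc]
    abel

end RenewalSeries

section Positivity

variable {Y : Type*} [MeasurableSpace Y] {μ : Measure Y} [IsProbabilityMeasure μ]
  {F : Y → Y} {φ : Y → ℕ} {B : Type*} [NormedAddCommGroup B] [NormedSpace ℂ B]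

/-- The function `ι v` is real and nonnegative almost everywhere. -/
def NonnegAE (ι : B →ₗ[ℂ] Lp ℂ ∞ μ) (v : B) : Prop :=
  ∀ᵐ y ∂μ, 0 ≤ (ι v y).re ∧ (ι v y).im = 0

namespace NonnegAE

variable {ι : B →ₗ[ℂ] Lp ℂ ∞ μ} {u v w : B}

theorem zero : NonnegAE ι 0 := by
  have := Lp.coeFn_zero ℂ ∞ μ
  unfold NonnegAE
  rw [map_zero]
  filter_upwards [this] with y hy
  simp

theorem add (hu : NonnegAE ι u) (hv : NonnegAE ι v) : NonnegAE ι (u + v) := by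
  unfold NonnegAE
  rw [map_add]
  filter_upwards [hu, hv, Lp.coeFn_add (ι u) (ι v)] with y h1 h2 h3
  rw [h3, Pi.add_apply, Complex.add_re, Complex.add_im, h1.2, h2.2, add_zero]
  exact ⟨add_nonneg h1.1 h2.1, rfl⟩

theorem smul {c : ℝ} (hc : 0 ≤ c) (hv : NonnegAE ι v) : NonnegAE ι ((c : ℂ) • v) := by
  unfold NonnegAE
  rw [map_smul]
  filter_upwards [hv, Lp.coeFn_smul (c : ℂ) (ι v)] with y h1 h2
  rw [h2, Pi.smul_apply, smul_eq_mul, Complex.re_ofReal_mul, Complex.im_ofReal_mul, h1.2, mul_zero]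
  exact ⟨mul_nonneg hc h1.1, rfl⟩

theorem sum {κ : Type*} {s : Finset κ} {f : κ → B} (hf : ∀ i ∈ s, NonnegAE ι (f i)) :
    NonnegAE ι (∑ i ∈ s, f i) := by
  classical
  induction s using Finset.induction_on with
  | empty => simpa using zero
  | insert i s his ih =>
    rw [Finset.sum_insert his]
    exact (hf i (by simp)).add (ih fun j hj => hf j (by simp [hj]))

theorem sub_trans (h1 : NonnegAE ι (w - v)) (h2 : NonnegAE ι (v - u)) : NonnegAE ι (w - u) := by
  rw [← sub_add_sub_cancel w v u]
  exact h1.add h2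

theorem of_setFunctional (hι : ∀ v : B, ‖ι v‖ ≤ ‖v‖)
    (hv : ∀ s : Set Y, MeasurableSet s →
      0 ≤ (setFunctional ι hι s v).re ∧ (setFunctional ι hι s v).im = 0) : NonnegAE ι v := by
  have hi := Lp_top_integrable (ι v)
  have e1 : ∀ s : Set Y, ∫ y in s, (ι v y).re ∂μ = (setFunctional ι hι s v).re := fun s =>
    Complex.reCLM.integral_comp_comm hi.integrableOn
  have e2 : ∀ s : Set Y, ∫ y in s, (ι v y).im ∂μ = (setFunctional ι hι s v).im := fun s =>
    Complex.imCLM.integral_comp_comm hi.integrableOn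
  have h1 : 0 ≤ᵐ[μ] fun y => (ι v y).re :=
    ae_nonneg_of_forall_setIntegral_nonneg hi.re fun s hs _ => by
      rw [e1]; exact (hv s hs).1
  have h2 : (fun y => (ι v y).im) =ᵐ[μ] 0 :=
    hi.im.ae_eq_zero_of_forall_setIntegral_eq_zero fun s hs _ => by
      refine (e2 s).trans (hv s hs).2
  filter_upwards [h1, h2] with y h3 h4 using ⟨h3, h4⟩

theorem setFunctional (hι : ∀ v : B, ‖ι v‖ ≤ ‖v‖) (hv : NonnegAE ι v) (s : Set Y) :
    0 ≤ (setFunctional ι hι s v).re ∧ (setFunctional ι hι s v).im = 0 := by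
  have hi := Lp_top_integrable (ι v)
  have e1 : ∫ y in s, (ι v y).re ∂μ = (_root_.setFunctional ι hι s v).re :=
    Complex.reCLM.integral_comp_comm hi.integrableOn
  have e2 : ∫ y in s, (ι v y).im ∂μ = (_root_.setFunctional ι hι s v).im :=
    Complex.imCLM.integral_comp_comm hi.integrableOn
  rw [← e1, ← e2]
  refine ⟨integral_nonneg_of_ae (ae_restrict_of_ae (hv.mono fun y hy => hy.1)), ?_⟩
  exact integral_eq_zero_of_ae (ae_restrict_of_ae (hv.mono fun y hy => hy.2))

end NonnegAE

/-- The coefficients of `a` preserve nonnegative functions, and `∑_n a_n e ≤ M e`. -/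
structure HasMass (ι : B →ₗ[ℂ] Lp ℂ ∞ μ) (e : B) (a : PowerSeries (B →L[ℂ] B)) (M : ℝ) :
    Prop where
  pos : ∀ n v, NonnegAE ι v → NonnegAE ι (PowerSeries.coeff n a v)
  mass : ∀ N : ℕ, NonnegAE ι ((M : ℂ) • e - ∑ n ∈ Finset.range N, PowerSeries.coeff n a e)

theorem sum_coeff_mul {A : Type*} [Semiring A] (a b : PowerSeries A) (N : ℕ) :
    ∑ n ∈ Finset.range N, PowerSeries.coeff n (a * b)
      = ∑ i ∈ Finset.range N, PowerSeries.coeff i a *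
        ∑ j ∈ Finset.range (N - i), PowerSeries.coeff j b := by
  simp only [Finset.mul_sum, PowerSeries.coeff_mul,
    Finset.Nat.sum_antidiagonal_eq_sum_range_succ_mk]
  exact Finset.sum_range_diag_flip N fun i j => PowerSeries.coeff i a * PowerSeries.coeff j b

theorem sum_coeff_mul_apply (a b : PowerSeries (B →L[ℂ] B)) (N : ℕ) (v : B) :
    ∑ n ∈ Finset.range N, PowerSeries.coeff n (a * b) v
      = ∑ i ∈ Finset.range N, PowerSeries.coeff i a
        (∑ j ∈ Finset.range (N - i), PowerSeries.coeff j b v) := by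
  have := congrArg (fun f : B →L[ℂ] B => f v) (sum_coeff_mul a b N)
  simpa only [_root_.sum_apply, mul_apply_eq_comp] using this

namespace HasMass

variable {ι : B →ₗ[ℂ] Lp ℂ ∞ μ} {e : B} {a b : PowerSeries (B →L[ℂ] B)} {M L : ℝ}

theorem sum_sub (ha : HasMass ι e a M) {c : ℝ} (hc : 0 ≤ c) {N : ℕ} {f : ℕ → B}
    (hf : ∀ i < N, NonnegAE ι ((c : ℂ) • e - f i)) :
    NonnegAE ι (((c * M : ℝ) : ℂ) • e - ∑ i ∈ Finset.range N, PowerSeries.coeff i a (f i)) := by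
  refine NonnegAE.sub_trans (v := (c : ℂ) • ∑ i ∈ Finset.range N, PowerSeries.coeff i a e) ?_ ?_
  · rw [Complex.ofReal_mul, mul_smul, ← smul_sub]
    exact (ha.mass N).smul hc
  · rw [Finset.smul_sum, ← Finset.sum_sub_distrib]
    refine NonnegAE.sum fun i hi => ?_
    rw [← map_smul, ← map_sub]
    exact ha.pos i _ (hf i (Finset.mem_range.1 hi))

theorem mul (ha : HasMass ι e a M) (hb : HasMass ι e b L) (hL : 0 ≤ L) :
    HasMass ι e (a * b) (L * M) := by
  refine ⟨fun n v hv => ?_, fun N => ?_⟩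
  · rw [PowerSeries.coeff_mul, sum_apply]
    exact NonnegAE.sum fun p _ => ha.pos _ _ (hb.pos _ _ hv)
  · rw [sum_coeff_mul_apply]
    exact ha.sum_sub hL fun i _ => hb.mass _

theorem one (he : NonnegAE ι e) : HasMass ι e (1 : PowerSeries (B →L[ℂ] B)) 1 := by
  refine ⟨fun n v hv => ?_, fun N => ?_⟩
  · rw [PowerSeries.coeff_one]
    split_ifs
    · exact hv
    · exact NonnegAE.zero
  · rcases N with _ | N
    · simpa using he
    · rw [Finset.sum_range_succ', Finset.sum_eq_zero fun n _ => by simp]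
      simpa using NonnegAE.zero

theorem pow (he : NonnegAE ι e) (ha : HasMass ι e a 1) (n : ℕ) : HasMass ι e (a ^ n) 1 := by
  induction n with
  | zero => simpa using one he
  | succ n ih => simpa [pow_succ] using ih.mul ha zero_le_one

theorem smul (ha : HasMass ι e a M) {c : ℝ} (hc : 0 ≤ c) :
    HasMass ι e ((c : ℂ) • a) (c * M) := by
  have hco : ∀ n v, PowerSeries.coeff n ((c : ℂ) • a) v = (c : ℂ) • PowerSeries.coeff n a v :=
    fun n v => rfl
  refine ⟨fun n v hv => ?_, fun N => ?_⟩
  · rw [hco]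
    exact (ha.pos n v hv).smul hc
  · simp only [hco]
    rw [← Finset.smul_sum, Complex.ofReal_mul, mul_smul, ← smul_sub]
    exact (ha.mass N).smul hc

theorem add (ha : HasMass ι e a M) (hb : HasMass ι e b L) : HasMass ι e (a + b) (M + L) := by
  refine ⟨fun n v hv => ?_, fun N => ?_⟩
  · rw [map_add]
    exact (ha.pos n v hv).add (hb.pos n v hv)
  · simp only [map_add, add_apply, Finset.sum_add_distrib, Complex.ofReal_add, add_smul]
    rw [add_sub_add_comm]
    exact (ha.mass N).add (hb.mass N)

theorem zero : HasMass ι e (0 : PowerSeries (B →L[ℂ] B)) 0 :=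
  ⟨fun n v _ => by simpa using NonnegAE.zero, fun N => by simpa using NonnegAE.zero⟩

theorem sum {f : ℕ → PowerSeries (B →L[ℂ] B)} (hf : ∀ i, HasMass ι e (f i) M) (p : ℕ) :
    HasMass ι e (∑ i ∈ Finset.range p, f i) (p * M) := by
  induction p with
  | zero => simpa using zero
  | succ p ih =>
    rw [Finset.sum_range_succ, Nat.cast_succ, add_mul, one_mul]
    exact ih.add (hf p)

end HasMass

theorem NonnegAE.renewalOperator {ι : B →ₗ[ℂ] Lp ℂ ∞ μ} {S : ℕ → B →L[ℂ] B}
    (hS : ∀ n, 1 ≤ n → ∀ v, NonnegAE ι v → NonnegAE ι (S n v)) (n : ℕ) :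
    ∀ v, NonnegAE ι v → NonnegAE ι (renewalOperator S n v) := by
  induction n using Nat.strong_induction_on with
  | _ n ih =>
    intro v hv
    rcases Nat.eq_zero_or_pos n with rfl | hn
    · rwa [renewalOperator_zero]
    · rw [renewalOperator_eq S hn, sum_apply]
      refine NonnegAE.sum fun j hj => ?_
      have := Finset.mem_Icc.1 hj
      exact ih (n - j) (by omega) _ (hS j this.1 v hv)

theorem HasMass.of_returnPowerSeries {ι : B →ₗ[ℂ] Lp ℂ ∞ μ} {e : B} (he : NonnegAE ι e)
    {S : ℕ → B →L[ℂ] B} {s : ℝ} (hs0 : 0 ≤ s) (hs1 : s < 1)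
    (hS : HasMass ι e (returnPowerSeries S) s) :
    HasMass ι e (renewalPowerSeries S) (1 / (1 - s)) := by
  have hs : (1 - s) ≠ 0 := by linarith
  have hpos : ∀ n v, NonnegAE ι v → NonnegAE ι (PowerSeries.coeff n (renewalPowerSeries S) v) := by
    intro n v hv
    rw [renewalPowerSeries, PowerSeries.coeff_mk]
    refine NonnegAE.renewalOperator (fun n hn v hv => ?_) n v hv
    have := hS.pos n v hv
    rwa [returnPowerSeries, PowerSeries.coeff_mk, if_neg (by omega)] at this
  refine ⟨hpos, fun N => ?_⟩
  induction N with
  | zero =>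
    simpa using he.smul (c := (1 - s)⁻¹) (inv_nonneg.2 (by linarith))
  | succ N ih =>
    set G := renewalPowerSeries S with hG
    have h1 : ∑ n ∈ Finset.range (N + 1), PowerSeries.coeff n G e
        = e + ∑ i ∈ Finset.range N, PowerSeries.coeff i G
          (∑ j ∈ Finset.range (N + 1 - i), PowerSeries.coeff j (returnPowerSeries S) e) := by
      conv_lhs => rw [hG, renewalPowerSeries_eq]
      simp only [map_add, add_apply, Finset.sum_add_distrib]
      rw [sum_coeff_mul_apply, Finset.sum_range_succ', Finset.sum_range_succ (n := N),
        Finset.sum_eq_zero fun n _ => by simp]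
      simp [returnPowerSeries, hG]
    have h2 : NonnegAE ι (((s * (1 / (1 - s)) : ℝ) : ℂ) • e - ∑ i ∈ Finset.range N,
        PowerSeries.coeff i G
          (∑ j ∈ Finset.range (N + 1 - i), PowerSeries.coeff j (returnPowerSeries S) e)) := by
      refine NonnegAE.sub_trans
        (v := (s : ℂ) • ∑ i ∈ Finset.range N, PowerSeries.coeff i G e) ?_ ?_
      · rw [Complex.ofReal_mul, mul_smul, ← smul_sub]
        exact ih.smul hs0
      · rw [Finset.smul_sum, ← Finset.sum_sub_distrib]
        refine NonnegAE.sum fun i _ => ?_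
        rw [← map_smul, ← map_sub]
        exact hpos i _ (hS.mass _)
    have h3 : 1 / (1 - s) = 1 + s * (1 / (1 - s)) := by field_simp; ring
    rw [h1, h3, Complex.ofReal_add, add_smul, Complex.ofReal_one, one_smul,
      add_sub_add_left_eq_sub]
    exact h2

namespace IsReturnOperators

variable {ι : B →ₗ[ℂ] Lp ℂ ∞ μ} {Rn : ℕ → B →L[ℂ] B} {e : B} {C : ℝ}
  (h : IsReturnOperators μ F φ ι Rn e C)

include h

theorem nonnegAE_one : NonnegAE ι e := by
  filter_upwards [h.const_one] with y hy
  simp [hy]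

theorem nonnegAE_apply (n : ℕ) (hn : 1 ≤ n) (v : B) (hv : NonnegAE ι v) :
    NonnegAE ι (Rn n v) := by
  refine NonnegAE.of_setFunctional h.norm_le fun s hs => ?_
  rw [setFunctional_apply, h.setIntegral_renewal n hn v hs]
  exact hv.setFunctional h.norm_le _

theorem setFunctional_one (s : Set Y) : setFunctional ι h.norm_le s e = (μ.real s : ℂ) := by
  rw [setFunctional_apply, integral_congr_ae (ae_restrict_of_ae h.const_one)]
  simp

theorem nonnegAE_one_sub_sum (N : ℕ) :
    NonnegAE ι (e - ∑ n ∈ Finset.range N, Rn (n + 1) e) := by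
  refine NonnegAE.of_setFunctional h.norm_le fun s hs => ?_
  have h1 : ∀ n : ℕ, setFunctional ι h.norm_le s (Rn (n + 1) e)
      = (μ.real (F ⁻¹' s ∩ {y | φ y = n + 1}) : ℂ) := by
    intro n
    rw [setFunctional_apply, h.setIntegral_renewal (n + 1) (by omega) e hs, ← h.setFunctional_one,
      setFunctional_apply]
  have h2 := h.hasSum_setIntegral (integrable_const (1 : ℝ)) (h.preserving.measurable hs)
  simp only [setIntegral_const, smul_eq_mul, mul_one] at h2
  have h3 := sum_le_hasSum (Finset.range N) (fun _ _ => measureReal_nonneg) h2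
  rw [measureReal_def μ (F ⁻¹' s), h.preserving.measure_preimage hs.nullMeasurableSet,
    ← measureReal_def] at h3
  rw [map_sub, map_sum, h.setFunctional_one]
  simp only [h1]
  rw [← Complex.ofReal_sum, ← Complex.ofReal_sub]
  exact ⟨by simpa using h3, Complex.ofReal_im _⟩

theorem hasMass_returnPowerSeries : HasMass ι e (returnPowerSeries Rn) 1 := by
  refine ⟨fun n v hv => ?_, fun N => ?_⟩
  · rw [returnPowerSeries, PowerSeries.coeff_mk]
    split_ifs with hn
    · exact NonnegAE.zero
    · exact h.nonnegAE_apply n (by omega) v hv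
  · rcases N with _ | N
    · simpa using h.nonnegAE_one
    · rw [Finset.sum_range_succ']
      simpa [returnPowerSeries] using h.nonnegAE_one_sub_sum N

theorem hasMass_renewal {s : ℝ} (hs0 : 0 ≤ s) (hs1 : s < 1) :
    HasMass ι e (renewalPowerSeries fun n => (s : ℂ) • Rn n) (1 / (1 - s)) := by
  refine HasMass.of_returnPowerSeries h.nonnegAE_one hs0 hs1 ?_
  rw [returnPowerSeries_smul]
  simpa using h.hasMass_returnPowerSeries.smul hs0

theorem hasMass_dampedSeries {s : ℝ} (hs0 : 0 ≤ s) (hs1 : s < 1) :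
    HasMass ι e (dampedSeries Rn s) 1 := by
  have := (h.hasMass_renewal hs0 hs1).smul (c := 1 - s) (by linarith)
  rwa [mul_one_div_cancel (by linarith)] at this

theorem hasMass_sub {s : ℝ} (hs0 : 0 ≤ s) (hs1 : s < 1)
    (hs : (1 - returnPowerSeries fun n => (s : ℂ) • Rn n)
        * renewalPowerSeries (fun n => (s : ℂ) • Rn n) = 1) (p : ℕ) :
    HasMass ι e (renewalPowerSeries Rn - renewalPowerSeries Rn * dampedSeries Rn s ^ p)
      (s * (p * (1 * (1 / (1 - s))))) := by
  rw [renewalPowerSeries_sub_mul_dampedSeries_pow hs]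
  exact (HasMass.sum (fun i => (h.hasMass_renewal hs0 hs1).mul
    ((h.hasMass_dampedSeries hs0 hs1).pow h.nonnegAE_one i) zero_le_one) p).smul hs0

end IsReturnOperators

end Positivity

section Oscillation

theorem polarGap_circleMap {r θ : ℝ} (hr0 : 0 < r) (hr1 : r ≤ 1)
    (hθ : θ ∈ Set.Ioc (-Real.pi) Real.pi) :
    polarGap (circleMap 0 r θ) = -Real.log r + |θ| := by
  have h1 : ‖circleMap 0 r θ‖ = r := by rw [norm_circleMap_zero, abs_of_pos hr0]
  have h2 : (circleMap 0 r θ).arg = θ := by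
    rw [circleMap_zero, Complex.exp_mul_I]
    exact Complex.arg_mul_cos_add_sin_mul_I hr0 hθ
  rw [polarGap, h1, h2, abs_of_nonpos (Real.log_nonpos hr0.le hr1)]

theorem integral_inv_one_add_sq_le {x : ℝ} (hx : 0 < x) :
    ∫ θ in -Real.pi..Real.pi, 1 / (1 + (x * θ) ^ 2) ≤ Real.pi / x := by
  rw [intervalIntegral.integral_comp_mul_left (fun t => 1 / (1 + t ^ 2)) hx.ne',
    integral_one_div_one_add_sq, smul_eq_mul, div_eq_inv_mul]
  gcongr
  have h1 := Real.arctan_lt_pi_div_two (x * Real.pi)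
  have h2 := Real.neg_pi_div_two_lt_arctan (x * -Real.pi)
  linarith

theorem damped_bound {K D P t t' x a : ℝ} {p : ℕ} (hK : 0 ≤ K) (hD : 0 ≤ D)
    (ht : 0 < t) (ht' : 0 < t') (hx : 1 ≤ x) (hpot : x ^ a * t ≤ P * t') (hp : 3 ≤ a * (p + 1)) :
    K / t' * (D * t * (K / t')) ^ p ≤ K * (D * K) ^ p * P ^ (p + 1) / (x ^ 3 * t) := by
  have hx0 : 0 < x := by linarith
  have h1 : x ^ 3 ≤ (x ^ a) ^ (p + 1) := by
    rw [← Real.rpow_natCast, ← Real.rpow_natCast, ← Real.rpow_mul hx0.le]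
    exact Real.rpow_le_rpow_of_exponent_le hx (by push_cast; linarith)
  have h2 : x ^ 3 * t ^ (p + 1) ≤ P ^ (p + 1) * t' ^ (p + 1) := by
    calc x ^ 3 * t ^ (p + 1) ≤ (x ^ a) ^ (p + 1) * t ^ (p + 1) := by gcongr
      _ = (x ^ a * t) ^ (p + 1) := (mul_pow _ _ _).symm
      _ ≤ (P * t') ^ (p + 1) := by gcongr
      _ = _ := mul_pow _ _ _
  have h3 : K / t' * (D * t * (K / t')) ^ p = K * (D * K) ^ p * (t ^ p / t' ^ (p + 1)) := by
    rw [show D * t * (K / t') = D * K * (t / t') by ring, mul_pow, div_pow, pow_succ]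
    field_simp
  rw [h3, mul_div_assoc]
  refine mul_le_mul_of_nonneg_left ?_ (by positivity)
  rw [div_le_div_iff₀ (by positivity) (by positivity)]
  calc t ^ p * (x ^ 3 * t) = x ^ 3 * t ^ (p + 1) := by ring
    _ ≤ _ := h2

variable {Y : Type*} [MeasurableSpace Y] {μ : Measure Y} [IsProbabilityMeasure μ]
  {F : Y → Y} {φ : Y → ℕ} {B : Type*} [NormedAddCommGroup B] [NormedSpace ℂ B]
  [CompleteSpace B] {ι : B →ₗ[ℂ] Lp ℂ ∞ μ} {Rn : ℕ → B →L[ℂ] B} {e : B} {C : ℝ}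

/-- The smoothing `T U_sᵖ` of the renewal series, with `U_s` the damped series. -/
noncomputable def smoothedSeries (Rn : ℕ → B →L[ℂ] B) (s : ℝ) (p : ℕ) :
    PowerSeries (B →L[ℂ] B) :=
  renewalPowerSeries Rn * dampedSeries Rn s ^ p

namespace IsReturnOperators

variable (h : IsReturnOperators μ F φ ι Rn e C)

include h

theorem eval_renewal (hH2 : HypothesisH2 Rn) :
    PowerSeriesEval (fun z => Ring.inverse (renewalSymbol Rn 1 z)) (renewalPowerSeries Rn) := by
  have h1 := (h.mul_renewalPowerSeries_and_eval (s := 1) fun z hz =>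
    h.isUnit_renewalSymbol_one hH2 hz.le fun hz1 => by simp [hz1] at hz).2
  simpa only [Complex.ofReal_one, one_smul] using h1

theorem norm_coeff_smoothedSeries_sub_le (hH2 : HypothesisH2 Rn) {s : ℝ}
    (hs : ∀ z : ℂ, ‖z‖ < 1 → IsUnit (renewalSymbol Rn s z)) (p : ℕ) {M x : ℝ} (hx : 1 ≤ x)
    (hM : 0 ≤ M)
    (hb : ∀ θ ∈ Set.Ioc (-Real.pi) Real.pi,
      ‖Ring.inverse (renewalSymbol Rn 1 (circleMap 0 (Real.exp (-x⁻¹)) θ))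
        * (((1 - s : ℝ) : ℂ) • Ring.inverse
          (renewalSymbol Rn s (circleMap 0 (Real.exp (-x⁻¹)) θ))) ^ p‖
        ≤ M / (1 + x * |θ|) ^ 3)
    {n : ℕ} (hn : (n : ℝ) + 1 ≤ 2 * x) :
    ‖PowerSeries.coeff (n + 1) (smoothedSeries Rn s p)
      - PowerSeries.coeff n (smoothedSeries Rn s p)‖ ≤ Real.exp 2 * M / x ^ 2 := by
  have hx0 : 0 < x := by linarith
  set r := Real.exp (-x⁻¹) with hr
  have hr0 : 0 < r := Real.exp_pos _
  have hr1 : r < 1 := Real.exp_lt_one_iff.2 (neg_lt_zero.2 (by positivity))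
  set f : ℂ → B →L[ℂ] B := fun z => Ring.inverse (renewalSymbol Rn 1 z)
    * (((1 - s : ℝ) : ℂ) • Ring.inverse (renewalSymbol Rn s z)) ^ p with hf
  have hfe : PowerSeriesEval f (smoothedSeries Rn s p) :=
    (h.eval_renewal hH2).mul (((h.mul_renewalPowerSeries_and_eval hs).2.const_smul _).pow p)
  have hfd : DifferentiableOn ℂ f (Metric.ball 0 1) :=
    (h.differentiableOn_inverse_renewalSymbol fun z hz =>
      h.isUnit_renewalSymbol_one hH2 hz.le fun hz1 => by simp [hz1] at hz).mul
      (((h.differentiableOn_inverse_renewalSymbol hs).const_smul ((1 - s : ℝ) : ℂ)).pow p :)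
  set g : ℂ → B →L[ℂ] B := fun z => f z - z • f z with hg
  have hge : PowerSeriesEval g (smoothedSeries Rn s p - PowerSeries.X * smoothedSeries Rn s p) :=
    hfe.sub hfe.X_mul
  have hgd : DifferentiableOn ℂ g (Metric.ball 0 1) := hfd.sub (differentiableOn_id.smul hfd)
  have h1 := PowerSeriesEval.norm_coeff_mul_pow_le hgd hge hr0 hr1 (n + 1)
  rw [map_sub, PowerSeries.coeff_succ_X_mul] at h1
  have hball : ∀ θ, circleMap 0 r θ ∈ Metric.ball (0 : ℂ) 1 := fun θ => by
    simpa [abs_of_pos hr0] using hr1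
  have hcont : Continuous fun θ => ‖g (circleMap 0 r θ)‖ :=
    (hgd.continuousOn.comp_continuous (continuous_circleMap 0 r) hball).norm
  have hpt : ∀ θ ∈ Set.Ioc (-Real.pi) Real.pi,
      ‖g (circleMap 0 r θ)‖ ≤ M / x * (1 / (1 + (x * θ) ^ 2)) := by
    intro θ hθ
    set z := circleMap 0 r θ with hz
    have hz0 : z ≠ 0 := circleMap_ne_center hr0.ne'
    have hgap : ‖1 - z‖ ≤ (1 + x * |θ|) / x := by
      have h2 := norm_one_sub_le_polarGap hz0 
        (by rw [hz, norm_circleMap_zero, abs_of_pos hr0]; exact hr1.le)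
      rw [hz, polarGap_circleMap hr0 hr1.le hθ, hr, Real.log_exp, neg_neg] at h2
      refine h2.trans_eq ?_
      field_simp
    have e1 : g z = (1 - z) • f z := by rw [hg, sub_smul, one_smul]
    have hy : 0 < 1 + x * |θ| := by positivity
    rw [e1, norm_smul]
    calc ‖1 - z‖ * ‖f z‖ ≤ (1 + x * |θ|) / x * (M / (1 + x * |θ|) ^ 3) :=
          mul_le_mul hgap (hb θ hθ) (norm_nonneg _) (by positivity)
      _ = M / x * (1 / (1 + x * |θ|) ^ 2) := by field_simp
      _ ≤ M / x * (1 / (1 + (x * θ) ^ 2)) := by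
          gcongr
          have : (x * θ) ^ 2 = (x * |θ|) ^ 2 := by rw [mul_pow, mul_pow, sq_abs]
          rw [this]
          nlinarith [mul_nonneg hx0.le (abs_nonneg θ)]
  have hpi := Real.pi_pos
  have h2 : ∫ θ in -Real.pi..Real.pi, ‖g (circleMap 0 r θ)‖ ≤ M / x * (Real.pi / x) := by
    calc ∫ θ in -Real.pi..Real.pi, ‖g (circleMap 0 r θ)‖
        ≤ ∫ θ in -Real.pi..Real.pi, M / x * (1 / (1 + (x * θ) ^ 2)) := by
          refine intervalIntegral.integral_mono_on_of_le_Ioo (by linarith)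
            (hcont.intervalIntegrable _ _) (Continuous.intervalIntegrable ?_ _ _)
            fun θ hθ => hpt θ ⟨hθ.1, hθ.2.le⟩
          refine continuous_const.mul (continuous_const.div (by fun_prop) fun θ => ?_)
          positivity
      _ = M / x * ∫ θ in -Real.pi..Real.pi, 1 / (1 + (x * θ) ^ 2) :=
          intervalIntegral.integral_const_mul _ _
      _ ≤ _ := by
          gcongr
          exact integral_inv_one_add_sq_le hx0
  have h3 : Real.exp (-2) ≤ r ^ (n + 1) := by
    rw [hr, ← Real.exp_nat_mul, Real.exp_le_exp]
    push_cast
    have : ((n : ℝ) + 1) * x⁻¹ ≤ 2 := by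
      rw [← div_eq_mul_inv, div_le_iff₀ hx0]; exact hn
    linarith
  set d := ‖PowerSeries.coeff (n + 1) (smoothedSeries Rn s p)
      - PowerSeries.coeff n (smoothedSeries Rn s p)‖
  have h4 : d * Real.exp (-2) ≤ M / x ^ 2 := by
    calc d * Real.exp (-2) ≤ d * r ^ (n + 1) := by gcongr
      _ ≤ (2 * Real.pi)⁻¹ * (M / x * (Real.pi / x)) := h1.trans (by gcongr)
      _ = M / x ^ 2 / 2 := by field_simp
      _ ≤ M / x ^ 2 := half_le_self (by positivity)
  rw [Real.exp_neg, ← div_eq_mul_inv, div_le_iff₀ (Real.exp_pos 2)] at h4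
  refine h4.trans_eq ?_
  ring

/-- For `1 - s` proportional to the tail at `N`, the smoothed series satisfies the exact identity
behind the mass bound, and its coefficients up to `2N` have small increments. -/
theorem exists_increment_bound (hH2 : HypothesisH2 Rn) {β : ℝ} (hβ0 : 0 < β) (hβ1 : β < 1)
    (hτ : IsRegVarTail (returnTail μ φ) β) :
    ∃ p : ℕ, ∀ D : ℝ, 0 < D → ∃ M : ℝ, 0 ≤ M ∧ ∀ᶠ N : ℕ in atTop,
      0 ≤ 1 - D * returnTail μ φ N ∧
      (1 - returnPowerSeries fun n => ((1 - D * returnTail μ φ N : ℝ) : ℂ) • Rn n)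
        * renewalPowerSeries (fun n => ((1 - D * returnTail μ φ N : ℝ) : ℂ) • Rn n) = 1 ∧
      ∀ n : ℕ, n < 2 * N →
        ‖PowerSeries.coeff (n + 1) (smoothedSeries Rn (1 - D * returnTail μ φ N) p)
          - PowerSeries.coeff n (smoothedSeries Rn (1 - D * returnTail μ φ N) p)‖
          ≤ M / ((N : ℝ) ^ 2 * returnTail μ φ N) := by
  obtain ⟨K, hK, hres⟩ := h.exists_bound_resolvent hH2 hβ0 hβ1 hτ
  obtain ⟨P, hP, hpot⟩ := hτ.potter_lower (a := β / 2) (y₀ := 1 / 5) (by linarith) (by linarith)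
    (by norm_num)
  obtain ⟨p, hp⟩ := exists_nat_ge (3 / (β / 2))
  have hp3 : 3 ≤ β / 2 * (p + 1) := by
    rw [div_le_iff₀ (by linarith)] at hp
    nlinarith
  refine ⟨p, fun D hD => ⟨Real.exp 2 * (K * (D * K) ^ p * P ^ (p + 1)), by positivity, ?_⟩⟩
  have hres1 := hres.self_of_nhdsWithin (Set.mem_Iic.2 le_rfl)
  have hlim : Tendsto (fun N : ℕ => 1 - D * returnTail μ φ N) atTop (𝓝[≤] 1) := by
    refine tendsto_nhdsWithin_iff.2 ⟨?_, Eventually.of_forall fun N => ?_⟩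
    · have := ((hτ.tendsto_zero hβ0).comp tendsto_natCast_atTop_atTop).const_mul D
      simpa using this.const_sub 1
    · have := (hτ.pos N).le
      simp only [Set.mem_Iic]
      nlinarith
  have hlim0 : ∀ᶠ N : ℕ in atTop, 0 ≤ 1 - D * returnTail μ φ N :=
    (hlim.mono_right nhdsWithin_le_nhds).eventually_const_le zero_lt_one
  filter_upwards [hlim0, hlim.eventually hres, eventually_ge_atTop 1] with N hN0 hNres hN1
  set t := returnTail μ φ N with ht
  have ht0 : 0 < t := hτ.pos N
  have hunit : ∀ z : ℂ, ‖z‖ < 1 → IsUnit (renewalSymbol Rn (1 - D * t) z) := fun z hz =>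
    (hNres z hz.le fun hz1 => by simp [hz1] at hz).1
  refine ⟨hN0, (h.mul_renewalPowerSeries_and_eval hunit).1, fun n hn => ?_⟩
  have hx : (1 : ℝ) ≤ N := by exact_mod_cast hN1
  have hx0 : (0 : ℝ) < N := by linarith
  have hM0 : 0 ≤ K * (D * K) ^ p * P ^ (p + 1) / t := by positivity
  refine (h.norm_coeff_smoothedSeries_sub_le hH2 hunit p hx hM0 ?_
    (by exact_mod_cast hn)).trans_eq (by field_simp)
  intro θ hθ
  set r := Real.exp (-(N : ℝ)⁻¹) with hr
  have hr0 : 0 < r := Real.exp_pos _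
  have hr1 : r < 1 := Real.exp_lt_one_iff.2 (neg_lt_zero.2 (by positivity))
  set z := circleMap 0 r θ with hz
  have hzn : ‖z‖ = r := by rw [hz, norm_circleMap_zero, abs_of_pos hr0]
  have hz1 : z ≠ 1 := fun hz1 => by rw [hz1, norm_one] at hzn; linarith
  have hgap : polarGap z = (1 + N * |θ|) / N := by
    rw [hz, polarGap_circleMap hr0 hr1.le hθ, hr, Real.log_exp, neg_neg]
    field_simp
  have hy : 1 ≤ 1 + N * |θ| := by
    have := abs_nonneg θ
    nlinarith
  have hθ4 : |θ| ≤ 4 := (abs_le.2 ⟨hθ.1.le, hθ.2⟩).trans Real.pi_le_four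
  have hb1 := (hres1 z (hzn.trans_le hr1.le) hz1).2
  have hb2 := (hNres z (hzn.trans_le hr1.le) hz1).2
  set t' := returnTail μ φ (1 / polarGap z) with ht'
  have ht'0 : 0 < t' := hτ.pos _
  have hpo : (1 + N * |θ|) ^ (β / 2) * t ≤ P * t' := by
    have := hpot N (1 / polarGap z) ?_ ?_
    · have e1 : (N : ℝ) / (1 / polarGap z) = 1 + N * |θ| := by
        rw [hgap]
        field_simp
      rwa [e1] at this
    · rw [hgap, one_div_div, div_le_div_iff₀ (by norm_num) (by linarith)]
      nlinarith
    · rw [hgap, one_div_div]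
      exact div_le_self hx0.le hy
  calc ‖Ring.inverse (renewalSymbol Rn 1 z)
        * (((1 - (1 - D * t) : ℝ) : ℂ) • Ring.inverse (renewalSymbol Rn (1 - D * t) z)) ^ p‖
      ≤ ‖Ring.inverse (renewalSymbol Rn 1 z)‖
        * ‖(((1 - (1 - D * t) : ℝ) : ℂ) • Ring.inverse (renewalSymbol Rn (1 - D * t) z)) ^ p‖ :=
        norm_mul_le _ _
    _ ≤ K / t' * (D * t * (K / t')) ^ p := by
        refine mul_le_mul hb1 ?_ (norm_nonneg _) (by positivity)
        have h5 : ‖((1 - (1 - D * t) : ℝ) : ℂ) • Ring.inverse (renewalSymbol Rn (1 - D * t) z)‖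
            ≤ D * t * (K / t') := by
          rw [norm_smul, sub_sub_cancel, Complex.norm_real, Real.norm_of_nonneg (by positivity)]
          gcongr
        rcases Nat.eq_zero_or_pos p with hp0 | hp0
        · exfalso
          rw [hp0] at hp3
          push_cast at hp3
          linarith
        · exact (norm_pow_le' _ hp0).trans (by gcongr)
    _ ≤ K * (D * K) ^ p * P ^ (p + 1) / ((1 + N * |θ|) ^ 3 * t) :=
        damped_bound hK.le hD.le ht0 ht'0 hy hpo hp3
    _ = _ := by rw [mul_comm (_ ^ 3) t, div_mul_eq_div_div]

end IsReturnOperators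

end Oscillation

theorem HasDensityZero.mono {E E' : Set ℕ} (hE : HasDensityZero E) (h : E' ⊆ E) :
    HasDensityZero E' := by
  refine squeeze_zero (fun n => by positivity) (fun n => ?_) hE
  gcongr
  exact (Set.finite_Icc 1 n).inter_of_right E

theorem HasDensityZero.union {E E' : Set ℕ} (hE : HasDensityZero E) (hE' : HasDensityZero E') :
    HasDensityZero (E ∪ E') := by
  have h := hE.add hE'
  rw [add_zero] at h
  refine squeeze_zero (fun n => by positivity) (fun n => ?_) h
  rw [← add_div, Set.union_inter_distrib_right]
  gcongr
  exact_mod_cast Set.ncard_union_le _ _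

section Pointwise

variable {Y : Type*} [MeasurableSpace Y] {μ : Measure Y} [IsProbabilityMeasure μ]
  {F : Y → Y} {φ : Y → ℕ} {B : Type*} [NormedAddCommGroup B] [NormedSpace ℂ B]
  {ι : B →ₗ[ℂ] Lp ℂ ∞ μ} {Rn : ℕ → B →L[ℂ] B} {e : B} {C : ℝ}

theorem ae_norm_le_of_norm_le (hι : ∀ v : B, ‖ι v‖ ≤ ‖v‖) (v : B) : ∀ᵐ y ∂μ, ‖ι v y‖ ≤ ‖v‖ := by
  filter_upwards [Lp_top_ae_norm_le (ι v)] with y hy using hy.trans (hι v)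

theorem ae_map_sub (u v : B) : ∀ᵐ y ∂μ, ι (u - v) y = ι u y - ι v y := by
  rw [map_sub]
  exact Lp.coeFn_sub _ _

theorem ae_map_smul (c : ℂ) (v : B) : ∀ᵐ y ∂μ, ι (c • v) y = c * ι v y := by
  rw [map_smul]
  exact Lp.coeFn_smul _ _

theorem ae_map_sum (f : ℕ → B) (s : Finset ℕ) :
    ∀ᵐ y ∂μ, ι (∑ i ∈ s, f i) y = ∑ i ∈ s, ι (f i) y := by
  induction s using Finset.induction_on with
  | empty =>
    simp only [Finset.sum_empty, map_zero]
    exact Lp.coeFn_zero ℂ ∞ μ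
  | insert i s his ih =>
    rw [Finset.sum_insert his, map_add]
    filter_upwards [ih, Lp.coeFn_add (ι (f i)) (ι (∑ i ∈ s, f i))] with y h1 h2
    rw [h2, Pi.add_apply, h1, Finset.sum_insert his]

theorem ae_tendsto (hι : ∀ v : B, ‖ι v‖ ≤ ‖v‖) {b : ℕ → B} {w : B} (hb : Tendsto b atTop (𝓝 w)) :
    ∀ᵐ y ∂μ, Tendsto (fun n => ι (b n) y) atTop (𝓝 (ι w y)) := by
  have h1 : ∀ᵐ y ∂μ, ∀ n, ‖ι (b n - w) y‖ ≤ ‖b n - w‖ ∧ ι (b n - w) y = ι (b n) y - ι w y :=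
    ae_all_iff.2 fun n => (ae_norm_le_of_norm_le hι _).and (ae_map_sub _ _)
  filter_upwards [h1] with y hy
  rw [tendsto_iff_norm_sub_tendsto_zero] at hb ⊢
  refine squeeze_zero (fun n => norm_nonneg _) (fun n => ?_) hb
  rw [← (hy n).2]
  exact (hy n).1

theorem ae_hasSum (hι : ∀ v : B, ‖ι v‖ ≤ ‖v‖) {b : ℕ → B} {w : B} (hs : Summable fun n => ‖b n‖)
    (hb : HasSum b w) : ∀ᵐ y ∂μ, HasSum (fun n => ι (b n) y) (ι w y) := by
  have h1 : ∀ᵐ y ∂μ, ∀ n, ‖ι (b n) y‖ ≤ ‖b n‖ ∧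
      ι (∑ i ∈ Finset.range n, b i) y = ∑ i ∈ Finset.range n, ι (b i) y :=
    ae_all_iff.2 fun n => (ae_norm_le_of_norm_le hι _).and (ae_map_sum _ _)
  filter_upwards [h1, ae_tendsto hι hb.tendsto_sum_nat] with y hy ht
  rw [(Summable.of_norm_bounded hs fun n => (hy n).1).hasSum_iff_tendsto_nat]
  exact ht.congr fun n => (hy n).2

namespace IsReturnOperators

variable (h : IsReturnOperators μ F φ ι Rn e C)

include h

theorem nonnegAE_norm_smul_sub {v : B} (hv : ∀ᵐ y ∂μ, (ι v y).im = 0) :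
    NonnegAE ι ((‖v‖ : ℂ) • e - v) := by
  filter_upwards [ae_map_sub (ι := ι) ((‖v‖ : ℂ) • e) v, ae_map_smul (ι := ι) (‖v‖ : ℂ) e,
    h.const_one, hv, ae_norm_le_of_norm_le h.norm_le v] with y h1 h2 h3 h4 h5
  rw [h1, h2, h3, mul_one, Complex.sub_re, Complex.sub_im, h4]
  refine ⟨?_, by simp⟩
  have := (Complex.re_le_norm (ι v y)).trans h5
  simpa using this

theorem nonnegAE_norm_smul_add {v : B} (hv : ∀ᵐ y ∂μ, (ι v y).im = 0) :
    NonnegAE ι ((‖v‖ : ℂ) • e + v) := by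
  have := h.nonnegAE_norm_smul_sub (v := -v) (by
    rw [map_neg]
    filter_upwards [hv, Lp.coeFn_neg (ι v)] with y h1 h2
    rw [h2, Pi.neg_apply, Complex.neg_im, h1, neg_zero])
  rwa [norm_neg, sub_neg_eq_add] at this

theorem ae_sum_abs_sub_le {v : B} (hv : NonnegAE ι v) {a b : PowerSeries (B →L[ℂ] B)} {M : ℝ}
    (hab : HasMass ι e (a - b) M) (m : ℕ) :
    ∀ᵐ y ∂μ, ∑ n ∈ Finset.range m,
      |(ι (PowerSeries.coeff n a v) y).re - (ι (PowerSeries.coeff n b v) y).re| ≤ ‖v‖ * M := by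
  have h1 : ∀ᵐ y ∂μ, ∀ n, ι (PowerSeries.coeff n (a - b) v) y
      = ι (PowerSeries.coeff n a v) y - ι (PowerSeries.coeff n b v) y :=
    ae_all_iff.2 fun n => by rw [map_sub, sub_apply]; exact ae_map_sub _ _
  have h2 : ∀ᵐ y ∂μ, ∀ n, 0 ≤ (ι (PowerSeries.coeff n (a - b) v) y).re :=
    ae_all_iff.2 fun n => (hab.pos n v hv).mono fun y hy => hy.1
  have h3 := hab.sum_sub (norm_nonneg v) (N := m) (f := fun _ => v) fun i _ =>
    h.nonnegAE_norm_smul_sub (hv.mono fun y hy => hy.2)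
  filter_upwards [h1, h2, h3, h.const_one,
    ae_map_sub (ι := ι) (((‖v‖ * M : ℝ) : ℂ) • e)
      (∑ n ∈ Finset.range m, PowerSeries.coeff n (a - b) v),
    ae_map_smul (ι := ι) ((‖v‖ * M : ℝ) : ℂ) e,
    ae_map_sum (ι := ι) (fun n => PowerSeries.coeff n (a - b) v) (Finset.range m)]
    with y h4 h5 h6 h7 h8 h9 h10
  rw [h8, h9, h10, h7, mul_one, Complex.sub_re, Complex.ofReal_re, Complex.re_sum, sub_nonneg] at h6
  refine (Finset.sum_le_sum fun n _ => le_of_eq ?_).trans h6.1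
  have h11 := h5 n
  rw [h4, Complex.sub_re] at h11 ⊢
  exact abs_of_nonneg h11

theorem ae_abs_increment_le (v : B) (b : PowerSeries (B →L[ℂ] B)) :
    ∀ᵐ y ∂μ, ∀ n, |(ι (PowerSeries.coeff (n + 1) b v) y).re - (ι (PowerSeries.coeff n b v) y).re|
      ≤ ‖PowerSeries.coeff (n + 1) b - PowerSeries.coeff n b‖ * ‖v‖ := by
  refine ae_all_iff.2 fun n => ?_
  filter_upwards [ae_map_sub (ι := ι) (PowerSeries.coeff (n + 1) b v) (PowerSeries.coeff n b v),
    ae_norm_le_of_norm_le h.norm_le (PowerSeries.coeff (n + 1) b v - PowerSeries.coeff n b v)]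
    with y h1 h2
  rw [← Complex.sub_re, ← h1]
  refine (Complex.abs_re_le_norm _).trans (h2.trans ?_)
  rw [← sub_apply]
  exact ContinuousLinearMap.le_opNorm _ _

variable [CompleteSpace B]

/-- The Laplace transform of the renewal sequence at almost every point. -/
theorem ae_hasSum_laplace (hH2 : HypothesisH2 Rn) (v : B) {x : ℝ} (hx : 0 < x) :
    ∀ᵐ y ∂μ, HasSum (fun n : ℕ => (ι (renewalOperator Rn n v) y).re * Real.exp (-(x * n)))
      (ι (Ring.inverse (renewalSymbol Rn 1 (Real.exp (-x) : ℝ)) v) y).re := by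
  set z : ℂ := ((Real.exp (-x) : ℝ) : ℂ) with hz
  have hzn : ‖z‖ < 1 := by
    rw [hz, Complex.norm_real, Real.norm_of_nonneg (Real.exp_pos _).le]
    exact Real.exp_lt_one_iff.2 (by linarith)
  obtain ⟨h1, h2⟩ := h.eval_renewal hH2 z hzn
  simp only [renewalPowerSeries, PowerSeries.coeff_mk] at h1 h2
  have h3 : Summable fun n : ℕ => ‖(z ^ n • renewalOperator Rn n) v‖ :=
    .of_nonneg_of_le (fun _ => norm_nonneg _) (fun n => ContinuousLinearMap.le_opNorm _ _)
      (h1.mul_right ‖v‖)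
  have h4 : HasSum (fun n : ℕ => (z ^ n • renewalOperator Rn n) v)
      (Ring.inverse (renewalSymbol Rn 1 z) v) := h2.mapL (ContinuousLinearMap.apply ℂ B v)
  have h5 : ∀ᵐ y ∂μ, ∀ n : ℕ, ι (z ^ n • renewalOperator Rn n v) y
      = z ^ n * ι (renewalOperator Rn n v) y := ae_all_iff.2 fun n => ae_map_smul _ _
  filter_upwards [ae_hasSum h.norm_le h3 h4, h5] with y h6 h7
  refine (Complex.hasSum_re h6).congr_fun fun n => ?_
  rw [smul_apply, h7, hz, ← Complex.ofReal_pow, Complex.re_ofReal_mul, ← Real.exp_nat_mul, mul_comm,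
    mul_neg, mul_comm (n : ℝ)]

theorem nonnegAE_renewalOperator {v : B} (hv : NonnegAE ι v) (n : ℕ) :
    NonnegAE ι (renewalOperator Rn n v) :=
  NonnegAE.renewalOperator h.nonnegAE_apply n v hv

theorem mean_nonneg {v : B} (hv : NonnegAE ι v) : 0 ≤ (h.mean v).re ∧ (h.mean v).im = 0 :=
  hv.setFunctional h.norm_le Set.univ

theorem ae_tendsto_partialSum (hH2 : HypothesisH2 Rn) {β : ℝ} (hβ0 : 0 < β) (hβ1 : β < 1)
    (hτ : IsRegVarTail (returnTail μ φ) β) {v : B} (hv : NonnegAE ι v) :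
    ∀ᵐ y ∂μ, ∀ k : ℕ, 1 ≤ k → Tendsto (fun N : ℕ => returnTail μ φ N
      * ∑ n ∈ Finset.range (k * N), (ι (renewalOperator Rn n v) y).re) atTop
      (𝓝 (Real.pi⁻¹ * Real.sin (β * Real.pi) * (h.mean v).re * ((k : ℝ) ^ β / β))) := by
  have h1 : ∀ᵐ y ∂μ, ∀ n, 0 ≤ (ι (renewalOperator Rn n v) y).re :=
    ae_all_iff.2 fun n => (h.nonnegAE_renewalOperator hv n).mono fun y hy => hy.1
  have h2 : ∀ᵐ y ∂μ, ∀ (q N : ℕ), 1 ≤ N →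
      HasSum (fun n : ℕ => (ι (renewalOperator Rn n v) y).re
        * Real.exp (-(((q : ℝ) + 1) / N * n)))
      (ι (Ring.inverse (renewalSymbol Rn 1 (Real.exp (-(((q : ℝ) + 1) / N)) : ℝ)) v) y).re := by
    refine ae_all_iff.2 fun q => ae_all_iff.2 fun N => ?_
    rw [eventually_imp_distrib_left]
    intro hN
    have : (0 : ℝ) < N := by exact_mod_cast hN
    exact h.ae_hasSum_laplace hH2 v (by positivity)
  have h3 : ∀ᵐ y ∂μ, ∀ q : ℕ, Tendsto (fun N : ℕ => ι ((returnTail μ φ N : ℂ)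
      • Ring.inverse (renewalSymbol Rn 1 (Real.exp (-(((q : ℝ) + 1) / N)) : ℝ)) v) y) atTop
      (𝓝 (ι ((((Real.Gamma (1 - β) * ((q : ℝ) + 1) ^ β : ℝ) : ℂ)⁻¹ * h.mean v) • e) y)) :=
    ae_all_iff.2 fun q => ae_tendsto h.norm_le
      ((h.tendsto_resolvent_real hH2 hβ0 hβ1 hτ (by positivity) v).comp
        tendsto_natCast_atTop_atTop)
  have h4 : ∀ᵐ y ∂μ, ∀ q N : ℕ, ι ((returnTail μ φ N : ℂ)
      • Ring.inverse (renewalSymbol Rn 1 (Real.exp (-(((q : ℝ) + 1) / N)) : ℝ)) v) y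
      = (returnTail μ φ N : ℂ)
        * ι (Ring.inverse (renewalSymbol Rn 1 (Real.exp (-(((q : ℝ) + 1) / N)) : ℝ)) v) y :=
    ae_all_iff.2 fun q => ae_all_iff.2 fun N => ae_map_smul _ _
  have h5 : ∀ᵐ y ∂μ, ∀ q : ℕ,
      ι ((((Real.Gamma (1 - β) * ((q : ℝ) + 1) ^ β : ℝ) : ℂ)⁻¹ * h.mean v) • e) y
      = (((Real.Gamma (1 - β) * ((q : ℝ) + 1) ^ β : ℝ) : ℂ)⁻¹ * h.mean v) * ι e y :=
    ae_all_iff.2 fun q => ae_map_smul _ _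
  have hΓ0 : 0 < Real.Gamma β := Real.Gamma_pos_of_pos hβ0
  have hΓ1 : 0 < Real.Gamma (1 - β) := Real.Gamma_pos_of_pos (by linarith)
  have hsin : 0 < Real.sin (β * Real.pi) :=
    Real.sin_pos_of_pos_of_lt_pi (by positivity) (by nlinarith [Real.pi_pos])
  have hpi := Real.pi_pos
  have hrefl := Real.Gamma_mul_Gamma_one_sub β
  rw [mul_comm Real.pi β, eq_div_iff hsin.ne'] at hrefl
  have hmean := h.mean_nonneg hv
  filter_upwards [h1, h2, h3, h4, h5, h.const_one] with y g1 g2 g3 g4 g5 g6 k hk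
  have hexp : ∀ q n N : ℕ, ((q : ℝ) + 1) / N * n = (q + 1) * (n / N) := fun q n N => by ring
  simp only [hexp] at g2
  refine tendsto_sum_of_laplace (τ := fun N : ℕ => returnTail μ φ N) g1 (fun N => (hτ.pos _).le) hβ0
    (mul_nonneg (by positivity) hmean.1) (fun N hN => ?_) (fun q => ?_) hk
  · simpa using (g2 0 N hN).summable
  · have g7 := (Complex.continuous_re.tendsto _).comp (g3 q)
    rw [g5, g6, mul_one, ← Complex.ofReal_inv, Complex.re_ofReal_mul] at g7
    have e1 : (Real.Gamma (1 - β) * ((q : ℝ) + 1) ^ β)⁻¹ * (h.mean v).re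
        = Real.pi⁻¹ * Real.sin (β * Real.pi) * (h.mean v).re
          * ((1 / ((q : ℝ) + 1)) ^ β * Real.Gamma β) := by
      rw [Real.div_rpow zero_le_one (by positivity), Real.one_rpow]
      have : Real.pi⁻¹ * Real.sin (β * Real.pi) * Real.Gamma β = (Real.Gamma (1 - β))⁻¹ := by
        have e2 : Real.pi⁻¹ * Real.sin (β * Real.pi) * Real.Gamma β * Real.Gamma (1 - β)
            = Real.pi⁻¹ * (Real.Gamma β * Real.Gamma (1 - β) * Real.sin (β * Real.pi)) := by ring
        refine eq_inv_of_mul_eq_one_left ?_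
        rw [e2, hrefl, inv_mul_cancel₀ hpi.ne']
      rw [mul_inv, ← this]
      ring
    rw [e1] at g7
    refine g7.congr' ?_
    filter_upwards [eventually_ge_atTop 1] with N hN
    simp only [Function.comp_apply]
    rw [g4, Complex.re_ofReal_mul, (g2 q N hN).tsum_eq]

theorem ae_exists_smoothing (hH2 : HypothesisH2 Rn) {β : ℝ} (hβ0 : 0 < β) (hβ1 : β < 1)
    (hτ : IsRegVarTail (returnTail μ φ) β) {v : B} (hv : NonnegAE ι v) :
    ∀ᵐ y ∂μ, ∀ δ : ℝ, 0 < δ → ∃ K : ℝ, 0 ≤ K ∧ ∀ᶠ N : ℕ in atTop, ∃ W : ℕ → ℝ,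
      ∑ n ∈ Finset.range (2 * N), |(ι (renewalOperator Rn n v) y).re - W n|
        ≤ δ / returnTail μ φ N ∧
      ∀ n, n < 2 * N → |W (n + 1) - W n| ≤ K / ((N : ℝ) ^ 2 * returnTail μ φ N) := by
  obtain ⟨p, hp⟩ := h.exists_increment_bound hH2 hβ0 hβ1 hτ
  have h1 : ∀ᵐ y ∂μ, ∀ D N : ℕ,
      (1 ≤ D ∧ 0 ≤ 1 - D * returnTail μ φ N ∧
      (1 - returnPowerSeries fun n => ((1 - D * returnTail μ φ N : ℝ) : ℂ) • Rn n)
        * renewalPowerSeries (fun n => ((1 - D * returnTail μ φ N : ℝ) : ℂ) • Rn n) = 1) →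
      ∑ n ∈ Finset.range (2 * N), |(ι (renewalOperator Rn n v) y).re
        - (ι (PowerSeries.coeff n (smoothedSeries Rn (1 - D * returnTail μ φ N) p) v) y).re|
        ≤ ‖v‖ * p / D / returnTail μ φ N := by
    refine ae_all_iff.2 fun D => ae_all_iff.2 fun N => ?_
    rw [eventually_imp_distrib_left]
    rintro ⟨hD, hs0, hs⟩
    have hD0 : (0 : ℝ) < D := by exact_mod_cast hD
    have ht0 : 0 < returnTail μ φ N := hτ.pos N
    have hDt : 0 < D * returnTail μ φ N := by positivity
    have hm := h.hasMass_sub hs0 (by linarith) hs p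
    filter_upwards [h.ae_sum_abs_sub_le hv hm (2 * N)] with y hy
    simp only [renewalPowerSeries, PowerSeries.coeff_mk] at hy
    refine hy.trans ?_
    rw [sub_sub_cancel, one_mul, div_div, mul_div_assoc]
    refine mul_le_mul_of_nonneg_left ?_ (norm_nonneg v)
    refine (mul_le_of_le_one_left (by positivity) (by linarith)).trans_eq ?_
    ring
  have h2 : ∀ᵐ y ∂μ, ∀ D N n : ℕ,
      |(ι (PowerSeries.coeff (n + 1) (smoothedSeries Rn (1 - D * returnTail μ φ N) p) v) y).re
        - (ι (PowerSeries.coeff n (smoothedSeries Rn (1 - D * returnTail μ φ N) p) v) y).re|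
      ≤ ‖PowerSeries.coeff (n + 1) (smoothedSeries Rn (1 - D * returnTail μ φ N) p)
          - PowerSeries.coeff n (smoothedSeries Rn (1 - D * returnTail μ φ N) p)‖ * ‖v‖ :=
    ae_all_iff.2 fun D => ae_all_iff.2 fun N => h.ae_abs_increment_le v _
  filter_upwards [h1, h2] with y g1 g2 δ hδ
  obtain ⟨D, hD⟩ := exists_nat_ge (max 1 (‖v‖ * p / δ))
  have hD1 : (1 : ℝ) ≤ D := (le_max_left _ _).trans hD
  have hD2 : ‖v‖ * p / δ ≤ D := (le_max_right _ _).trans hD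
  obtain ⟨M, hM, hev⟩ := hp D (by linarith)
  refine ⟨M * ‖v‖, by positivity, ?_⟩
  filter_upwards [hev] with N hN
  have ht0 : 0 < returnTail μ φ N := hτ.pos N
  refine ⟨_, (g1 D N ⟨by exact_mod_cast hD1, hN.1, hN.2.1⟩).trans ?_, fun n hn =>
    (g2 D N n).trans ?_⟩
  · gcongr
    rw [div_le_iff₀ hδ] at hD2
    rw [div_le_iff₀ (by linarith)]
    linarith
  · refine (mul_le_mul_of_nonneg_right (hN.2.2 n hn) (norm_nonneg v)).trans_eq ?_
    ring

theorem ae_hasDensityZero (hH2 : HypothesisH2 Rn) {β : ℝ} (hβ0 : 0 < β) (hβ1 : β < 1)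
    (hτ : IsRegVarTail (returnTail μ φ) β) {v : B} (hv : NonnegAE ι v) :
    ∀ᵐ y ∂μ, ∀ ε : ℝ, 0 < ε → HasDensityZero {n : ℕ |
      ε < |n * returnTail μ φ n * (ι (renewalOperator Rn n v) y).re
        - Real.pi⁻¹ * Real.sin (β * Real.pi) * (h.mean v).re|} := by
  have h1 : ∀ᵐ y ∂μ, ∀ n, 0 ≤ (ι (renewalOperator Rn n v) y).re :=
    ae_all_iff.2 fun n => (h.nonnegAE_renewalOperator hv n).mono fun y hy => hy.1
  filter_upwards [h1, h.ae_tendsto_partialSum hH2 hβ0 hβ1 hτ hv,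
    h.ae_exists_smoothing hH2 hβ0 hβ1 hτ hv] with y g1 g2 g3 ε hε
  exact hasDensityZero_deviation hβ0 hτ g1 g2 g3 hε

theorem ae_exists_densityZero_tendsto (hH2 : HypothesisH2 Rn) {β : ℝ} (hβ0 : 0 < β) (hβ1 : β < 1)
    (hτ : IsRegVarTail (returnTail μ φ) β) {v : B} (hv : ∀ᵐ y ∂μ, (ι v y).im = 0) :
    ∀ᵐ y ∂μ, ∃ E : Set ℕ, HasDensityZero E ∧
      Tendsto (fun n : ℕ => ((n * returnTail μ φ n : ℝ) : ℂ) * ι (renewalOperator Rn n v) y)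
        (atTop ⊓ 𝓟 Eᶜ)
        (𝓝 (((Real.pi⁻¹ * Real.sin (β * Real.pi) : ℝ) : ℂ) * h.mean v)) := by
  have hv₁ := h.nonnegAE_norm_smul_add hv
  have hv₂ := h.nonnegAE_one.smul (norm_nonneg v)
  set v₁ := (‖v‖ : ℂ) • e + v with hv₁def
  set v₂ := (‖v‖ : ℂ) • e with hv₂def
  have hvv : v = v₁ - v₂ := by rw [hv₁def, add_sub_cancel_left]
  have hsub : ∀ᵐ y ∂μ, ∀ n, ι (renewalOperator Rn n v) y
      = ι (renewalOperator Rn n v₁) y - ι (renewalOperator Rn n v₂) y :=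
    ae_all_iff.2 fun n => by rw [hvv, map_sub]; exact ae_map_sub _ _
  have him : ∀ᵐ y ∂μ, ∀ n, (ι (renewalOperator Rn n v₁) y).im = 0 ∧
      (ι (renewalOperator Rn n v₂) y).im = 0 :=
    ae_all_iff.2 fun n => ((h.nonnegAE_renewalOperator hv₁ n).mono fun y hy => hy.2).and
      ((h.nonnegAE_renewalOperator hv₂ n).mono fun y hy => hy.2)
  have hmean : h.mean v = ((h.mean v₁).re - (h.mean v₂).re : ℝ) := by
    have e1 : h.mean v = h.mean v₁ - h.mean v₂ := by rw [hvv, map_sub]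
    rw [e1]
    refine Complex.ext (by simp) ?_
    rw [Complex.sub_im, (h.mean_nonneg hv₁).2, (h.mean_nonneg hv₂).2, sub_zero, Complex.ofReal_im]
  filter_upwards [hsub, him, h.ae_hasDensityZero hH2 hβ0 hβ1 hτ hv₁,
    h.ae_hasDensityZero hH2 hβ0 hβ1 hτ hv₂] with y g1 g2 g3 g4
  set κ := Real.pi⁻¹ * Real.sin (β * Real.pi) with hκ
  obtain ⟨E, hE, hlim⟩ := exists_densityZero_tendsto
    (a := fun n : ℕ => n * returnTail μ φ n * ((ι (renewalOperator Rn n v₁) y).re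
      - (ι (renewalOperator Rn n v₂) y).re)) (c := κ * ((h.mean v₁).re - (h.mean v₂).re))
    fun ε hε => by
      refine ((g3 (ε / 2) (by positivity)).union (g4 (ε / 2) (by positivity))).mono fun n hn => ?_
      by_contra hcon
      simp only [Set.mem_union, Set.mem_ofPred_eq, not_or, not_lt] at hcon hn
      have h5 := abs_sub (n * returnTail μ φ n * (ι (renewalOperator Rn n v₁) y).re
        - κ * (h.mean v₁).re) (n * returnTail μ φ n * (ι (renewalOperator Rn n v₂) y).re
        - κ * (h.mean v₂).re)
      rw [show n * returnTail μ φ n * ((ι (renewalOperator Rn n v₁) y).re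
          - (ι (renewalOperator Rn n v₂) y).re) - κ * ((h.mean v₁).re - (h.mean v₂).re)
        = (n * returnTail μ φ n * (ι (renewalOperator Rn n v₁) y).re
        - κ * (h.mean v₁).re) - (n * returnTail μ φ n * (ι (renewalOperator Rn n v₂) y).re
        - κ * (h.mean v₂).re) by ring] at hn
      linarith [hcon.1, hcon.2]
  refine ⟨E, hE, ?_⟩
  rw [hmean, ← Complex.ofReal_mul]
  refine ((Complex.continuous_ofReal.tendsto _).comp hlim).congr fun n => ?_
  simp only [Function.comp_apply]
  rw [g1, Complex.ofReal_mul]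
  congr 1
  refine Complex.ext (by simp) ?_
  rw [Complex.sub_im, (g2 n).1, (g2 n).2, sub_zero, Complex.ofReal_im]

end IsReturnOperators

end Pointwise

theorem operator_renewal_zero_density_convergence
    {Y : Type*} [MeasurableSpace Y] (μ : Measure Y) [IsProbabilityMeasure μ]
    (F : Y → Y) (hF : MeasurePreserving F μ μ)
    (φ : Y → ℕ) (hφ_meas : Measurable φ) (hφ_pos : ∀ y, 1 ≤ φ y)
    (l : ℝ → ℝ) (hl : SlowlyVarying l) (β : ℝ) (hβ0 : 0 < β) (hβ : β ≤ 1 / 2)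
    (htail : ∀ n : ℕ, 1 ≤ n → μ.real {y | n < φ y} = l n * (n : ℝ) ^ (-β))
    -- the Banach space `𝓑 ⊆ L^∞(Y, μ)`, with its own complete norm, containing the constants
    {B : Type*} [NormedAddCommGroup B] [NormedSpace ℂ B] [CompleteSpace B]
    (ι : B →ₗ[ℂ] Lp ℂ ∞ μ) (hι_inj : Function.Injective ι) (hι_norm : ∀ v : B, ‖ι v‖ ≤ ‖v‖)
    (hι_one : ∃ e : B, ι e =ᵐ[μ] fun _ => (1 : ℂ))
    -- `R_n v = R (1_{φ = n} v)` maps `𝓑` boundedly into `𝓑`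
    (Rn : ℕ → B →L[ℂ] B)
    (hRn : ∀ n : ℕ, 1 ≤ n → ∀ v : B,
      ι (Rn n v) =ᵐ[μ] transferOperator μ F ({y | φ y = n}.indicator (ι v)))
    (hH1 : HypothesisH1 μ φ Rn) (hH2 : HypothesisH2 Rn)
    (v : B) (hv : ∀ᵐ y ∂μ, (ι v y).im = 0) :
    ∀ᵐ y ∂μ, ∃ E : Set ℕ, HasDensityZero E ∧
      Tendsto (fun n : ℕ => ((l n * (n : ℝ) ^ (1 - β) : ℝ) : ℂ) * ι (renewalOperator Rn n v) y)
        (atTop ⊓ 𝓟 Eᶜ)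
        (𝓝 (((Real.pi⁻¹ * Real.sin (β * Real.pi) : ℝ) : ℂ) * ∫ x, ι v x ∂μ)) := by
  obtain ⟨e, he⟩ := hι_one
  obtain ⟨C, hC, hbound⟩ := hH1
  have h : IsReturnOperators μ F φ ι Rn e C :=
    ⟨hF, hφ_meas, hφ_pos, hι_inj, hι_norm, he, hRn, hC.le, hbound⟩
  have htail' : ∀ n : ℕ, 1 ≤ n → returnTail μ φ n = l n * (n : ℝ) ^ (-β) := by
    intro n hn
    rw [← htail n hn, returnTail]
    simp only [Nat.cast_lt]
  have hτ : IsRegVarTail (returnTail μ φ) β :=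
    IsRegVarTail.of_slowlyVarying hl (returnTail_antitone μ) htail'
  filter_upwards [h.ae_exists_densityZero_tendsto hH2 hβ0 (by linarith) hτ hv] with y hy
  obtain ⟨E, hE, hlim⟩ := hy
  refine ⟨E, hE, ?_⟩
  rw [← h.mean_apply]
  refine hlim.congr' ?_
  filter_upwards [mem_inf_of_left (eventually_ge_atTop 1)] with n hn
  have hn0 : (0 : ℝ) < n := by exact_mod_cast hn
  have e1 : (n : ℝ) * returnTail μ φ n = l n * (n : ℝ) ^ (1 - β) := by
    rw [htail' n hn, Real.rpow_sub hn0, Real.rpow_one, Real.rpow_neg hn0.le]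
    ring
  rw [e1]
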